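/- arXiv:math/0301073 — 2 statements merged into one kernel-verified Lean document; each statement's English description precedes it below -/
import Mathlib

section
/- Let n, m ≥ 1 and r > 0, and consider the symplectic cylinder B_r^{2n} × ℝ^{2m} ⊂ ℝ^{2(n+m)}, where B_r^{2n} is the open ball of radius r centered at the origin in the first 2n coordinates and the splitting ℝ^{2(n+m)} = ℝ^{2n} × ℝ^{2m} is compatible with the standard symplectic structure. Then c_HZ(B_r^{2n} × ℝ^{2m}, {0}) = π r². -/
open scoped RealInnerProductSpace ENNReal NNReal Topology
open Metric Set

noncomputable section

/-- `ℝ^{2n}` identified with `ℂ^n`, with the standard (real) inner product and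
the standard complex structure `J` given by multiplication by `i`. -/
abbrev Esp (n : ℕ) := EuclideanSpace ℂ (Fin n)

variable {n : ℕ}

/-- The Hamiltonian vector field `X_H = J ∇H` of `H : ℝ^{2n} → ℝ`. -/
def hamVF (H : Esp n → ℝ) (x : Esp n) : Esp n := Complex.I • gradient H x

/-- A nonconstant `T`-periodic orbit of the Hamiltonian flow of `H`:
a nonconstant solution `γ` of `γ' = J∇H(γ)` with `γ (t + T) = γ t`. -/
def IsPeriodicOrbit (H : Esp n → ℝ) (γ : ℝ → Esp n) (T : ℝ) : Prop :=
  0 < T ∧ (∀ t, HasDerivAt γ (hamVF H (γ t)) t) ∧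
    (∀ t, γ (t + T) = γ t) ∧ ∃ t₀ t₁, γ t₀ ≠ γ t₁

/-- `H` has a fast (period `≤ 1`) nonconstant periodic orbit. -/
def HasFastOrbit (H : Esp n → ℝ) : Prop :=
  ∃ γ T, IsPeriodicOrbit H γ T ∧ T ≤ 1

/-- The symplectic action of a `1`-periodic loop `γ` with respect to the
(possibly time-dependent) Hamiltonian `H`:
`A_H(γ) = -(1/2)∫₀¹ ⟨Jγ(t), γ'(t)⟩ dt + ∫₀¹ H(t, γ(t)) dt`. -/
def action (H : ℝ → Esp n → ℝ) (γ : ℝ → Esp n) : ℝ :=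
  -(1 / 2) * (∫ t in (0:ℝ)..1, ⟪(Complex.I • γ t : Esp n), deriv γ t⟫) +
    ∫ t in (0:ℝ)..1, H t (γ t)

/-- The class `𝓗(V, Z)`: smooth functions on `ℝ^{2n}` with compact support
contained in `V`, constant on a neighborhood of `Z`, whose value on `Z` is the
maximum of `H`. -/
def InHclass (V Z : Set (Esp n)) (H : Esp n → ℝ) : Prop :=
  ContDiff ℝ (⊤ : ℕ∞) H ∧ IsCompact (tsupport H) ∧ tsupport H ⊆ V ∧
    (∃ U, IsOpen U ∧ Z ⊆ U ∧ ∃ c : ℝ, ∀ x ∈ U, H x = c) ∧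
    ∀ z ∈ Z, ∀ x, H x ≤ H z

/-- The relative Hofer–Zehnder capacity `c_HZ(V, Z)`: the supremum of `max H`
over all `H ∈ 𝓗(V, Z)` having no fast nonconstant periodic orbit (for `z ∈ Z`,
`H z = max H`). -/
def relCap (V Z : Set (Esp n)) : ℝ≥0∞ :=
  sSup {c | ∃ H, InHclass V Z H ∧ ¬ HasFastOrbit H ∧
    ∃ z ∈ Z, c = ENNReal.ofReal (H z)}

/-! Part 1 -/

section Brouwer
open MeasureTheory

variable {V : Type*} [NormedAddCommGroup V] [InnerProductSpace ℝ V] [FiniteDimensional ℝ V]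

lemma brw_interp (m : ℕ) (δ : ℝ) (hδ : 0 < δ) :
    ∃ (v l : Fin (m + 1) → ℝ), (∀ i, 0 ≤ v i ∧ v i ≤ δ) ∧ ∑ i, l i = 1 ∧
      ∀ p : Polynomial ℝ, p.natDegree ≤ m → p.eval 1 = ∑ i, l i * p.eval (v i) := by
  classical
  let v : Fin (m + 1) → ℝ := fun i => δ * (i : ℝ) / (m + 1)
  have hm : (0 : ℝ) < m + 1 := by positivity
  have hinj : Set.InjOn v (Finset.univ : Finset (Fin (m + 1))) := by
    intro i _ j _ hij
    simp only [v] at hij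
    field_simp at hij
    exact Fin.ext (by exact_mod_cast hij)
  refine ⟨v, fun i => (Lagrange.basis Finset.univ v i).eval 1, ?_, ?_, ?_⟩
  · intro i
    refine ⟨by positivity, ?_⟩
    simp only [v]
    rw [div_le_iff₀ hm]
    have : (i : ℝ) ≤ m + 1 := by exact_mod_cast i.2.le
    gcongr
  · have := Lagrange.sum_basis hinj Finset.univ_nonempty
    rw [← Polynomial.eval_finsetSum, this, Polynomial.eval_one]
  · intro p hp
    have hd : p.degree < (Finset.univ : Finset (Fin (m + 1))).card := by
      refine lt_of_le_of_lt Polynomial.degree_le_natDegree ?_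
      simp only [Finset.card_univ, Fintype.card_fin]
      exact_mod_cast Nat.lt_succ_of_le hp
    have h := Lagrange.eq_interpolate hinj hd
    conv_lhs => rw [h]
    rw [Lagrange.interpolate_apply, Polynomial.eval_finsetSum]
    simp [mul_comm]

lemma brw_det_poly (A : V →L[ℝ] V) :
    ∃ p : Polynomial ℝ, p.natDegree ≤ Module.finrank ℝ V ∧
      ∀ t : ℝ, p.eval t = (ContinuousLinearMap.id ℝ V + t • A).det := by
  classical
  let b := Module.finBasis ℝ V
  let M := LinearMap.toMatrix b b (A : V →ₗ[ℝ] V)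
  refine ⟨((Polynomial.X : Polynomial ℝ) • M.map Polynomial.C +
      (1 : Matrix (Fin (Module.finrank ℝ V)) (Fin (Module.finrank ℝ V)) ℝ).map Polynomial.C).det, ?_, ?_⟩
  · simpa using Polynomial.natDegree_det_X_add_C_le M 1
  · intro t
    have h1 : (ContinuousLinearMap.id ℝ V + t • A).det
        = (LinearMap.toMatrix b b ((ContinuousLinearMap.id ℝ V + t • A : V →L[ℝ] V) : V →ₗ[ℝ] V)).det := by
      rw [LinearMap.det_toMatrix]
    rw [h1, ← Polynomial.coe_evalRingHom, RingHom.map_det]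
    congr 1
    have h2 : ((ContinuousLinearMap.id ℝ V + t • A : V →L[ℝ] V) : V →ₗ[ℝ] V)
       = LinearMap.id + t • (A : V →ₗ[ℝ] V) := by ext; simp
    have h3 : LinearMap.toMatrix b b (LinearMap.id + t • (A : V →ₗ[ℝ] V)) = 1 + t • M := by
      rw [map_add, map_smul, LinearMap.toMatrix_id]
    rw [h2, h3]
    ext i j
    simp [Matrix.one_apply, add_comm, apply_ite]
    ring

lemma brw_poly (x y : V) (A : V →L[ℝ] V) (R : ℝ) (k : ℕ) :
    ∃ p : Polynomial ℝ, p.natDegree ≤ 2 * k + Module.finrank ℝ V ∧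
      ∀ t : ℝ, p.eval t = (R ^ 2 - ‖x + t • y‖ ^ 2) ^ k *
        (ContinuousLinearMap.id ℝ V + t • A).det := by
  obtain ⟨p, hp, hpe⟩ := brw_det_poly A
  let Q : Polynomial ℝ := Polynomial.C (R ^ 2 - ‖x‖ ^ 2) - Polynomial.C (2 * ⟪x, y⟫) * Polynomial.X
    - Polynomial.C (‖y‖ ^ 2) * Polynomial.X ^ 2
  have hQ : Q.natDegree ≤ 2 := by
    simp only [Q]; compute_degree
  refine ⟨Q ^ k * p, ?_, ?_⟩
  · refine Polynomial.natDegree_mul_le.trans ?_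
    refine add_le_add ?_ hp
    refine Polynomial.natDegree_pow_le.trans ?_
    nlinarith
  · intro t
    rw [Polynomial.eval_mul, Polynomial.eval_pow, hpe]
    congr 2
    rw [norm_add_sq_real]
    simp [Q, inner_smul_right, norm_smul, mul_pow]
    ring

lemma brw_ratio (a b c C : ℝ) (ha : 0 ≤ a) (hab : a < b) (hc : 0 < c)
    (h : ∀ k : ℕ, b ^ k * c ≤ a ^ k * C) : False := by
  have hb : 0 < b := lt_of_le_of_lt ha hab
  have h1 : Filter.Tendsto (fun k : ℕ => (a / b) ^ k * C) Filter.atTop (𝓝 (0 * C)) :=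
    (tendsto_pow_atTop_nhds_zero_of_lt_one (by positivity) ((div_lt_one hb).2 hab)).mul_const _
  have h2 : ∀ k : ℕ, c ≤ (a / b) ^ k * C := by
    intro k
    rw [div_pow, div_mul_eq_mul_div, le_div_iff₀ (by positivity)]
    linarith [h k, mul_comm c (b ^ k)]
  have := ge_of_tendsto' h1 h2
  simp at this
  linarith

variable [MeasurableSpace V] [BorelSpace V]

lemma brw_small (u : V → V) (hu : ContDiff ℝ 1 u) (C : ℝ≥0) (hC : LipschitzWith C u) (R : ℝ)
    (hR : ∀ x, R < ‖x‖ → u x = 0) (t : ℝ) (ht : 0 ≤ t) (htC : t * C < 1) (k : ℕ) :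
    ∫ x in closedBall (0 : V) R, (R ^ 2 - ‖x + t • u x‖ ^ 2) ^ k *
        (ContinuousLinearMap.id ℝ V + t • fderiv ℝ u x).det
      = ∫ x in closedBall (0 : V) R, (R ^ 2 - ‖x‖ ^ 2) ^ k := by
  have hinj : Function.Injective (fun x => x + t • u x) := by
    intro x y hxy
    simp only at hxy
    have h1 : x - y = t • (u y - u x) := by
      rw [smul_sub]; rw [← sub_eq_zero] at hxy ⊢; rw [← hxy]; abel
    have h2 : ‖x - y‖ ≤ t * C * ‖x - y‖ := by
      conv_lhs => rw [h1, norm_smul, Real.norm_of_nonneg ht]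
      rw [mul_assoc]
      gcongr
      have := hC.dist_le_mul y x
      rwa [dist_eq_norm, dist_eq_norm, norm_sub_rev y x] at this
    have h3 : ‖x - y‖ = 0 := by nlinarith [norm_nonneg (x - y)]
    exact sub_eq_zero.1 (norm_eq_zero.1 h3)
  have hsurj : Function.Surjective (fun x => x + t • u x) := by
    intro y
    have hct : ContractingWith (t.toNNReal * C) (fun x => y - t • u x) := by
      refine ⟨by rw [← NNReal.coe_lt_coe]; push_cast; rwa [Real.coe_toNNReal t ht], ?_⟩
      refine LipschitzWith.of_dist_le_mul fun a b => ?_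
      rw [dist_sub_left, dist_smul₀, Real.norm_of_nonneg ht]
      push_cast
      rw [Real.coe_toNNReal t ht, mul_assoc]
      gcongr
      exact hC.dist_le_mul a b
    refine ⟨hct.fixedPoint, ?_⟩
    have := hct.fixedPoint_isFixedPt
    simp only [Function.IsFixedPt] at this
    exact (eq_sub_iff_add_eq.1 this.symm)
  have himg : (fun x => x + t • u x) '' closedBall (0 : V) R = closedBall (0 : V) R := by
    have hout : ∀ x, R < ‖x‖ → x + t • u x = x := fun x hx => by simp [hR x hx]
    apply Set.Subset.antisymm
    · rintro _ ⟨x, hx, rfl⟩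
      by_contra hcon
      simp only [mem_closedBall, dist_zero_right, not_le] at hcon hx
      have h4 : x + t • u x = x := hinj (hout _ hcon)
      rw [h4] at hcon
      linarith
    · intro y hy
      obtain ⟨x, hx⟩ := hsurj y
      refine ⟨x, ?_, hx⟩
      by_contra hcon
      simp only [mem_closedBall, dist_zero_right, not_le] at hcon hy
      simp only at hx
      rw [hout x hcon] at hx
      rw [hx] at hcon
      linarith
  have hdu : Differentiable ℝ u := hu.differentiable (by simp)
  have hdet : ∀ x, 0 < (ContinuousLinearMap.id ℝ V + t • fderiv ℝ u x).det := by
    intro x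
    obtain ⟨p, -, hp⟩ := brw_det_poly (fderiv ℝ u x)
    have hnz : ∀ s ∈ Set.Icc 0 t, p.eval s ≠ 0 := by
      intro s hs h0
      rw [hp] at h0
      have hn : ‖fderiv ℝ u x‖ ≤ C := norm_fderiv_le_of_lipschitz ℝ hC
      have hker : LinearMap.ker ((ContinuousLinearMap.id ℝ V + s • fderiv ℝ u x : V →L[ℝ] V) : V →ₗ[ℝ] V) = ⊥ := by
        rw [LinearMap.ker_eq_bot']
        intro w hw
        have h1 : w = -(s • fderiv ℝ u x w) := by
          rw [eq_neg_iff_add_eq_zero]; simpa using hw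
        have h2 : ‖w‖ ≤ t * C * ‖w‖ := by
          conv_lhs => rw [h1, norm_neg, norm_smul, Real.norm_of_nonneg hs.1]
          rw [mul_assoc]
          gcongr
          · exact hs.2
          · exact (ContinuousLinearMap.le_opNorm _ _).trans (by gcongr)
        have h3 : ‖w‖ = 0 := by nlinarith [norm_nonneg w]
        exact norm_eq_zero.1 h3
      have := LinearMap.isUnit_det _ ((LinearMap.isUnit_iff_ker_eq_bot _).2 hker)
      exact this.ne_zero h0
    rw [← hp]
    by_contra hneg
    push Not at hneg
    have h0 : p.eval 0 = 1 := by rw [hp]; simp [ContinuousLinearMap.det]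
    have := intermediate_value_Icc' ht (p.continuous.continuousOn (s := Set.Icc 0 t))
    obtain ⟨s, hs, hs0⟩ := this ⟨hneg, by rw [h0]; norm_num⟩
    exact hnz s hs hs0
  have key := integral_image_eq_integral_abs_det_fderiv_smul (volume : Measure V)
    (s := closedBall (0 : V) R) (f := fun x => x + t • u x)
    (f' := fun x => ContinuousLinearMap.id ℝ V + t • fderiv ℝ u x) measurableSet_closedBall
    (fun x _ => ((hasFDerivAt_id x).add ((hdu x).hasFDerivAt.const_smul t)).hasFDerivWithinAt)
    hinj.injOn (fun y => (R ^ 2 - ‖y‖ ^ 2) ^ k)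
  rw [himg] at key
  rw [key]
  refine integral_congr_ae (Filter.Eventually.of_forall fun x => ?_)
  simp only [smul_eq_mul]
  rw [abs_of_pos (hdet x), mul_comm]

lemma brw_smooth (u : V → V) (hu : ContDiff ℝ 1 u) (hs : HasCompactSupport u) (ε : ℝ)
    (hε : 0 < ε) : ∃ x, ‖x + u x‖ < ε := by
  by_contra hcon
  push Not at hcon
  obtain ⟨K, hK⟩ := ContDiff.lipschitzWith_of_hasCompactSupport hs hu (by simp)
  obtain ⟨C, hC⟩ := hs.exists_bound_of_continuous hu.continuous
  obtain ⟨R0, hR0⟩ := hs.isCompact.isBounded.subset_closedBall (0 : V)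
  have hR0' : ∀ x, R0 < ‖x‖ → u x = 0 := by
    intro x hx
    by_contra hne
    have := hR0 (subset_tsupport u hne)
    simp at this
    linarith
  set R : ℝ := max R0 0 + C with hRdef
  have hC0 : 0 ≤ C := (norm_nonneg _).trans (hC 0)
  have hRR : R0 ≤ R := by have := le_max_left R0 0; linarith
  have hR : ∀ x, R < ‖x‖ → u x = 0 := fun x hx => hR0' x (by linarith)
  have hGR : ∀ x, ‖x‖ ≤ R → ‖x + u x‖ ≤ R := by
    intro x hx
    rcases le_or_gt ‖x‖ R0 with h | h
    · calc ‖x + u x‖ ≤ ‖x‖ + ‖u x‖ := norm_add_le _ _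
        _ ≤ max R0 0 + C := add_le_add (h.trans (le_max_left _ _)) (hC x)
    · rw [hR0' x h, add_zero]; exact hx
  have hRnn : 0 ≤ R := by positivity
  have hεR : ε ≤ R := (hcon 0).trans (hGR 0 (by simpa using hRnn))
  have hRpos : 0 < R := by linarith
  let B := closedBall (0 : V) R
  have hBc : IsCompact B := isCompact_closedBall _ _
  have hcd : Continuous (fun x => fderiv ℝ u x) := hu.continuous_fderiv (by simp)
  have hcont : ∀ (k : ℕ) (t : ℝ), Continuous (fun x => (R ^ 2 - ‖x + t • u x‖ ^ 2) ^ k *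
        (ContinuousLinearMap.id ℝ V + t • fderiv ℝ u x).det) := by
    intro k t
    have h1 := hu.continuous
    have h2 : Continuous (fun x => (ContinuousLinearMap.id ℝ V + t • fderiv ℝ u x).det) :=
      ContinuousLinearMap.continuous_det.comp (by fun_prop)
    fun_prop
  have hmain : ∀ k : ℕ, ∫ x in B, (R ^ 2 - ‖x + (1 : ℝ) • u x‖ ^ 2) ^ k *
        (ContinuousLinearMap.id ℝ V + (1 : ℝ) • fderiv ℝ u x).det
      = ∫ x in B, (R ^ 2 - ‖x‖ ^ 2) ^ k := by
    intro k
    obtain ⟨v, l, hv, hl, hvl⟩ := brw_interp (2 * k + Module.finrank ℝ V) (1 / (K + 1)) (by positivity)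
    have hpt : ∀ x, (R ^ 2 - ‖x + (1 : ℝ) • u x‖ ^ 2) ^ k *
        (ContinuousLinearMap.id ℝ V + (1 : ℝ) • fderiv ℝ u x).det = ∑ i, l i *
        ((R ^ 2 - ‖x + v i • u x‖ ^ 2) ^ k *
        (ContinuousLinearMap.id ℝ V + v i • fderiv ℝ u x).det) := by
      intro x
      obtain ⟨p, hp, hpe⟩ := brw_poly x (u x) (fderiv ℝ u x) R k
      have := hvl p hp
      simpa only [hpe] using this
    simp_rw [hpt]
    rw [integral_finsetSum]
    · simp_rw [integral_const_mul]
      have : ∀ i, ∫ x in B, ((R ^ 2 - ‖x + v i • u x‖ ^ 2) ^ k *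
        (ContinuousLinearMap.id ℝ V + v i • fderiv ℝ u x).det) = ∫ x in B, (R ^ 2 - ‖x‖ ^ 2) ^ k := by
        intro i
        refine brw_small u hu K hK R hR (v i) (hv i).1 ?_ k
        have h1 := (hv i).2
        calc v i * K ≤ 1 / (K + 1) * K := by gcongr
          _ < 1 := by rw [div_mul_eq_mul_div, div_lt_one (by positivity)]; linarith
      simp_rw [this]
      rw [← Finset.sum_mul, hl, one_mul]
    · intro i _
      exact ((hcont k (v i)).continuousOn.integrableOn_compact hBc).const_mul _
  let C' : ℝ := ∫ x in B, |(ContinuousLinearMap.id ℝ V + (1 : ℝ) • fderiv ℝ u x).det|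
  let c : ℝ := (volume : Measure V).real (ball (0 : V) (ε / 2))
  have hc : 0 < c := by
    refine ENNReal.toReal_pos (measure_ball_pos _ _ (by positivity)).ne' measure_ball_lt_top.ne
  refine brw_ratio (R ^ 2 - ε ^ 2) (R ^ 2 - (ε / 2) ^ 2) c C' (by nlinarith) (by nlinarith) hc ?_
  intro k
  have hlow : (R ^ 2 - (ε / 2) ^ 2) ^ k * c ≤ ∫ x in B, (R ^ 2 - ‖x‖ ^ 2) ^ k := by
    have hci : IntegrableOn (fun x : V => (R ^ 2 - ‖x‖ ^ 2) ^ k) B volume :=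
      Continuous.continuousOn (by fun_prop) |>.integrableOn_compact hBc
    have hsub : ball (0 : V) (ε / 2) ⊆ B := by
      intro x hx; simp only [B, mem_closedBall, mem_ball, dist_zero_right] at *; linarith
    calc (R ^ 2 - (ε / 2) ^ 2) ^ k * c = ∫ x in ball (0 : V) (ε / 2), (R ^ 2 - (ε / 2) ^ 2) ^ k := by
          rw [setIntegral_const, smul_eq_mul, mul_comm]
      _ ≤ ∫ x in ball (0 : V) (ε / 2), (R ^ 2 - ‖x‖ ^ 2) ^ k := by
          refine setIntegral_mono_on (integrableOn_const (measure_ball_lt_top.ne)) (hci.mono_set hsub) measurableSet_ball ?_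
          intro x hx
          simp only [mem_ball, dist_zero_right] at hx
          have := norm_nonneg x
          apply pow_le_pow_left₀
          · nlinarith
          · nlinarith
      _ ≤ _ := by
          refine setIntegral_mono_set hci ?_ hsub.eventuallyLE
          refine (ae_restrict_iff' measurableSet_closedBall).2 (Filter.Eventually.of_forall fun x hx => ?_)
          simp only [mem_closedBall, dist_zero_right] at hx
          have := norm_nonneg x
          apply pow_nonneg
          nlinarith
  refine hlow.trans ?_
  rw [← hmain k, ← integral_const_mul]
  refine setIntegral_mono_on ((hcont k 1).continuousOn.integrableOn_compact hBc) ?_ measurableSet_closedBall ?_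
  · refine Continuous.continuousOn (f := fun x => (R ^ 2 - ε ^ 2) ^ k * |(ContinuousLinearMap.id ℝ V + (1 : ℝ) • fderiv ℝ u x).det|) ?_ |>.integrableOn_compact hBc
    have := (hcont 0 1).abs
    simp only [pow_zero, one_mul] at this
    exact continuous_const.mul this
  · intro x hx
    simp only [B, mem_closedBall, dist_zero_right] at hx
    have h1 := hGR x hx
    have h2 := hcon x
    rw [one_smul]
    refine (le_abs_self _).trans ?_
    rw [abs_mul]
    gcongr
    rw [abs_of_nonneg (by apply pow_nonneg; nlinarith)]
    apply pow_le_pow_left₀ <;> nlinarith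

end Brouwer

lemma brw_zero {V : Type*} [NormedAddCommGroup V] [InnerProductSpace ℝ V] [FiniteDimensional ℝ V]
    (G : V → V) (hG : Continuous G) (R : ℝ) (hR : ∀ x, R ≤ ‖x‖ → G x = x) :
    ∃ x, G x = 0 := by
  borelize V
  have hsup : HasCompactSupport (fun x => G x - x) := by
    refine HasCompactSupport.of_support_subset_isCompact (isCompact_closedBall (0 : V) R) ?_
    intro x hx
    by_contra hc
    simp only [mem_closedBall, dist_zero_right, not_le] at hc
    exact hx (by simp [hR x hc.le])
  have happ : ∀ ε : ℝ, 0 < ε → ∃ x, ‖G x‖ < ε := by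
    intro ε hε
    obtain ⟨u, hu1, hu2, hu3⟩ := Continuous.exists_contDiff_approx (f := fun x => G x - x)
      (ε := fun _ => ε / 2) 1 (by fun_prop) (by fun_prop) (fun _ => by positivity)
    obtain ⟨x, hx⟩ := brw_smooth u hu1 (hsup.mono hu3) (ε / 2) (by positivity)
    refine ⟨x, ?_⟩
    have := hu2 x
    rw [dist_eq_norm] at this
    calc ‖G x‖ = ‖(x + u x) - (u x - (G x - x))‖ := by congr 1; abel
      _ ≤ _ := norm_sub_le _ _
      _ < ε := by linarith
  -- compactness
  set R' := max R 1
  have hcomp : IsCompact (closedBall (0 : V) R') := isCompact_closedBall _ _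
  obtain ⟨x0, hx0, hmin⟩ := hcomp.exists_isMinOn ⟨0, by simp [R']⟩ hG.norm.continuousOn
  refine ⟨x0, ?_⟩
  by_contra hne
  have hpos : 0 < ‖G x0‖ := norm_pos_iff.2 hne
  obtain ⟨x, hx⟩ := happ (min ‖G x0‖ 1) (by positivity)
  have h1 := lt_min_iff.1 hx
  by_cases hxR : ‖x‖ ≤ R'
  · have := hmin (show x ∈ closedBall (0 : V) R' by simpa using hxR)
    simp only [mem_ofPred_eq] at this
    linarith
  · push Not at hxR
    have := hR x ((le_max_left _ _).trans hxR.le)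
    rw [this] at h1
    have := (le_max_right R 1).trans hxR.le
    linarith

/-- A continuous self-map of a finite-dimensional space equal to the identity outside of
a bounded set is surjective. -/
lemma brw_surj {W : Type*} [NormedAddCommGroup W] [NormedSpace ℝ W] [FiniteDimensional ℝ W]
    (G : W → W) (hG : Continuous G) (R : ℝ) (hR : ∀ x, R ≤ ‖x‖ → G x = x) (p : W) :
    ∃ x, G x = p := by
  let Φ : W ≃L[ℝ] EuclideanSpace ℝ (Fin (Module.finrank ℝ W)) := toEuclidean
  obtain ⟨C, hC⟩ := (Φ.symm : EuclideanSpace ℝ (Fin (Module.finrank ℝ W)) →L[ℝ] W).isBoundedLinearMap.bound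
  obtain ⟨hC0, hC⟩ := hC
  obtain ⟨y, hy⟩ := brw_zero (fun y => Φ (G (Φ.symm y + p) - p)) (by fun_prop)
    (C * (|R| + ‖p‖) + ‖(Φ : W →L[ℝ] EuclideanSpace ℝ (Fin (Module.finrank ℝ W)))‖ * (|R| + ‖p‖)) (by
      intro y hy
      have h1 : R ≤ ‖Φ.symm y + p‖ := by
        by_contra hlt
        push Not at hlt
        have h2 : ‖Φ.symm y‖ < |R| + ‖p‖ := by
          calc ‖Φ.symm y‖ = ‖(Φ.symm y + p) - p‖ := by simp
            _ ≤ ‖Φ.symm y + p‖ + ‖p‖ := norm_sub_le _ _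
            _ < |R| + ‖p‖ := by linarith [le_abs_self R]
        have h3 : ‖y‖ ≤ ‖(Φ : W →L[ℝ] EuclideanSpace ℝ (Fin (Module.finrank ℝ W)))‖ * ‖Φ.symm y‖ := by
          simpa using (Φ : W →L[ℝ] EuclideanSpace ℝ (Fin (Module.finrank ℝ W))).le_opNorm (Φ.symm y)
        have h4 : 0 < C * (|R| + ‖p‖) := by
          have : 0 < |R| + ‖p‖ := (norm_nonneg _).trans_lt h2
          positivity
        have h5 : ‖(Φ : W →L[ℝ] EuclideanSpace ℝ (Fin (Module.finrank ℝ W)))‖ * ‖Φ.symm y‖ ≤ ‖(Φ : W →L[ℝ] EuclideanSpace ℝ (Fin (Module.finrank ℝ W)))‖ * (|R| + ‖p‖) := by gcongr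
        linarith
      simp [hR _ h1])
  refine ⟨Φ.symm y + p, ?_⟩
  have : G (Φ.symm y + p) - p = 0 := Φ.map_eq_zero_iff.1 hy
  exact sub_eq_zero.1 this

/-! Part 2 -/

/-- Abstract linking theorem in finite dimension. -/
lemma linking {E : Type*} [NormedAddCommGroup E] [InnerProductSpace ℝ E] [FiniteDimensional ℝ E]
    {Y : Type*} [NormedAddCommGroup Y] [NormedSpace ℝ Y] [FiniteDimensional ℝ Y]
    (j : Y →L[ℝ] E) (P : E →L[ℝ] Y) (hPj : ∀ y, P (j y) = y) (e : E) (hPe : P e = 0)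
    (w : E → ℝ) (hw : Continuous w) (hwe : ∀ y s, w (j y + s • e) = |s|)
    (Φ : E → ℝ) (hΦ : Continuous Φ) (g : E → E) (hg : Continuous g) (L : ℝ) (hL : 0 < L)
    (hT : ∀ x h, Φ (x + h) ≤ Φ x + ⟪g x, h⟫ + L * ‖h‖ ^ 2)
    (η C : ℝ) (hη : 0 < η) (hgrow : ∀ x, η * ‖x‖ - C ≤ ‖g x‖)
    (τ : ℝ) (h0 : ∀ y, Φ (j y) ≤ 0)
    (hτ : ∀ y s, 0 ≤ s → τ ≤ ‖((y, s) : Y × ℝ)‖ → Φ (j y + s • e) ≤ 0)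
    (ρ β : ℝ) (hρ : 0 < ρ) (hβ : 0 < β) (hΓ : ∀ x, P x = 0 → w x = ρ → β ≤ Φ x) :
    ∃ x, g x = 0 ∧ β ≤ Φ x := by
  by_contra hcon
  push Not at hcon
  -- lower bound on the gradient
  obtain ⟨η1, hη1, hgeta⟩ : ∃ η1 > 0, ∀ x, β ≤ Φ x → η1 ≤ ‖g x‖ := by
    set R := (|C| + 1) / η
    have hcomp : IsCompact (closedBall (0 : E) R ∩ {x | β ≤ Φ x}) :=
      (isCompact_closedBall _ _).inter_right (isClosed_le continuous_const hΦ)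
    have hbig : ∀ x, R < ‖x‖ → 1 ≤ ‖g x‖ := by
      intro x hx
      have := hgrow x
      rw [div_lt_iff₀ hη] at hx
      linarith [le_abs_self C, mul_comm η ‖x‖]
    rcases (closedBall (0 : E) R ∩ {x | β ≤ Φ x}).eq_empty_or_nonempty with he | hne
    · refine ⟨1, one_pos, fun x hx => hbig x ?_⟩
      by_contra hle
      have : x ∈ closedBall (0 : E) R ∩ {x | β ≤ Φ x} := ⟨by simpa using hle, hx⟩
      rw [he] at this
      exact this
    · obtain ⟨x0, hx0, hmin⟩ := hcomp.exists_isMinOn hne hg.norm.continuousOn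
      have hpos : 0 < ‖g x0‖ := norm_pos_iff.2 fun h => absurd hx0.2 (not_le.2 (hcon x0 h))
      refine ⟨min ‖g x0‖ 1, by positivity, fun x hx => ?_⟩
      by_cases hxR : ‖x‖ ≤ R
      · have h1 := hmin (show x ∈ closedBall (0 : E) R ∩ {x | β ≤ Φ x} from ⟨by simpa using hxR, hx⟩)
        exact (min_le_left _ _).trans h1
      · exact (min_le_right _ _).trans (hbig x (not_le.1 hxR))
  -- the deformation
  set δ : ℝ := 1 / (2 * L) with hδ
  have hδpos : 0 < δ := by positivity
  let χ : ℝ → ℝ := fun s => min (max (s / β) 0) 1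
  have hχc : Continuous χ := by fun_prop
  have hχ0 : ∀ s, 0 ≤ χ s := fun s => le_min (le_max_right _ _) zero_le_one
  have hχ1 : ∀ s, χ s ≤ 1 := fun s => min_le_right _ _
  have hχneg : ∀ s, s ≤ 0 → χ s = 0 := by
    intro s hs
    have : s / β ≤ 0 := div_nonpos_of_nonpos_of_nonneg hs hβ.le
    simp [χ, max_eq_right this]
  have hχbig : ∀ s, β ≤ s → χ s = 1 := by
    intro s hs
    have : 1 ≤ s / β := by rwa [le_div_iff₀ hβ, one_mul]
    simp only [χ]
    exact min_eq_right (this.trans (le_max_left _ _))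
  let ψ : E → E := fun x => x + (-(δ * χ (Φ x))) • g x
  have hψc : Continuous ψ := by fun_prop
  have hψdec : ∀ x, Φ (ψ x) ≤ Φ x - δ / 2 * χ (Φ x) * ‖g x‖ ^ 2 := by
    intro x
    have h1 := hT x ((-(δ * χ (Φ x))) • g x)
    rw [inner_smul_right, real_inner_self_eq_norm_sq, norm_smul, mul_pow, Real.norm_eq_abs, sq_abs] at h1
    have h2 : L * δ = 1 / 2 := by rw [hδ]; field_simp
    have h3 : L * ((-(δ * χ (Φ x))) ^ 2 * ‖g x‖ ^ 2) ≤ δ / 2 * χ (Φ x) * ‖g x‖ ^ 2 := by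
      have : L * ((-(δ * χ (Φ x))) ^ 2 * ‖g x‖ ^ 2) = (L * δ) * δ * (χ (Φ x)) ^ 2 * ‖g x‖ ^ 2 := by ring
      rw [this, h2]
      have h4 : (χ (Φ x)) ^ 2 ≤ χ (Φ x) := by nlinarith [hχ0 (Φ x), hχ1 (Φ x)]
      have h5 : 0 ≤ δ / 2 * ‖g x‖ ^ 2 := by positivity
      nlinarith
    calc Φ (ψ x) ≤ _ := h1
      _ ≤ _ := by nlinarith
  have hψle : ∀ x, Φ (ψ x) ≤ Φ x := by
    intro x
    have := hψdec x
    have h5 : 0 ≤ δ / 2 * χ (Φ x) * ‖g x‖ ^ 2 := by have := hχ0 (Φ x); positivity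
    linarith
  have hψfix : ∀ x, Φ x ≤ 0 → ψ x = x := by
    intro x hx; simp [ψ, hχneg _ hx]
  have hψit_c : ∀ k, Continuous (ψ^[k]) := fun k => hψc.iterate k
  have hψit_fix : ∀ k x, Φ x ≤ 0 → ψ^[k] x = x := fun k x hx =>
    Function.iterate_fixed (hψfix x hx) k
  have hψit : ∀ k x, Φ (ψ^[k] x) < β ∨ Φ (ψ^[k] x) ≤ Φ x - k * (δ / 2 * η1 ^ 2) := by
    intro k x
    induction k with
    | zero => right; simp
    | succ k ih =>
      rw [Function.iterate_succ_apply']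
      by_cases hb : Φ (ψ^[k] x) < β
      · left; exact (hψle _).trans_lt hb
      · right
        push Not at hb
        have h1 := ih.resolve_left (not_lt.2 hb)
        have h2 := hψdec (ψ^[k] x)
        rw [hχbig _ hb] at h2
        have h3 : η1 ^ 2 ≤ ‖g (ψ^[k] x)‖ ^ 2 := by
          have := hgeta _ hb
          gcongr
        push_cast
        nlinarith
  -- uniform bound on the half ball
  let ι : Y × ℝ → E := fun p => j p.1 + (max p.2 0) • e
  have hιc : Continuous ι := by fun_prop
  have hιneg : ∀ p : Y × ℝ, p.2 ≤ 0 → ι p = j p.1 := by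
    intro p hp; simp [ι, max_eq_right hp]
  have hout : ∀ p : Y × ℝ, τ ≤ ‖p‖ → Φ (ι p) ≤ 0 := by
    intro p hp
    rcases le_or_gt p.2 0 with h | h
    · rw [hιneg p h]; exact h0 _
    · simp only [ι, max_eq_left h.le]
      exact hτ p.1 p.2 h.le hp
  obtain ⟨M, hM⟩ : ∃ M, ∀ p, Φ (ι p) ≤ M := by
    obtain ⟨M, hM⟩ := (isCompact_closedBall (0 : Y × ℝ) τ).bddAbove_image (hΦ.comp hιc).continuousOn
    refine ⟨max M 0, fun p => ?_⟩
    by_cases hp : ‖p‖ ≤ τ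
    · exact (hM ⟨p, by simpa using hp, rfl⟩).trans (le_max_left _ _)
    · exact (hout p (not_le.1 hp).le).trans (le_max_right _ _)
  obtain ⟨k, hk⟩ := exists_nat_gt (M / (δ / 2 * η1 ^ 2))
  have hkβ : ∀ p, Φ (ψ^[k] (ι p)) < β := by
    intro p
    rcases hψit k (ι p) with h | h
    · exact h
    · rw [div_lt_iff₀ (by positivity)] at hk
      linarith [hM p]
  let G : Y × ℝ → Y × ℝ := fun p => (P (ψ^[k] (ι p)), w (ψ^[k] (ι p)) - max (-p.2) 0)
  have hGc : Continuous G := by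
    have := hψit_c k
    fun_prop
  have hGid : ∀ p, Φ (ι p) ≤ 0 → G p = p := by
    intro p hp
    simp only [G]
    rw [hψit_fix k _ hp]
    simp only [ι, map_add, map_smul, hPj, hPe, hwe]
    ext
    · simp
    · simp only
      rcases le_total p.2 0 with h | h
      · rw [max_eq_right h, max_eq_left (by linarith)]; simp
      · rw [max_eq_left h, max_eq_right (by linarith), abs_of_nonneg h]; simp
  obtain ⟨p, hp⟩ := brw_surj G hGc τ (fun p hp => hGid p (hout p hp)) (0, ρ)
  have hp1 : P (ψ^[k] (ι p)) = 0 := congrArg Prod.fst hp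
  have hp2 : w (ψ^[k] (ι p)) - max (-p.2) 0 = ρ := congrArg Prod.snd hp
  have hpos : 0 ≤ p.2 := by
    by_contra hneg
    push Not at hneg
    have := hGid p (by rw [hιneg p hneg.le]; exact h0 _)
    rw [hp] at this
    rw [← this] at hneg
    simp only at hneg
    linarith
  rw [max_eq_right (by linarith), sub_zero] at hp2
  exact absurd (hΓ _ hp1 hp2) (not_le.2 (hkβ p))

/-! Part 3 -/

section FourierBasics
open MeasureTheory intervalIntegral

/-- The character `t ↦ exp (2 π i k t)`. -/
def ee (k : ℤ) (t : ℝ) : ℂ := Complex.exp (2 * Real.pi * Complex.I * k * t)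

lemma ee_continuous (k : ℤ) : Continuous (ee k) := by unfold ee; fun_prop

lemma ee_zero (t : ℝ) : ee 0 t = 1 := by simp [ee]

lemma ee_add (k l : ℤ) (t : ℝ) : ee (k + l) t = ee k t * ee l t := by
  simp only [ee, ← Complex.exp_add]; congr 1; push_cast; ring

lemma ee_conj (k : ℤ) (t : ℝ) : (starRingEnd ℂ) (ee k t) = ee (-k) t := by
  simp only [ee, ← Complex.exp_conj]; congr 1
  have h2 : (starRingEnd ℂ) 2 = 2 := Complex.conj_ofNat 2
  simp [map_mul, Complex.conj_ofReal, h2]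

lemma ee_norm (k : ℤ) (t : ℝ) : ‖ee k t‖ = 1 := by
  have : (2 * Real.pi * Complex.I * k * t : ℂ) = ((2 * Real.pi * k * t : ℝ) : ℂ) * Complex.I := by
    push_cast; ring
  rw [ee, this, Complex.norm_exp_ofReal_mul_I]

lemma ee_periodic (k : ℤ) (t : ℝ) : ee k (t + 1) = ee k t := by
  simp only [ee]
  have : (2 * Real.pi * Complex.I * k * ((t + 1 : ℝ) : ℂ) : ℂ)
      = 2 * Real.pi * Complex.I * k * t + k * (2 * Real.pi * Complex.I) := by push_cast; ring
  rw [this, Complex.exp_add, Complex.exp_int_mul_two_pi_mul_I, mul_one]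

lemma ee_hasDerivAt (k : ℤ) (t : ℝ) :
    HasDerivAt (ee k) (2 * Real.pi * Complex.I * k * ee k t) t := by
  have h1 : HasDerivAt (fun s : ℝ => (2 * Real.pi * Complex.I * k * (s : ℂ) : ℂ))
      (2 * Real.pi * Complex.I * k * 1) t := (Complex.ofRealCLM.hasDerivAt (x := t)).const_mul _
  have h2 := h1.cexp
  unfold ee
  convert h2 using 1
  ring

lemma ee_integral (k : ℤ) : ∫ t in (0:ℝ)..1, ee k t = if k = 0 then 1 else 0 := by
  split_ifs with h
  · subst h; simp [ee_zero]
  · have hne : (2 * Real.pi * Complex.I * k : ℂ) ≠ 0 := by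
      simp [h, Real.pi_ne_zero, Complex.I_ne_zero]
    have hd : ∀ t ∈ uIcc (0:ℝ) 1, HasDerivAt (fun t => (2 * Real.pi * Complex.I * k : ℂ)⁻¹ * ee k t) (ee k t) t := by
      intro t _
      have := (ee_hasDerivAt k t).const_mul (2 * Real.pi * Complex.I * k : ℂ)⁻¹
      rwa [inv_mul_cancel_left₀ hne] at this
    rw [integral_eq_sub_of_hasDerivAt hd ((ee_continuous k).intervalIntegrable _ _)]
    have : ee k 1 = ee k 0 := by simpa using ee_periodic k 0
    rw [this, sub_self]

lemma parseval_scalar {ι : Type*} [Fintype ι] (ν : ι → ℤ) (a b : ι → ℂ) :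
    ∫ t in (0:ℝ)..1, (starRingEnd ℂ) (∑ i, ee (ν i) t * a i) * (∑ i, ee (ν i) t * b i)
      = ∑ i, ∑ i', if ν i = ν i' then (starRingEnd ℂ) (a i) * b i' else 0 := by
  have hpt : ∀ t, (starRingEnd ℂ) (∑ i, ee (ν i) t * a i) * (∑ i, ee (ν i) t * b i)
      = ∑ i, ∑ i', ee (ν i' - ν i) t * ((starRingEnd ℂ) (a i) * b i') := by
    intro t
    rw [map_sum, Finset.sum_mul_sum]
    refine Finset.sum_congr rfl fun i _ => Finset.sum_congr rfl fun i' _ => ?_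
    rw [map_mul, ee_conj, sub_eq_add_neg, ee_add]; ring
  simp_rw [hpt]
  rw [intervalIntegral.integral_finsetSum]
  · refine Finset.sum_congr rfl fun i _ => ?_
    rw [intervalIntegral.integral_finsetSum]
    · refine Finset.sum_congr rfl fun i' _ => ?_
      rw [intervalIntegral.integral_mul_const, ee_integral]
      by_cases h : ν i = ν i'
      · simp [h]
      · rw [if_neg h, if_neg (by omega), zero_mul]
    · intro i' _
      exact ((ee_continuous _).mul continuous_const).intervalIntegrable _ _
  · intro i _
    exact Continuous.intervalIntegrable (continuous_finsetSum _ fun i' _ => (ee_continuous _).mul continuous_const) _ _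

variable {d : ℕ}

lemma esp_inner (x y : Esp d) : ⟪x, y⟫ = ∑ j, ((starRingEnd ℂ) (x j) * y j).re := by
  rw [PiLp.inner_apply]
  refine Finset.sum_congr rfl fun j _ => ?_
  rw [Complex.inner, mul_comm]

lemma esp_inner_smul (z : ℂ) (x y : Esp d) : ⟪z • x, y⟫ = ⟪x, (starRingEnd ℂ) z • y⟫ := by
  rw [esp_inner, esp_inner]
  refine Finset.sum_congr rfl fun j _ => ?_
  simp only [PiLp.smul_apply, smul_eq_mul, map_mul]
  congr 1; ring

lemma esp_norm_sq (x : Esp d) : ‖x‖ ^ 2 = ∑ j, ‖x j‖ ^ 2 := EuclideanSpace.norm_sq_eq x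

/-- Loops given by finitely many Fourier modes. -/
abbrev PL (ι : Type*) [Fintype ι] (d : ℕ) := PiLp 2 (fun _ : ι => Esp d)

variable {ι : Type*} [Fintype ι] (ν : ι → ℤ)

/-- Evaluation of a trigonometric polynomial. -/
def ev (c : PL ι d) (t : ℝ) : Esp d := ∑ i, ee (ν i) t • c i

lemma ev_apply (c : PL ι d) (t : ℝ) (j : Fin d) : ev ν c t j = ∑ i, ee (ν i) t * c i j := by
  simp [ev]

lemma ev_add (c c' : PL ι d) (t : ℝ) : ev ν (c + c') t = ev ν c t + ev ν c' t := by
  simp [ev, Finset.sum_add_distrib]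

lemma ev_continuous : Continuous (fun p : PL ι d × ℝ => ev ν p.1 p.2) := by
  unfold ev
  refine continuous_finsetSum _ fun i _ => ?_
  have := ee_continuous (ν i)
  refine Continuous.smul ((ee_continuous _).comp continuous_snd) ?_
  exact (PiLp.continuous_apply 2 _ i).comp continuous_fst

lemma ev_continuous_t (c : PL ι d) : Continuous (ev ν c) :=
  (ev_continuous ν).comp (Continuous.prodMk_right c)

lemma ev_periodic (c : PL ι d) (t : ℝ) : ev ν c (t + 1) = ev ν c t := by
  simp [ev, ee_periodic]

lemma parseval (hν : Function.Injective ν) (c c' : PL ι d) :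
    ∫ t in (0:ℝ)..1, ⟪ev ν c t, ev ν c' t⟫ = ⟪c, c'⟫ := by
  have h1 : ∀ t, ⟪ev ν c t, ev ν c' t⟫ = ∑ j, Complex.reCLM
      ((starRingEnd ℂ) (∑ i, ee (ν i) t * c i j) * (∑ i, ee (ν i) t * c' i j)) := by
    intro t
    rw [esp_inner]
    simp only [ev_apply, Complex.reCLM_apply]
  have hc : ∀ j, Continuous (fun t => (starRingEnd ℂ) (∑ i, ee (ν i) t * c i j) * (∑ i, ee (ν i) t * c' i j)) := by
    intro j
    refine Continuous.mul (Complex.continuous_conj.comp ?_) ?_ <;>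
    exact continuous_finsetSum _ fun i _ => (ee_continuous _).mul continuous_const
  simp_rw [h1]
  rw [intervalIntegral.integral_finsetSum]
  · rw [PiLp.inner_apply]
    simp_rw [esp_inner]
    rw [Finset.sum_comm]
    refine Finset.sum_congr rfl fun j _ => ?_
    rw [ContinuousLinearMap.intervalIntegral_comp_comm _ ((hc j).intervalIntegrable _ _),
      parseval_scalar, map_sum]
    refine Finset.sum_congr rfl fun i _ => ?_
    rw [Finset.sum_eq_single i]
    · simp
    · intro b _ hb
      rw [if_neg]
      exact fun h => hb (hν h).symm
    · simp
  · intro j _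
    exact (Complex.reCLM.continuous.comp (hc j)).intervalIntegrable _ _

lemma parseval_norm (hν : Function.Injective ν) (c : PL ι d) :
    ∫ t in (0:ℝ)..1, ‖ev ν c t‖ ^ 2 = ‖c‖ ^ 2 := by
  have := parseval ν hν c c
  simpa only [real_inner_self_eq_norm_sq] using this

/-- Fourier coefficients of a continuous loop. -/
def fc (u : ℝ → Esp d) : PL ι d :=
  WithLp.toLp 2 (fun i => ∫ t in (0:ℝ)..1, ee (-ν i) t • u t)

lemma fc_apply (u : ℝ → Esp d) (i : ι) : fc ν u i = ∫ t in (0:ℝ)..1, ee (-ν i) t • u t := rfl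

lemma fc_inner (u : ℝ → Esp d) (hu : Continuous u) (c : PL ι d) :
    ⟪fc ν u, c⟫ = ∫ t in (0:ℝ)..1, ⟪u t, ev ν c t⟫ := by
  have h1 : ∀ t, ⟪u t, ev ν c t⟫ = ∑ i, ⟪c i, ee (-ν i) t • u t⟫ := by
    intro t
    rw [ev, inner_sum]
    refine Finset.sum_congr rfl fun i _ => ?_
    rw [real_inner_comm, esp_inner_smul, ee_conj]
  simp_rw [h1]
  rw [intervalIntegral.integral_finsetSum]
  · rw [PiLp.inner_apply]
    refine Finset.sum_congr rfl fun i _ => ?_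
    rw [fc_apply, real_inner_comm]
    have := ContinuousLinearMap.intervalIntegral_comp_comm (μ := volume) (a := 0) (b := 1)
      (innerSL ℝ (c i)) (f := fun t => ee (-ν i) t • u t)
      (((ee_continuous _).smul hu).intervalIntegrable _ _)
    simpa using this.symm
  · intro i _
    have := ee_continuous (-ν i)
    exact Continuous.intervalIntegrable (by fun_prop) _ _

lemma fc_bessel (hν : Function.Injective ν) (u : ℝ → Esp d) (hu : Continuous u) (C : ℝ) (hC : ∀ t, ‖u t‖ ≤ C) :
    ‖fc ν u‖ ≤ C := by
  have hC0 : 0 ≤ C := (norm_nonneg _).trans (hC 0)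
  set S := fc ν u
  have h1 : ‖S‖ ^ 2 = ∫ t in (0:ℝ)..1, ⟪u t, ev ν S t⟫ := by
    rw [← fc_inner ν u hu S, real_inner_self_eq_norm_sq]
  have hcS := ev_continuous_t ν S
  have h2 : ∫ t in (0:ℝ)..1, ⟪u t, ev ν S t⟫ ≤ ∫ t in (0:ℝ)..1, (C ^ 2 / 2 + 1 / 2 * ‖ev ν S t‖ ^ 2) := by
    refine integral_mono_on zero_le_one (Continuous.intervalIntegrable (by fun_prop) _ _)
      (Continuous.intervalIntegrable (by fun_prop) _ _) fun t _ => ?_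
    have h3 := real_inner_le_norm (u t) (ev ν S t)
    have h4 := hC t
    nlinarith [norm_nonneg (u t), norm_nonneg (ev ν S t), sq_nonneg (‖u t‖ - ‖ev ν S t‖)]
  rw [intervalIntegral.integral_add (by simp) (Continuous.intervalIntegrable (by fun_prop) _ _),
    intervalIntegral.integral_const_mul, parseval_norm ν hν] at h2
  simp at h2
  have : ‖S‖ ^ 2 ≤ C ^ 2 := by linarith
  exact le_of_sq_le_sq this hC0

lemma carleman_count (hpos : ∀ i, 1 ≤ ν i) (hν : Function.Injective ν) (m : ℤ) :
    ∑ p : ι × ι, (if ν p.1 + ν p.2 = m then (1 : ℝ) / (ν p.1 * ν p.2) else 0) ≤ 1 := by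
  classical
  rw [← Finset.sum_filter]
  rcases le_or_gt m 1 with hm | hm
  · rw [Finset.sum_eq_zero]
    · norm_num
    · intro p hp
      have := (Finset.mem_filter.1 hp).2
      have := hpos p.1; have := hpos p.2
      omega
  have hm' : (0 : ℝ) < (m : ℝ) - 1 := by
    have : (1 : ℝ) < m := by exact_mod_cast hm
    linarith
  have h1 : ∀ p ∈ Finset.univ.filter (fun p : ι × ι => ν p.1 + ν p.2 = m),
      (1 : ℝ) / (ν p.1 * ν p.2) ≤ 1 / (m - 1) := by
    intro p hp
    have h := (Finset.mem_filter.1 hp).2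
    have ha : (1 : ℝ) ≤ ν p.1 := by exact_mod_cast hpos p.1
    have hb : (1 : ℝ) ≤ ν p.2 := by exact_mod_cast hpos p.2
    have hab : (ν p.1 : ℝ) + ν p.2 = m := by exact_mod_cast h
    apply one_div_le_one_div_of_le hm'
    nlinarith
  have hcard : (Finset.univ.filter (fun p : ι × ι => ν p.1 + ν p.2 = m)).card ≤ (Finset.Icc 1 (m - 1)).card := by
    refine Finset.card_le_card_of_injOn (fun p => ν p.1) ?_ ?_
    · intro p hp
      have h := (Finset.mem_filter.1 hp).2
      have := hpos p.1; have := hpos p.2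
      simp only [Finset.coe_Icc, Set.mem_Icc]
      omega
    · intro p hp q hq hpq
      have h := (Finset.mem_filter.1 hp).2
      have h' := (Finset.mem_filter.1 hq).2
      simp only at hpq
      have h2 : ν p.2 = ν q.2 := by omega
      exact Prod.ext (hν hpq) (hν h2)
  refine (Finset.sum_le_card_nsmul _ _ _ h1).trans ?_
  rw [nsmul_eq_mul, mul_one_div, div_le_one hm']
  have h3 : ((Finset.Icc 1 (m - 1)).card : ℝ) = m - 1 := by
    rw [Int.card_Icc]
    have : (((m - 1 + 1 - 1).toNat : ℤ) : ℝ) = ((m - 1 : ℤ) : ℝ) := by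
      congr 1
      omega
    push_cast at this
    exact_mod_cast this
  calc _ ≤ ((Finset.Icc 1 (m - 1)).card : ℝ) := by exact_mod_cast hcard
    _ = _ := h3
    _ ≤ _ := le_rfl

lemma carleman_schur {κ : Type*} [Fintype κ] (μ : κ → ℤ) (b : κ → ℝ) (w : κ → ℝ) (hw : ∀ p, 0 < w p)
    (hs : ∀ m, ∑ p, (if μ p = m then 1 / w p else 0) ≤ 1) :
    ∑ p, ∑ p', (if μ p = μ p' then b p * b p' else 0) ≤ ∑ p, w p * b p ^ 2 := by
  have h1 : ∀ p p', (if μ p = μ p' then b p * b p' else 0)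
      ≤ 1 / 2 * (w p * b p ^ 2 * (if μ p' = μ p then 1 / w p' else 0))
        + 1 / 2 * (w p' * b p' ^ 2 * (if μ p = μ p' then 1 / w p else 0)) := by
    intro p p'
    by_cases h : μ p = μ p'
    · rw [if_pos h, if_pos h.symm, if_pos h]
      have := hw p; have := hw p'
      have h2 : 1 / 2 * (w p * b p ^ 2 * (1 / w p')) + 1 / 2 * (w p' * b p' ^ 2 * (1 / w p)) - b p * b p'
          = (w p * b p - w p' * b p') ^ 2 / (2 * w p * w p') := by field_simp; ring
      have h3 : 0 ≤ (w p * b p - w p' * b p') ^ 2 / (2 * w p * w p') := by positivity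
      linarith
    · rw [if_neg h, if_neg (Ne.symm h), if_neg h]; simp
  have h2 : ∑ p, ∑ p', w p * b p ^ 2 * (if μ p' = μ p then 1 / w p' else 0) ≤ ∑ p, w p * b p ^ 2 := by
    refine Finset.sum_le_sum fun p _ => ?_
    rw [← Finset.mul_sum]
    have := hw p
    have h5 : 0 ≤ w p * b p ^ 2 := by positivity
    have := hs (μ p)
    nlinarith
  calc _ ≤ ∑ p, ∑ p', (1 / 2 * (w p * b p ^ 2 * (if μ p' = μ p then 1 / w p' else 0))
        + 1 / 2 * (w p' * b p' ^ 2 * (if μ p = μ p' then 1 / w p else 0))) :=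
        Finset.sum_le_sum fun p _ => Finset.sum_le_sum fun p' _ => h1 p p'
    _ = 1 / 2 * ∑ p, ∑ p', w p * b p ^ 2 * (if μ p' = μ p then 1 / w p' else 0)
        + 1 / 2 * ∑ p', ∑ p, w p' * b p' ^ 2 * (if μ p = μ p' then 1 / w p else 0) := by
        simp_rw [Finset.sum_add_distrib, Finset.mul_sum]
        congr 1
        rw [Finset.sum_comm]
    _ ≤ _ := by linarith

lemma carleman_scalar (hpos : ∀ i, 1 ≤ ν i) (hν : Function.Injective ν) (a : ι → ℂ) :
    ∫ t in (0:ℝ)..1, ‖∑ i, ee (ν i) t * a i‖ ^ 4 ≤ (∑ i, (ν i : ℝ) * ‖a i‖ ^ 2) ^ 2 := by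
  let μ : ι × ι → ℤ := fun p => ν p.1 + ν p.2
  let b : ι × ι → ℂ := fun p => a p.1 * a p.2
  have hpt : ∀ t, ‖∑ i, ee (ν i) t * a i‖ ^ 4 = Complex.reCLM ((starRingEnd ℂ) (∑ p, ee (μ p) t * b p)
      * (∑ p, ee (μ p) t * b p)) := by
    intro t
    have h1 : ∑ p, ee (μ p) t * b p = (∑ i, ee (ν i) t * a i) ^ 2 := by
      rw [sq, Finset.sum_mul_sum, Fintype.sum_prod_type]
      refine Finset.sum_congr rfl fun i _ => Finset.sum_congr rfl fun i' _ => ?_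
      simp only [μ, b, ee_add]; ring
    rw [h1, Complex.conj_mul', norm_pow, Complex.reCLM_apply]
    rw [← Complex.ofReal_pow, Complex.ofReal_re]; ring
  have hc : Continuous (fun t => (starRingEnd ℂ) (∑ p, ee (μ p) t * b p) * (∑ p, ee (μ p) t * b p)) := by
    refine Continuous.mul (Complex.continuous_conj.comp ?_) ?_ <;>
    exact continuous_finsetSum _ fun i _ => (ee_continuous _).mul continuous_const
  simp_rw [hpt]
  rw [ContinuousLinearMap.intervalIntegral_comp_comm _ (hc.intervalIntegrable _ _), parseval_scalar,
    map_sum]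
  simp_rw [map_sum]
  have hle : ∀ p p', Complex.reCLM (if μ p = μ p' then (starRingEnd ℂ) (b p) * b p' else 0)
      ≤ if μ p = μ p' then ‖b p‖ * ‖b p'‖ else 0 := by
    intro p p'
    split_ifs
    · rw [Complex.reCLM_apply]
      refine (Complex.re_le_norm _).trans ?_
      rw [norm_mul, RCLike.norm_conj]
    · simp
  refine (Finset.sum_le_sum fun p _ => Finset.sum_le_sum fun p' _ => hle p p').trans ?_
  have hν0 : ∀ i, (0 : ℝ) < ν i := fun i => by exact_mod_cast (hpos i)
  refine (carleman_schur μ (fun p => ‖b p‖) (fun p => ν p.1 * ν p.2)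
    (fun p => mul_pos (hν0 _) (hν0 _)) (fun m => carleman_count ν hpos hν m)).trans ?_
  rw [sq, Finset.sum_mul_sum, Fintype.sum_prod_type]
  refine le_of_eq (Finset.sum_congr rfl fun i _ => Finset.sum_congr rfl fun i' _ => ?_)
  simp only [b, norm_mul]; ring

/-- The version for vectors; only the modes with positive frequency are allowed to be nonzero. -/
lemma carleman (hν : Function.Injective ν) (c : PL ι d) (hc : ∀ i, ν i ≤ 0 → c i = 0) :
    ∫ t in (0:ℝ)..1, ‖ev ν c t‖ ^ 4 ≤ d * (∑ i, (ν i : ℝ) * ‖c i‖ ^ 2) ^ 2 := by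
  classical
  let κ := {i : ι // 1 ≤ ν i}
  have hsub : ∀ {M : Type} [AddCommMonoid M] (f : ι → M), (∀ i, ν i ≤ 0 → f i = 0) →
      ∑ i, f i = ∑ i : κ, f i := by
    intro M _ f hf
    rw [← Finset.sum_subtype (Finset.univ.filter (fun i => 1 ≤ ν i)) (by simp) f]
    rw [Finset.sum_filter_of_ne]
    intro i _ hne
    by_contra hlt
    exact hne (hf i (by omega))
  have hj : ∀ j, ∫ t in (0:ℝ)..1, ‖ev ν c t j‖ ^ 4 ≤ (∑ i, (ν i : ℝ) * ‖c i j‖ ^ 2) ^ 2 := by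
    intro j
    have h1 : ∀ t, ev ν c t j = ∑ i : κ, ee (ν i) t * c i j := by
      intro t
      rw [ev_apply, hsub]
      intro i hi; simp [hc i hi]
    simp_rw [h1]
    rw [hsub (fun i => (ν i : ℝ) * ‖c i j‖ ^ 2) (by intro i hi; simp [hc i hi])]
    exact carleman_scalar (fun i : κ => ν i) (fun i => i.2)
      (fun x y h => Subtype.ext (hν h)) (fun i => c i j)
  have hcont : ∀ j, Continuous (fun t => ev ν c t j) := fun j => by
    have := ev_continuous_t ν c
    fun_prop
  have h4 : ∀ t, ‖ev ν c t‖ ^ 4 ≤ d * ∑ j, ‖ev ν c t j‖ ^ 4 := by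
    intro t
    have h5 : ‖ev ν c t‖ ^ 4 = (∑ j, ‖ev ν c t j‖ ^ 2) ^ 2 := by rw [← esp_norm_sq]; ring
    rw [h5]
    refine (sq_sum_le_card_mul_sum_sq).trans ?_
    simp only [Finset.card_univ, Fintype.card_fin]
    refine le_of_eq ?_
    congr 1
    refine Finset.sum_congr rfl fun j _ => by ring
  have hnn : ∀ i j, 0 ≤ (ν i : ℝ) * ‖c i j‖ ^ 2 := by
    intro i j
    by_cases hi : ν i ≤ 0
    · simp [hc i hi]
    · have : (0 : ℝ) ≤ ν i := by exact_mod_cast (by omega)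
      positivity
  calc ∫ t in (0:ℝ)..1, ‖ev ν c t‖ ^ 4 ≤ ∫ t in (0:ℝ)..1, d * ∑ j, ‖ev ν c t j‖ ^ 4 := by
        refine integral_mono_on zero_le_one (((ev_continuous_t ν c).norm.pow 4).intervalIntegrable _ _)
          ((continuous_const.mul (continuous_finsetSum _ fun j _ =>
            (hcont j).norm.pow 4)).intervalIntegrable _ _) fun t _ => h4 t
    _ = d * ∑ j, ∫ t in (0:ℝ)..1, ‖ev ν c t j‖ ^ 4 := by
        rw [intervalIntegral.integral_const_mul, intervalIntegral.integral_finsetSum]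
        intro j _
        exact ((hcont j).norm.pow 4).intervalIntegrable _ _
    _ ≤ d * ∑ j, (∑ i, (ν i : ℝ) * ‖c i j‖ ^ 2) ^ 2 := by
        gcongr with j _
        exact hj j
    _ ≤ d * (∑ j, ∑ i, (ν i : ℝ) * ‖c i j‖ ^ 2) ^ 2 := by
        gcongr
        exact Finset.sum_sq_le_sq_sum_of_nonneg (fun j _ => Finset.sum_nonneg fun i _ => hnn i j)
    _ = _ := by
        rw [Finset.sum_comm]
        simp_rw [← Finset.mul_sum, ← esp_norm_sq]

end FourierBasics

/-! Part 4 -/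

section FiniteDim
open MeasureTheory intervalIntegral

variable {d : ℕ} {ι : Type*} [Fintype ι]

/-- Diagonal multiplier. -/
def dm (l : ι → Fin d → ℝ) : PL ι d →ₗ[ℝ] PL ι d where
  toFun c := WithLp.toLp 2 fun i => WithLp.toLp 2 fun j => (l i j : ℂ) * c i j
  map_add' c c' := by
    ext i j; simp [mul_add]
  map_smul' s c := by
    ext i j
    simp only [PiLp.smul_apply, Complex.real_smul, RingHom.id_apply]
    ring

lemma dm_apply (l : ι → Fin d → ℝ) (c : PL ι d) (i : ι) (j : Fin d) :
    dm l c i j = (l i j : ℂ) * c i j := rfl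

lemma dm_inner (l : ι → Fin d → ℝ) (c c' : PL ι d) :
    ⟪dm l c, c'⟫ = ∑ i, ∑ j, l i j * ((starRingEnd ℂ) (c i j) * c' i j).re := by
  rw [PiLp.inner_apply]
  refine Finset.sum_congr rfl fun i _ => ?_
  rw [esp_inner]
  refine Finset.sum_congr rfl fun j _ => ?_
  rw [dm_apply, map_mul, Complex.conj_ofReal, mul_assoc, Complex.re_ofReal_mul]

lemma dm_symm (l : ι → Fin d → ℝ) (c c' : PL ι d) : ⟪dm l c, c'⟫ = ⟪dm l c', c⟫ := by
  rw [dm_inner, dm_inner]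
  refine Finset.sum_congr rfl fun i _ => Finset.sum_congr rfl fun j _ => ?_
  congr 1
  simp only [Complex.mul_re, Complex.conj_re, Complex.conj_im]; ring

lemma pl_norm_sq (c : PL ι d) : ‖c‖ ^ 2 = ∑ i, ∑ j, ‖c i j‖ ^ 2 := by
  rw [PiLp.norm_sq_eq_of_L2]
  exact Finset.sum_congr rfl fun i _ => esp_norm_sq _

lemma dm_quad (l : ι → Fin d → ℝ) (c : PL ι d) :
    ⟪dm l c, c⟫ = ∑ i, ∑ j, l i j * ‖c i j‖ ^ 2 := by
  rw [dm_inner]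
  refine Finset.sum_congr rfl fun i _ => Finset.sum_congr rfl fun j _ => ?_
  rw [Complex.conj_mul', ← Complex.ofReal_pow, Complex.ofReal_re]

lemma dm_norm_sq (l : ι → Fin d → ℝ) (c : PL ι d) :
    ‖dm l c‖ ^ 2 = ∑ i, ∑ j, l i j ^ 2 * ‖c i j‖ ^ 2 := by
  rw [pl_norm_sq]
  refine Finset.sum_congr rfl fun i _ => Finset.sum_congr rfl fun j _ => ?_
  rw [dm_apply, norm_mul, mul_pow, Complex.norm_real, Real.norm_eq_abs, sq_abs]

lemma dm_norm_le (l : ι → Fin d → ℝ) (M : ℝ) (hM : 0 ≤ M) (hl : ∀ i j, |l i j| ≤ M) (c : PL ι d) :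
    ‖dm l c‖ ≤ M * ‖c‖ := by
  refine le_of_sq_le_sq ?_ (by positivity)
  rw [dm_norm_sq, mul_pow, pl_norm_sq, Finset.mul_sum]
  simp_rw [Finset.mul_sum]
  refine Finset.sum_le_sum fun i _ => Finset.sum_le_sum fun j _ => ?_
  refine mul_le_mul_of_nonneg_right ?_ (by positivity)
  rw [← sq_abs]
  exact pow_le_pow_left₀ (abs_nonneg _) (hl i j) 2

lemma le_dm_norm (l : ι → Fin d → ℝ) (M : ℝ) (hM : 0 ≤ M) (hl : ∀ i j, M ≤ |l i j|) (c : PL ι d) :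
    M * ‖c‖ ≤ ‖dm l c‖ := by
  refine le_of_sq_le_sq ?_ (by positivity)
  rw [dm_norm_sq, mul_pow, pl_norm_sq, Finset.mul_sum]
  simp_rw [Finset.mul_sum]
  refine Finset.sum_le_sum fun i _ => Finset.sum_le_sum fun j _ => ?_
  refine mul_le_mul_of_nonneg_right ?_ (by positivity)
  rw [← sq_abs (l i j)]
  exact pow_le_pow_left₀ hM (hl i j) 2

/-- The data of an asymptotically quadratic Hamiltonian. -/
structure HamData (d : ℕ) where
  a : Fin d → ℝ
  j0 : Fin d
  a_gt : Real.pi < a j0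
  a_lt : a j0 < 2 * Real.pi
  a_pos : ∀ j, 0 < a j
  a_other : ∀ j, j ≠ j0 → a j < Real.pi
  R : Esp d → ℝ
  gR : Esp d → Esp d
  R_cont : Continuous R
  gR_cont : Continuous gR
  C0 : ℝ
  R_bd : ∀ z, |R z| ≤ C0
  C1 : ℝ
  gR_bd : ∀ z, ‖gR z‖ ≤ C1
  ell : ℝ
  ell_pos : 0 < ell
  taylor : ∀ z h, |R (z + h) - R z - ⟪gR z, h⟫| ≤ ell * ‖h‖ ^ 2
  C4 : ℝ
  C4_pos : 0 < C4
  K_nonneg : ∀ z, 0 ≤ ∑ j, a j * ‖z j‖ ^ 2 + R z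
  K_le : ∀ z, ∑ j, a j * ‖z j‖ ^ 2 + R z ≤ C4 * ‖z‖ ^ 4

namespace HamData
variable (D : HamData d)

/-- The Hamiltonian. -/
def K (z : Esp d) : ℝ := ∑ j, D.a j * ‖z j‖ ^ 2 + D.R z

/-- The diagonal linear map with entries `a`. -/
def A (z : Esp d) : Esp d := WithLp.toLp 2 fun j => (D.a j : ℂ) * z j

/-- The gradient of the Hamiltonian. -/
def k (z : Esp d) : Esp d := (2 : ℝ) • D.A z + D.gR z

lemma A_cont : Continuous D.A := by unfold A; fun_prop

lemma K_cont : Continuous D.K := by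
  have := D.R_cont
  unfold K; fun_prop

lemma k_cont : Continuous D.k := by
  have := D.gR_cont; have := D.A_cont
  unfold k; fun_prop

lemma A_inner (z : Esp d) : ⟪D.A z, z⟫ = ∑ j, D.a j * ‖z j‖ ^ 2 := by
  rw [esp_inner]
  refine Finset.sum_congr rfl fun j _ => ?_
  simp only [A, map_mul, Complex.conj_ofReal]
  rw [mul_assoc, Complex.re_ofReal_mul, Complex.conj_mul', ← Complex.ofReal_pow, Complex.ofReal_re]

lemma ev_A (ν : ι → ℤ) (c : PL ι d) (t : ℝ) :
    ev ν (dm (fun _ j => D.a j) c) t = D.A (ev ν c t) := by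
  ext j
  rw [ev_apply]
  simp only [A, ev_apply, dm_apply, Finset.mul_sum]
  refine Finset.sum_congr rfl fun i _ => by ring

lemma gap : ∃ η : ℝ, 0 < η ∧ (∀ (k : ℤ) j, η ≤ |Real.pi * k - D.a j|) ∧
    (∀ (k : ℤ) j, k ≤ 0 → Real.pi * k - D.a j ≤ -η) ∧ (Real.pi - D.a D.j0 ≤ -η) := by
  have hne : (Finset.univ : Finset (Fin d)).Nonempty := ⟨D.j0, Finset.mem_univ _⟩
  obtain ⟨j1, -, h1⟩ := Finset.exists_min_image Finset.univ D.a hne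
  have hfin : ∃ δ > 0, ∀ j, j ≠ D.j0 → δ ≤ Real.pi - D.a j := by
    let f : Fin d → ℝ := fun j => if j = D.j0 then 1 else Real.pi - D.a j
    obtain ⟨j2, -, h2⟩ := Finset.exists_min_image Finset.univ f hne
    refine ⟨f j2, ?_, fun j hj => ?_⟩
    · simp only [f]; split_ifs with h
      · norm_num
      · have := D.a_other j2 h; linarith
    · have := h2 j (Finset.mem_univ _)
      simpa [f, hj] using this
  obtain ⟨δ, hδ, h2⟩ := hfin
  have hp := Real.pi_pos
  have g1 := D.a_gt; have g2 := D.a_lt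
  let η := min (min (D.a j1) δ) (min (D.a D.j0 - Real.pi) (2 * Real.pi - D.a D.j0))
  have e1 : η ≤ D.a j1 := (min_le_left _ _).trans (min_le_left _ _)
  have e2 : η ≤ δ := (min_le_left _ _).trans (min_le_right _ _)
  have e3 : η ≤ D.a D.j0 - Real.pi := (min_le_right _ _).trans (min_le_left _ _)
  have e4 : η ≤ 2 * Real.pi - D.a D.j0 := (min_le_right _ _).trans (min_le_right _ _)
  have hη : 0 < η := lt_min (lt_min (D.a_pos _) hδ) (lt_min (by linarith) (by linarith))
  have hk : ∀ (k : ℤ) j, k ≤ 0 → Real.pi * k - D.a j ≤ -η := by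
    intro k j hk
    have : (k : ℝ) ≤ 0 := by exact_mod_cast hk
    have := h1 j (Finset.mem_univ _)
    nlinarith
  refine ⟨η, hη, ?_, hk, by linarith⟩
  intro k j
  rcases le_or_gt k 0 with h | h
  · have := hk k j h
    rw [abs_of_nonpos (by linarith)]; linarith
  · have h' : (1 : ℝ) ≤ k := by exact_mod_cast h
    by_cases hj : j = D.j0
    · subst hj
      rcases (show k = 1 ∨ 2 ≤ k by omega) with rfl | h3
      · rw [abs_of_nonpos (by push_cast; linarith)]; push_cast; linarith
      · have h' : (2 : ℝ) ≤ k := by exact_mod_cast h3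
        rw [abs_of_nonneg (by nlinarith)]; nlinarith
    · have := h2 j hj
      rw [abs_of_nonneg (by nlinarith)]; nlinarith

variable (ν : ι → ℤ)

/-- Eigenvalues of the quadratic part. -/
def lam (i : ι) (j : Fin d) : ℝ := Real.pi * ν i - D.a j

/-- The action functional. -/
def Phi (c : PL ι d) : ℝ := ⟪dm (D.lam ν) c, c⟫ - ∫ t in (0:ℝ)..1, D.R (ev ν c t)

/-- Its gradient. -/
def gPhi (c : PL ι d) : PL ι d := (2 : ℝ) • dm (D.lam ν) c - fc ν (fun t => D.gR (ev ν c t))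

lemma dm_lam (c : PL ι d) :
    dm (D.lam ν) c = dm (fun i _ => Real.pi * ν i) c - dm (fun _ j => D.a j) c := by
  ext i j
  simp only [PiLp.sub_apply, dm_apply, lam]
  push_cast; ring

lemma Phi_cont : Continuous (D.Phi ν) := by
  unfold Phi
  have h0 : Continuous (dm (D.lam ν)) := LinearMap.continuous_of_finiteDimensional _
  refine Continuous.sub (by fun_prop) ?_
  exact intervalIntegral.continuous_parametric_intervalIntegral_of_continuous'
    (f := fun c t => D.R (ev ν c t)) (D.R_cont.comp (ev_continuous ν)) 0 1

lemma gPhi_cont : Continuous (D.gPhi ν) := by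
  unfold gPhi fc
  have h0 : Continuous (dm (D.lam ν)) := LinearMap.continuous_of_finiteDimensional _
  refine Continuous.sub (by fun_prop) ?_
  refine (PiLp.continuous_toLp 2 _).comp ?_
  refine continuous_pi fun i => ?_
  exact intervalIntegral.continuous_parametric_intervalIntegral_of_continuous'
    (f := fun c t => ee (-ν i) t • D.gR (ev ν c t))
    (((ee_continuous _).comp continuous_snd).smul (D.gR_cont.comp (ev_continuous ν))) 0 1

lemma A_int (hν : Function.Injective ν) (c c' : PL ι d) :
    ∫ t in (0:ℝ)..1, ⟪D.A (ev ν c t), ev ν c' t⟫ = ⟪dm (fun _ j => D.a j) c, c'⟫ := by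
  rw [← parseval ν hν]
  simp_rw [ev_A]

lemma Phi_eq (hν : Function.Injective ν) (c : PL ι d) :
    D.Phi ν c = ⟪dm (fun i _ => Real.pi * ν i) c, c⟫ - ∫ t in (0:ℝ)..1, D.K (ev ν c t) := by
  have hc := ev_continuous_t ν c
  have h1 : ∀ t, D.K (ev ν c t) = ⟪D.A (ev ν c t), ev ν c t⟫ + D.R (ev ν c t) := fun t => by
    rw [A_inner, K]
  simp_rw [h1]
  rw [intervalIntegral.integral_add, D.A_int ν hν, Phi, dm_lam, inner_sub_left]
  · ring
  · exact Continuous.intervalIntegrable ((D.A_cont.comp hc).inner hc) _ _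
  · exact (D.R_cont.comp hc).intervalIntegrable _ _

lemma Phi_taylor (hν : Function.Injective ν) : ∃ L > 0, ∀ x h,
    D.Phi ν (x + h) ≤ D.Phi ν x + ⟪D.gPhi ν x, h⟫ + L * ‖h‖ ^ 2 := by
  let M := ∑ i, ∑ j, |D.lam ν i j|
  have hM0 : 0 ≤ M := by positivity
  have hM : ∀ i j, |D.lam ν i j| ≤ M := fun i j =>
    (Finset.single_le_sum (f := fun j => |D.lam ν i j|) (fun _ _ => abs_nonneg _) (Finset.mem_univ j)).trans
      (Finset.single_le_sum (f := fun i => ∑ j, |D.lam ν i j|)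
        (fun _ _ => Finset.sum_nonneg fun _ _ => abs_nonneg _) (Finset.mem_univ i))
  refine ⟨M + D.ell, by have := D.ell_pos; linarith, fun x h => ?_⟩
  have hx := ev_continuous_t ν x
  have hh := ev_continuous_t ν h
  have q1 : ⟪dm (D.lam ν) (x + h), x + h⟫ = ⟪dm (D.lam ν) x, x⟫ + 2 * ⟪dm (D.lam ν) x, h⟫
      + ⟪dm (D.lam ν) h, h⟫ := by
    rw [map_add, inner_add_left, inner_add_right, inner_add_right, dm_symm (D.lam ν) h x]; ring
  have q2 : ⟪dm (D.lam ν) h, h⟫ ≤ M * ‖h‖ ^ 2 := by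
    have := real_inner_le_norm (dm (D.lam ν) h) h
    have := dm_norm_le (D.lam ν) M hM0 hM h
    nlinarith [norm_nonneg h]
  have cR : Continuous fun t => D.R (ev ν x t) := D.R_cont.comp hx
  have cg : Continuous fun t => D.gR (ev ν x t) := D.gR_cont.comp hx
  have q3 : (∫ t in (0:ℝ)..1, (D.R (ev ν x t) + ⟪D.gR (ev ν x t), ev ν h t⟫ - D.ell * ‖ev ν h t‖ ^ 2))
      ≤ ∫ t in (0:ℝ)..1, D.R (ev ν (x + h) t) := by
    refine integral_mono_on zero_le_one ?_ ?_ fun t _ => ?_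
    · exact Continuous.intervalIntegrable ((cR.add (cg.inner hh)).sub (continuous_const.mul (hh.norm.pow 2))) _ _
    · exact (D.R_cont.comp (ev_continuous_t ν _)).intervalIntegrable _ _
    · rw [ev_add]
      have := (abs_le.1 (D.taylor (ev ν x t) (ev ν h t))).1
      linarith
  rw [intervalIntegral.integral_sub, intervalIntegral.integral_add, intervalIntegral.integral_const_mul,
    parseval_norm ν hν, ← fc_inner ν _ cg] at q3
  · unfold Phi gPhi
    rw [q1, inner_sub_left, real_inner_smul_left]
    linarith
  · exact cR.intervalIntegrable _ _
  · exact (cg.inner hh).intervalIntegrable _ _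
  · exact (cR.add (cg.inner hh)).intervalIntegrable _ _
  · exact (continuous_const.mul (hh.norm.pow 2)).intervalIntegrable _ _

/-- Critical points of the truncated functional, with uniform bounds. -/
theorem crit : ∃ β > 0, ∃ C : ℝ, ∀ {ι : Type} [Fintype ι] (ν : ι → ℤ), Function.Injective ν →
    (∃ i, ν i = 1) → ∃ c : PL ι d,
      (∀ i, ((2 * Real.pi * ν i : ℝ) : ℂ) • c i = fc ν (fun t => D.k (ev ν c t)) i) ∧
      ‖c‖ ≤ C ∧ ‖dm (fun i _ => 2 * Real.pi * ν i) c‖ ≤ C ∧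
      β ≤ ∫ t in (0:ℝ)..1, (1 / 2 * ⟪D.k (ev ν c t), ev ν c t⟫ - D.K (ev ν c t)) := by
  classical
  obtain ⟨η, hη, hgap, hneg, hneg1⟩ := D.gap
  have hd : (0 : ℝ) < d := by
    have : 0 < d := D.j0.pos
    exact_mod_cast this
  have hp := Real.pi_pos
  have hC4 := D.C4_pos
  have hC1 : 0 ≤ D.C1 := (norm_nonneg _).trans (D.gR_bd 0)
  have hC0 : 0 ≤ D.C0 := (abs_nonneg _).trans (D.R_bd 0)
  have haM : ∀ j, |D.a j| ≤ 2 * Real.pi := by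
    intro j
    rw [abs_of_pos (D.a_pos j)]
    by_cases h : j = D.j0
    · rw [h]; exact D.a_lt.le
    · have := D.a_other j h; linarith
  refine ⟨Real.pi ^ 2 / (4 * (D.C4 * d)), by positivity,
    D.C1 / (2 * η) + (4 * Real.pi * (D.C1 / (2 * η)) + D.C1), ?_⟩
  intro ι _ ν hν ⟨i1, hi1⟩
  -- linking data
  let Y : Submodule ℝ (PL ι d) :=
    { carrier := {c | ∀ i, 0 < ν i → c i = 0}
      add_mem' := fun {a b} ha hb i hi => by simp [ha i hi, hb i hi]
      zero_mem' := fun i hi => rfl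
      smul_mem' := fun s c hc i hi => by simp [hc i hi] }
  let mask : ι → Fin d → ℝ := fun i _ => if 0 < ν i then 0 else 1
  have hmask : ∀ c, dm mask c ∈ Y := by
    intro c i hi
    ext j
    rw [dm_apply]; simp [mask, hi]
  let P : PL ι d →L[ℝ] Y := LinearMap.toContinuousLinearMap ((dm mask).codRestrict Y hmask)
  have hP : ∀ c, ((P c : Y) : PL ι d) = dm mask c := fun c => rfl
  let e : PL ι d := PiLp.single 2 i1 (EuclideanSpace.single D.j0 (1 : ℂ))
  have he1 : e i1 = EuclideanSpace.single D.j0 (1 : ℂ) := by simp [e]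
  have he : ∀ i, i ≠ i1 → e i = 0 := by intro i hi; simp [e, hi]
  let w : PL ι d → ℝ := fun c => Real.sqrt (∑ i, max (ν i : ℝ) 0 * ‖c i‖ ^ 2)
  have hw : Continuous w := by
    refine Real.continuous_sqrt.comp (continuous_finsetSum _ fun i _ => ?_)
    exact continuous_const.mul ((PiLp.continuous_apply 2 _ i).norm.pow 2)
  obtain ⟨L, hL, hT⟩ := D.Phi_taylor ν hν
  have habsInt : ∀ c, |∫ t in (0:ℝ)..1, D.R (ev ν c t)| ≤ D.C0 := by
    intro c
    have := intervalIntegral.norm_integral_le_of_norm_le_const (a := 0) (b := 1) (C := D.C0)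
      (f := fun t => D.R (ev ν c t)) (fun t _ => D.R_bd _)
    simpa using this
  have hgrow : ∀ x, 2 * η * ‖x‖ - D.C1 ≤ ‖D.gPhi ν x‖ := by
    intro x
    have h1 := le_dm_norm (D.lam ν) η hη.le (fun i j => hgap (ν i) j) x
    have h2 := fc_bessel ν hν (fun t => D.gR (ev ν x t)) (D.gR_cont.comp (ev_continuous_t ν x)) D.C1
      (fun t => D.gR_bd _)
    have h3 := norm_sub_norm_le ((2 : ℝ) • dm (D.lam ν) x) (fc ν (fun t => D.gR (ev ν x t)))
    rw [norm_smul, Real.norm_eq_abs, abs_of_pos (by norm_num : (0:ℝ) < 2)] at h3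
    unfold gPhi
    linarith
  set ρ2 : ℝ := Real.pi / (2 * (D.C4 * d)) with hρ2
  have hrhopos : 0 < ρ2 := by positivity
  obtain ⟨c, hc0, hcβ⟩ := linking Y.subtypeL P (fun y => by
      apply Subtype.ext
      rw [hP]
      ext i j
      rw [dm_apply]
      by_cases hi : 0 < ν i
      · simp [mask, hi, y.2 i hi]
      · simp [mask, hi]) e (by
      apply Subtype.ext
      rw [hP]
      ext i j
      rw [dm_apply]
      by_cases hi : i = i1
      · simp [mask, hi, hi1]
      · simp [he i hi]) w hw (by
      intro y s
      simp only [w]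
      rw [Finset.sum_eq_single i1]
      · have : (y : PL ι d) i1 = 0 := y.2 i1 (by omega)
        simp [this, hi1, he1, norm_smul, Real.sqrt_sq_eq_abs]
      · intro i _ hi
        by_cases h : 0 < ν i
        · simp [he i hi, y.2 i h]
        · have : (ν i : ℝ) ≤ 0 := by exact_mod_cast (by omega : ν i ≤ 0)
          rw [max_eq_right this, zero_mul]
      · simp) (D.Phi ν) (D.Phi_cont ν) (D.gPhi ν) (D.gPhi_cont ν) L hL hT (2 * η) D.C1 (by linarith) hgrow
      (2 * (D.C0 / η + 1)) (by
        intro y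
        rw [D.Phi_eq ν hν]
        have h1 : 0 ≤ ∫ t in (0:ℝ)..1, D.K (ev ν (Y.subtypeL y) t) :=
          intervalIntegral.integral_nonneg zero_le_one fun t _ => D.K_nonneg _
        have h2 : ⟪dm (fun i _ => Real.pi * ν i) (Y.subtypeL y), Y.subtypeL y⟫ ≤ 0 := by
          rw [dm_quad]
          refine Finset.sum_nonpos fun i _ => Finset.sum_nonpos fun j _ => ?_
          by_cases h : 0 < ν i
          · have : (y : PL ι d) i = 0 := y.2 i h
            simp [this]
          · have : (ν i : ℝ) ≤ 0 := by exact_mod_cast (by omega : ν i ≤ 0)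
            exact mul_nonpos_of_nonpos_of_nonneg (by nlinarith) (by positivity)
        linarith) (by
        intro y s hs hτ
        set x : PL ι d := Y.subtypeL y + s • e with hx
        have hxi : x i1 = s • EuclideanSpace.single D.j0 (1 : ℂ) := by
          have : (y : PL ι d) i1 = 0 := y.2 i1 (by omega)
          simp [hx, this, he1]
        have h1 : ⟪dm (D.lam ν) x, x⟫ ≤ -η * ‖x‖ ^ 2 := by
          rw [dm_quad, pl_norm_sq, Finset.mul_sum]
          simp_rw [Finset.mul_sum]
          refine Finset.sum_le_sum fun i _ => Finset.sum_le_sum fun j _ => ?_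
          by_cases h : ν i ≤ 0
          · exact mul_le_mul_of_nonneg_right (hneg _ _ h) (by positivity)
          · by_cases hi : i = i1
            · subst hi
              by_cases hj : j = D.j0
              · subst hj
                refine mul_le_mul_of_nonneg_right ?_ (by positivity)
                simpa [lam, hi1] using hneg1
              · simp [hxi, hj]
            · have : (y : PL ι d) i = 0 := y.2 i (by omega)
              have : x i = 0 := by simp [hx, this, he i hi]
              simp [this]
        have h2 := (abs_le.1 (habsInt x)).1
        have hsn : |s| ≤ ‖x‖ := by
          have h3 : ‖x i1‖ ≤ ‖x‖ := PiLp.norm_apply_le x i1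
          rw [hxi, norm_smul] at h3
          simpa using h3
        have hen : ‖e‖ = 1 := by simp [e]
        have hyn : ‖y‖ ≤ 2 * ‖x‖ := by
          have h4 : (y : PL ι d) = x - s • e := by simp [hx]
          have h5 : ‖(y : PL ι d)‖ ≤ ‖x‖ + ‖s • e‖ := by rw [h4]; exact norm_sub_le _ _
          rw [norm_smul, hen, mul_one, Real.norm_eq_abs] at h5
          have : ‖y‖ = ‖(y : PL ι d)‖ := rfl
          linarith
        have h6 : ‖((y, s) : Y × ℝ)‖ ≤ 2 * ‖x‖ := by
          rw [Prod.norm_def]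
          refine max_le hyn ?_
          simp only [Real.norm_eq_abs]
          linarith [norm_nonneg x]
        have h7 : D.C0 / η + 1 ≤ ‖x‖ := by linarith
        have h8 : 0 ≤ D.C0 / η := by positivity
        have h9 : D.C0 / η ≤ ‖x‖ ^ 2 := by nlinarith
        have h10 : D.C0 ≤ η * ‖x‖ ^ 2 := by
          rw [div_le_iff₀ hη] at h9; linarith
        unfold Phi
        linarith) (Real.sqrt ρ2) (Real.pi ^ 2 / (4 * (D.C4 * d))) (Real.sqrt_pos.2 hrhopos) (by positivity) (by
        intro x hPx hwx
        have hx0 : ∀ i, ν i ≤ 0 → x i = 0 := by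
          intro i hi
          have h1 : dm mask x = 0 := by rw [← hP, hPx]; rfl
          ext j
          have h2 : dm mask x i j = 0 := by rw [h1]; rfl
          rw [dm_apply] at h2
          simpa [mask, not_lt.2 hi] using h2
        have hW : ∑ i, (ν i : ℝ) * ‖x i‖ ^ 2 = ρ2 := by
          have h1 : ∑ i, max (ν i : ℝ) 0 * ‖x i‖ ^ 2 = ∑ i, (ν i : ℝ) * ‖x i‖ ^ 2 := by
            refine Finset.sum_congr rfl fun i _ => ?_
            by_cases h : ν i ≤ 0
            · simp [hx0 i h]
            · rw [max_eq_left]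
              exact_mod_cast (by omega : 0 ≤ ν i)
          simp only [w] at hwx
          rw [Real.sqrt_inj (Finset.sum_nonneg fun i _ => by positivity) hrhopos.le] at hwx
          rw [← h1, hwx]
        have hcar := carleman ν hν x hx0
        rw [hW] at hcar
        have hK : ∫ t in (0:ℝ)..1, D.K (ev ν x t) ≤ ∫ t in (0:ℝ)..1, D.C4 * ‖ev ν x t‖ ^ 4 := by
          refine integral_mono_on zero_le_one ?_ ?_ fun t _ => D.K_le _
          · exact (D.K_cont.comp (ev_continuous_t ν x)).intervalIntegrable _ _
          · exact (continuous_const.mul ((ev_continuous_t ν x).norm.pow 4)).intervalIntegrable _ _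
        rw [intervalIntegral.integral_const_mul] at hK
        have hq : ⟪dm (fun i _ => Real.pi * ν i) x, x⟫ = Real.pi * ρ2 := by
          rw [dm_quad, ← hW, Finset.mul_sum]
          refine Finset.sum_congr rfl fun i _ => ?_
          rw [← Finset.mul_sum, ← esp_norm_sq, mul_assoc]
        rw [D.Phi_eq ν hν, hq]
        have h5 : D.C4 * ∫ t in (0:ℝ)..1, ‖ev ν x t‖ ^ 4 ≤ D.C4 * (d * ρ2 ^ 2) := by gcongr
        have h6 : Real.pi * ρ2 - D.C4 * (d * ρ2 ^ 2) = Real.pi ^ 2 / (4 * (D.C4 * d)) := by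
          rw [hρ2]; field_simp; ring
        linarith)
  have cev := ev_continuous_t ν c
  have cg : Continuous fun t => D.gR (ev ν c t) := D.gR_cont.comp cev
  have hcn : ‖c‖ ≤ D.C1 / (2 * η) := by
    have := hgrow c
    rw [hc0, norm_zero] at this
    rw [le_div_iff₀ (by positivity)]; linarith
  have heq : dm (fun i _ => 2 * Real.pi * ν i) c
      = (2 : ℝ) • dm (fun _ j => D.a j) c + fc ν (fun t => D.gR (ev ν c t)) := by
    have h1 : dm (fun i _ => 2 * Real.pi * ν i) c = (2 : ℝ) • dm (fun i _ => Real.pi * ν i) c := by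
      ext i j
      simp only [PiLp.smul_apply, dm_apply, Complex.real_smul]; push_cast; ring
    have h2 : (2 : ℝ) • dm (D.lam ν) c = fc ν (fun t => D.gR (ev ν c t)) := sub_eq_zero.1 hc0
    rw [dm_lam, smul_sub, sub_eq_iff_eq_add] at h2
    rw [h1, h2, add_comm]
  have hkfc : fc ν (fun t => D.k (ev ν c t))
      = (2 : ℝ) • dm (fun _ j => D.a j) c + fc ν (fun t => D.gR (ev ν c t)) := by
    apply ext_inner_right ℝ
    intro v
    have cv := ev_continuous_t ν v
    rw [fc_inner ν (fun t => D.k (ev ν c t)) (D.k_cont.comp cev), inner_add_left, fc_inner ν _ cg, real_inner_smul_left,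
      ← D.A_int ν hν, ← intervalIntegral.integral_const_mul, ← intervalIntegral.integral_add]
    · refine intervalIntegral.integral_congr fun t _ => ?_
      simp only [k]
      rw [inner_add_left, real_inner_smul_left]
    · exact (continuous_const.mul ((D.A_cont.comp cev).inner cv)).intervalIntegrable _ _
    · exact (cg.inner cv).intervalIntegrable _ _
  have hb := fc_bessel ν hν (fun t => D.gR (ev ν c t)) cg D.C1 (fun t => D.gR_bd _)
  have hdma := dm_norm_le (ι := ι) (fun _ j => D.a j) (2 * Real.pi) (by positivity) (fun _ j => haM j) c
  have hnn : 0 ≤ D.C1 / (2 * η) := by positivity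
  have hpn : 0 ≤ 4 * Real.pi * (D.C1 / (2 * η)) := by positivity
  refine ⟨c, ?_, by linarith, ?_, ?_⟩
  · intro i
    rw [hkfc, ← heq]
    ext j
    rw [dm_apply]; rfl
  · rw [heq]
    refine (norm_add_le _ _).trans ?_
    rw [norm_smul, Real.norm_eq_abs, abs_of_pos (by norm_num : (0:ℝ) < 2)]
    have : 2 * Real.pi * ‖c‖ ≤ 2 * Real.pi * (D.C1 / (2 * η)) := by gcongr
    linarith
  · refine hcβ.trans (le_of_eq ?_)
    rw [D.Phi_eq ν hν, intervalIntegral.integral_sub, intervalIntegral.integral_const_mul,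
      ← fc_inner ν (fun t => D.k (ev ν c t)) (D.k_cont.comp cev), hkfc, ← heq]
    · congr 1
      rw [dm_quad, dm_quad, Finset.mul_sum]
      simp_rw [Finset.mul_sum]
      refine Finset.sum_congr rfl fun i _ => Finset.sum_congr rfl fun j _ => by ring
    · exact (continuous_const.mul ((D.k_cont.comp cev).inner cev)).intervalIntegrable _ _
    · exact (D.K_cont.comp cev).intervalIntegrable _ _

end HamData
end FiniteDim

/-! Part 5 -/

section LimitPart
open MeasureTheory intervalIntegral Filter

variable {d : ℕ}

/-- A continuous function on `[0,1]` with equal end values all of whose nonconstant Fourier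
coefficients vanish is constant. -/
lemma fourier_unique (y : ℝ → ℂ) (hy : Continuous y) (h01 : y 0 = y 1)
    (hk : ∀ k : ℤ, k ≠ 0 → ∫ t in (0:ℝ)..1, ee (-k) t • y t = 0) :
    ∀ t ∈ Icc (0:ℝ) 1, y t = y 0 := by
  have : Fact (0 < (1:ℝ)) := ⟨one_pos⟩
  have hcont : Continuous (AddCircle.liftIco 1 0 y) :=
    AddCircle.liftIco_continuous (by simpa using h01) hy.continuousOn
  let f : C(AddCircle (1:ℝ), ℂ) := ⟨_, hcont⟩
  have hcoef : ∀ k : ℤ, k ≠ 0 → fourierCoeff f k = 0 := by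
    intro k hk0
    have h1 : fourierCoeff (AddCircle.liftIco 1 0 y) k = _ := fourierCoeff_liftIco_eq (T := 1) (a := 0) y k
    have h2 : fourierCoeff f k = fourierCoeff (AddCircle.liftIco 1 0 y) k := rfl
    rw [h2, h1, fourierCoeffOn_eq_integral]
    have h3 : ∫ x in (0:ℝ)..(0 + 1), fourier (-k) (x : AddCircle ((0:ℝ) + 1 - 0)) • y x
        = ∫ t in (0:ℝ)..1, ee (-k) t • y t := by
      rw [zero_add]
      refine intervalIntegral.integral_congr fun t _ => ?_
      rw [fourier_coe_apply]
      simp [ee]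
    rw [h3, hk k hk0, smul_zero]
  have hsum : Summable (fourierCoeff f) :=
    summable_of_ne_finset_zero (s := {0}) fun k hk0 => hcoef k (by simpa using hk0)
  have hval : ∀ x, f x = fourierCoeff f 0 := by
    intro x
    have h1 := has_pointwise_sum_fourier_series_of_summable hsum x
    have h2 : HasSum (fun i => fourierCoeff f i • fourier i x) (fourierCoeff f 0 • fourier 0 x) :=
      hasSum_single 0 fun k hk0 => by rw [hcoef k hk0, zero_smul]
    have := h1.unique h2
    simpa using this
  have hIco : ∀ t ∈ Ico (0:ℝ) 1, y t = fourierCoeff f 0 := by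
    intro t ht
    rw [← hval (t : AddCircle (1:ℝ))]
    exact (AddCircle.liftIco_coe_apply (p := 1) (a := 0) (f := y) (by simpa using ht)).symm
  intro t ht
  rcases eq_or_lt_of_le ht.2 with h | h
  · rw [h, h01]
  · rw [hIco t ⟨ht.1, h⟩, hIco 0 ⟨le_rfl, one_pos⟩]

lemma limit_integral {V : Type*} [NormedAddCommGroup V] [NormedSpace ℝ V]
    (x : ℕ → ℝ → Esp d) (X : ℝ → Esp d) (B : ℝ) (hx : ∀ N, Continuous (x N))
    (hB : ∀ N, ∀ t ∈ Icc (0:ℝ) 1, ‖x N t‖ ≤ B)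
    (hlim : ∀ t ∈ Icc (0:ℝ) 1, Tendsto (fun N => x N t) atTop (𝓝 (X t)))
    (h : ℝ → Esp d → V) (hc : Continuous (fun p : ℝ × Esp d => h p.1 p.2)) :
    Tendsto (fun N => ∫ t in (0:ℝ)..1, h t (x N t)) atTop (𝓝 (∫ t in (0:ℝ)..1, h t (X t))) := by
  have hK : IsCompact (Icc (0:ℝ) 1 ×ˢ closedBall (0 : Esp d) B) :=
    isCompact_Icc.prod (isCompact_closedBall _ _)
  obtain ⟨M, hM⟩ := hK.exists_bound_of_continuousOn hc.continuousOn
  have hsub : uIoc (0:ℝ) 1 ⊆ Icc 0 1 := by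
    rw [uIoc_of_le zero_le_one]; exact Ioc_subset_Icc_self
  refine intervalIntegral.tendsto_integral_filter_of_dominated_convergence (fun _ => M) ?_ ?_ (by simp) ?_
  · exact Eventually.of_forall fun N =>
      (hc.comp (continuous_id.prodMk (hx N))).aestronglyMeasurable
  · refine Eventually.of_forall fun N => Eventually.of_forall fun t ht => ?_
    exact hM (t, x N t) ⟨hsub ht, by simpa using hB N t (hsub ht)⟩
  · refine Eventually.of_forall fun t ht => ?_
    exact (hc.tendsto (t, X t)).comp (tendsto_const_nhds.prodMk_nhds (hlim t (hsub ht)))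

lemma ev_hasDerivAt {ι : Type*} [Fintype ι] (ν : ι → ℤ) (c : PL ι d) (t : ℝ) :
    HasDerivAt (ev ν c) (Complex.I • ev ν (dm (fun i _ => 2 * Real.pi * ν i) c) t) t := by
  have h1 : HasDerivAt (ev ν c) (∑ i, (2 * Real.pi * Complex.I * ν i * ee (ν i) t) • c i) t := by
    unfold ev
    exact HasDerivAt.fun_sum fun i _ => (ee_hasDerivAt (ν i) t).smul_const (c i)
  convert h1 using 1
  ext j
  simp only [PiLp.smul_apply, ev_apply, dm_apply, smul_eq_mul, Finset.mul_sum]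
  simp
  refine Finset.sum_congr rfl fun i _ => by ring

lemma ev_holder {ι : Type*} [Fintype ι] (ν : ι → ℤ) (hν : Function.Injective ν) (c : PL ι d) (C : ℝ)
    (hC : ‖dm (fun i _ => 2 * Real.pi * ν i) c‖ ≤ C) (s t : ℝ) (hs : 0 ≤ s) (hst : s ≤ t) (ht : t ≤ 1) :
    ‖ev ν c t - ev ν c s‖ ≤ (C ^ 2 + 1) / 2 * Real.sqrt (t - s) := by
  set v := ev ν (dm (fun i _ => 2 * Real.pi * ν i) c) with hv
  have hvc : Continuous v := ev_continuous_t _ _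
  rcases eq_or_lt_of_le hst with rfl | hlt
  · simp
  set l := Real.sqrt (t - s) with hl
  have hlpos : 0 < l := Real.sqrt_pos.2 (by linarith)
  have hl2 : l * l = t - s := Real.mul_self_sqrt (by linarith)
  have h1 : ev ν c t - ev ν c s = ∫ τ in s..t, Complex.I • v τ :=
    (integral_eq_sub_of_hasDerivAt (fun τ _ => ev_hasDerivAt ν c τ)
      ((hvc.const_smul Complex.I).intervalIntegrable _ _)).symm
  rw [h1]
  have h2 : ‖∫ τ in s..t, Complex.I • v τ‖ ≤ ∫ τ in s..t, ‖Complex.I • v τ‖ :=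
    intervalIntegral.norm_integral_le_integral_norm hst
  have h3 : ∫ τ in s..t, ‖Complex.I • v τ‖ ≤ ∫ τ in s..t, (l / 2 * ‖v τ‖ ^ 2 + 1 / (2 * l)) := by
    refine integral_mono_on hst ?_ ?_ fun τ _ => ?_
    · exact ((hvc.const_smul Complex.I).norm).intervalIntegrable _ _
    · exact ((continuous_const.mul (hvc.norm.pow 2)).add continuous_const).intervalIntegrable _ _
    · rw [norm_smul, Complex.norm_I, one_mul]
      have : l / 2 * ‖v τ‖ ^ 2 + 1 / (2 * l) - ‖v τ‖ = (l * ‖v τ‖ - 1) ^ 2 / (2 * l) := by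
        field_simp; ring
      have : 0 ≤ (l * ‖v τ‖ - 1) ^ 2 / (2 * l) := by positivity
      linarith
  have ci : Continuous fun τ => l / 2 * ‖v τ‖ ^ 2 := continuous_const.mul (hvc.norm.pow 2)
  rw [intervalIntegral.integral_add (ci.intervalIntegrable _ _) (by simp),
    intervalIntegral.integral_const_mul, intervalIntegral.integral_const] at h3
  have h4 : ∫ τ in s..t, ‖v τ‖ ^ 2 ≤ ∫ τ in (0:ℝ)..1, ‖v τ‖ ^ 2 := by
    refine integral_mono_interval hs hst ht ?_ ((hvc.norm.pow 2).intervalIntegrable _ _)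
    exact Eventually.of_forall fun τ => by simp only [Pi.zero_apply]; positivity
  rw [hv, parseval_norm ν hν] at h4
  have h5 : ‖dm (fun i _ => 2 * Real.pi * ν i) c‖ ^ 2 ≤ C ^ 2 := pow_le_pow_left₀ (norm_nonneg _) hC 2
  have h6 : (t - s) • (1 / (2 * l)) = l / 2 := by
    rw [smul_eq_mul, ← hl2]; field_simp
  rw [h6] at h3
  have h7 : l / 2 * ∫ τ in s..t, ‖v τ‖ ^ 2 ≤ l / 2 * C ^ 2 := by
    gcongr; rw [hv]; linarith
  linarith

lemma ev_sup {ι : Type*} [Fintype ι] (ν : ι → ℤ) (hν : Function.Injective ν) (c : PL ι d) (C : ℝ)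
    (hC1 : ‖c‖ ≤ C)
    (hC : ‖dm (fun i _ => 2 * Real.pi * ν i) c‖ ≤ C) (t : ℝ) (ht : t ∈ Icc (0:ℝ) 1) :
    ‖ev ν c t‖ ≤ C ^ 2 + 1 := by
  have hvc : Continuous (ev ν c) := ev_continuous_t _ _
  have h1 : ∀ s ∈ Icc (0:ℝ) 1, ‖ev ν c t - ev ν c s‖ ≤ (C ^ 2 + 1) / 2 := by
    intro s hs
    have key : ∀ s t : ℝ, 0 ≤ s → s ≤ t → t ≤ 1 → ‖ev ν c t - ev ν c s‖ ≤ (C ^ 2 + 1) / 2 := by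
      intro s t h0 hst h1
      refine (ev_holder ν hν c C hC s t h0 hst h1).trans ?_
      have : Real.sqrt (t - s) ≤ 1 := Real.sqrt_le_one.2 (by linarith)
      nlinarith [sq_nonneg C]
    rcases le_total s t with h | h
    · exact key s t hs.1 h ht.2
    · rw [norm_sub_rev]; exact key t s ht.1 h hs.2
  have h2 : ∫ s in (0:ℝ)..1, ‖ev ν c t‖ ≤ ∫ s in (0:ℝ)..1, (1 / 2 * ‖ev ν c s‖ ^ 2 + (1 / 2 + (C ^ 2 + 1) / 2)) := by
    refine integral_mono_on zero_le_one (by simp) ?_ fun s hs => ?_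
    · exact ((continuous_const.mul (hvc.norm.pow 2)).add continuous_const).intervalIntegrable _ _
    · have h3 := h1 s hs
      have h4 : ‖ev ν c t‖ ≤ ‖ev ν c t - ev ν c s‖ + ‖ev ν c s‖ := by
        simpa using norm_add_le (ev ν c t - ev ν c s) (ev ν c s)
      nlinarith [sq_nonneg (‖ev ν c s‖ - 1)]
  have ci : Continuous fun τ => 1 / 2 * ‖ev ν c τ‖ ^ 2 := continuous_const.mul (hvc.norm.pow 2)
  rw [intervalIntegral.integral_add (ci.intervalIntegrable _ _) (by simp),
    intervalIntegral.integral_const_mul, parseval_norm ν hν] at h2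
  simp at h2
  have h5 : ‖c‖ ^ 2 ≤ C ^ 2 := pow_le_pow_left₀ (norm_nonneg _) hC1 2
  linarith

lemma fc_ev {ι : Type*} [Fintype ι] (ν : ι → ℤ) (hν : Function.Injective ν) (c : PL ι d) :
    fc ν (ev ν c) = c := by
  apply ext_inner_right ℝ
  intro v
  rw [fc_inner ν _ (ev_continuous_t ν c), parseval ν hν]

namespace HamData
variable (D : HamData d)

lemma approx : ∃ β > 0, ∃ B : ℝ, ∀ N : ℕ, ∃ x : ℝ → Esp d, Continuous x ∧ x 1 = x 0 ∧
    (∀ k : ℤ, |k| ≤ N → ((2 * Real.pi * k : ℝ) : ℂ) • (∫ t in (0:ℝ)..1, ee (-k) t • x t)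
      = ∫ t in (0:ℝ)..1, ee (-k) t • D.k (x t)) ∧
    (∀ t ∈ Icc (0:ℝ) 1, ‖x t‖ ≤ B) ∧
    (∀ s t, s ∈ Icc (0:ℝ) 1 → t ∈ Icc (0:ℝ) 1 → dist (x s) (x t) ≤ B * Real.sqrt (dist s t)) ∧
    β ≤ ∫ t in (0:ℝ)..1, (1 / 2 * ⟪D.k (x t), x t⟫ - D.K (x t)) := by
  obtain ⟨β, hβ, C, h⟩ := D.crit
  refine ⟨β, hβ, C ^ 2 + 1, fun N => ?_⟩
  let ν : {k : ℤ // k ∈ Finset.Icc (-(N + 1 : ℤ)) (N + 1)} → ℤ := fun k => k.1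
  have hν : Function.Injective ν := Subtype.val_injective
  obtain ⟨c, h1, h2, h3, h4⟩ := h ν hν ⟨⟨1, by simp only [Finset.mem_Icc]; omega⟩, rfl⟩
  refine ⟨ev ν c, ev_continuous_t ν c, by simpa using ev_periodic ν c 0, ?_,
    fun t ht => ev_sup ν hν c C h2 h3 t ht, ?_, h4⟩
  · intro k hk
    rw [abs_le] at hk
    let i : {k : ℤ // k ∈ Finset.Icc (-(N + 1 : ℤ)) (N + 1)} :=
      ⟨k, by simp only [Finset.mem_Icc]; omega⟩
    have h5 := h1 i
    have h6 : c i = ∫ t in (0:ℝ)..1, ee (-k) t • ev ν c t := by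
      conv_lhs => rw [← fc_ev ν hν c]
      rfl
    rw [h6] at h5
    exact h5
  · have key : ∀ s t : ℝ, 0 ≤ s → s ≤ t → t ≤ 1 →
        dist (ev ν c s) (ev ν c t) ≤ (C ^ 2 + 1) * Real.sqrt (dist s t) := by
      intro s t h0 hst ht
      have h5 := ev_holder ν hν c C h3 s t h0 hst ht
      rw [dist_comm, dist_eq_norm, dist_comm s t, Real.dist_eq, abs_of_nonneg (by linarith : 0 ≤ t - s)]
      have : 0 ≤ (C ^ 2 + 1) / 2 * Real.sqrt (t - s) := by positivity
      linarith
    intro s t hs ht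
    rcases le_total s t with hst | hst
    · exact key s t hs.1 hst ht.2
    · rw [dist_comm, dist_comm s t]; exact key t s ht.1 hst hs.2

/-- The limit loop on `[0,1]`. -/
lemma limit : ∃ X : ℝ → Esp d, Continuous X ∧ X 1 = X 0 ∧
    (∀ k : ℤ, ((2 * Real.pi * k : ℝ) : ℂ) • (∫ t in (0:ℝ)..1, ee (-k) t • X t)
      = ∫ t in (0:ℝ)..1, ee (-k) t • D.k (X t)) ∧
    0 < ∫ t in (0:ℝ)..1, (1 / 2 * ⟪D.k (X t), X t⟫ - D.K (X t)) := by
  obtain ⟨β, hβ, B, h⟩ := D.approx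
  choose x xc x1 xk xB xH xβ using h
  let F : ℕ → BoundedContinuousFunction (Icc (0:ℝ) 1) (Esp d) := fun N =>
    BoundedContinuousFunction.mkOfCompact ⟨fun t => x N t, (xc N).comp continuous_subtype_val⟩
  have hF : ∀ N t, F N t = x N t := fun N t => rfl
  have hcomp : IsCompact (closure (range F)) := by
    refine BoundedContinuousFunction.arzela_ascoli (closedBall (0 : Esp d) B) (isCompact_closedBall _ _) _ ?_ ?_
    · rintro _ t ⟨N, rfl⟩
      simpa [hF] using xB N t t.2
    · refine UniformEquicontinuous.equicontinuous ?_
      refine Metric.uniformEquicontinuous_of_continuity_modulus (fun r => B * Real.sqrt r) ?_ _ ?_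
      · have : Continuous fun r => B * Real.sqrt r := by fun_prop
        simpa using this.tendsto 0
      · rintro s t ⟨_, N, rfl⟩
        exact xH N s t s.2 t.2
  obtain ⟨f, -, φ, hφ, hlim⟩ := hcomp.tendsto_subseq (x := F) fun N => subset_closure ⟨N, rfl⟩
  let X : ℝ → Esp d := fun t => f (projIcc 0 1 zero_le_one t)
  have hXc : Continuous X := f.continuous.comp continuous_projIcc
  have hpt : ∀ t ∈ Icc (0:ℝ) 1, Tendsto (fun N => x (φ N) t) atTop (𝓝 (X t)) := by
    intro t ht
    have h1 := (continuous_eval_const (F := BoundedContinuousFunction (Icc (0:ℝ) 1) (Esp d)) (⟨t, ht⟩ : Icc (0:ℝ) 1)).tendsto f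
    have h2 := h1.comp hlim
    have : X t = f ⟨t, ht⟩ := by simp only [X]; rw [projIcc_of_mem zero_le_one ht]
    rw [this]
    exact h2
  have m0 : (0:ℝ) ∈ Icc (0:ℝ) 1 := ⟨le_rfl, zero_le_one⟩
  have m1 : (1:ℝ) ∈ Icc (0:ℝ) 1 := ⟨zero_le_one, le_rfl⟩
  refine ⟨X, hXc, ?_, ?_, ?_⟩
  · have h0 := hpt 0 m0
    have h1 := hpt 1 m1
    simp_rw [x1] at h1
    exact tendsto_nhds_unique h1 h0
  · intro k
    have l1 := limit_integral (fun N => x (φ N)) X B (fun N => xc _) (fun N => xB _) hpt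
      (fun t z => ee (-k) t • z) (((ee_continuous _).comp continuous_fst).smul continuous_snd)
    have l2 := limit_integral (fun N => x (φ N)) X B (fun N => xc _) (fun N => xB _) hpt
      (fun t z => ee (-k) t • D.k z)
      (((ee_continuous _).comp continuous_fst).smul (D.k_cont.comp continuous_snd))
    refine tendsto_nhds_unique (l1.const_smul ((2 * Real.pi * k : ℝ) : ℂ)) (l2.congr' ?_)
    have : ∀ᶠ N in atTop, |k|.toNat ≤ N := eventually_ge_atTop _
    filter_upwards [this] with N hN
    refine (xk (φ N) k ?_).symm
    have := hφ.id_le N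
    simp only [id] at this
    omega
  · have l1 := limit_integral (fun N => x (φ N)) X B (fun N => xc _) (fun N => xB _) hpt
      (fun t z => 1 / 2 * ⟪D.k z, z⟫ - D.K z)
      ((continuous_const.mul ((D.k_cont.comp continuous_snd).inner continuous_snd)).sub
        (D.K_cont.comp continuous_snd))
    exact hβ.trans_le (ge_of_tendsto' l1 fun N => xβ (φ N))

/-- **Theorem A**: existence of a one periodic solution with positive action. -/
theorem exists_solution : ∃ X : ℝ → Esp d, (∀ t, HasDerivAt X (Complex.I • D.k (X t)) t) ∧
    (∀ t, X (t + 1) = X t) ∧ 0 < ∫ t in (0:ℝ)..1, (1 / 2 * ⟪D.k (X t), X t⟫ - D.K (X t)) := by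
  obtain ⟨X, hXc, hX1, hXk, hXpos⟩ := D.limit
  have hvc : Continuous fun t => D.k (X t) := D.k_cont.comp hXc
  let F : ℝ → Esp d := fun t => ∫ s in (0:ℝ)..t, D.k (X s)
  have hFd : ∀ t, HasDerivAt F (D.k (X t)) t := fun t =>
    integral_hasDerivAt_right (hvc.intervalIntegrable _ _) (hvc.stronglyMeasurableAtFilter _ _) hvc.continuousAt
  have hFc : Continuous F := continuous_iff_continuousAt.2 fun t => (hFd t).continuousAt
  have hF0 : F 0 = 0 := by simp [F]
  have hF1 : F 1 = 0 := by
    have := hXk 0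
    simp [ee_zero] at this
    exact this.symm
  have hFk : ∀ k : ℤ, (2 * Real.pi * Complex.I * k : ℂ) • (∫ t in (0:ℝ)..1, ee (-k) t • F t)
      = ∫ t in (0:ℝ)..1, ee (-k) t • D.k (X t) := by
    intro k
    have hc1 : Continuous fun t => ee (-k) t • D.k (X t) := (ee_continuous _).smul hvc
    have hc2 : Continuous fun t => (2 * Real.pi * Complex.I * k : ℂ) • ee (-k) t • F t :=
      ((ee_continuous _).smul hFc).const_smul (2 * Real.pi * Complex.I * k : ℂ)
    have hd : ∀ t ∈ uIcc (0:ℝ) 1, HasDerivAt (fun t => ee (-k) t • F t)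
        (ee (-k) t • D.k (X t) - (2 * Real.pi * Complex.I * k : ℂ) • ee (-k) t • F t) t := by
      intro t _
      have := (ee_hasDerivAt (-k) t).smul (hFd t)
      have e : ee (-k) t • D.k (X t) - (2 * Real.pi * Complex.I * k : ℂ) • ee (-k) t • F t
          = ee (-k) t • D.k (X t) + (2 * Real.pi * Complex.I * ((-k : ℤ) : ℂ) * ee (-k) t) • F t := by
        rw [smul_smul, sub_eq_add_neg, ← neg_smul]
        congr 2
        push_cast; ring
      rw [e]
      exact this
    have h1 := integral_eq_sub_of_hasDerivAt hd ((hc1.sub hc2).intervalIntegrable _ _)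
    rw [hF0, hF1, smul_zero, smul_zero, sub_zero,
      intervalIntegral.integral_sub (hc1.intervalIntegrable _ _) (hc2.intervalIntegrable _ _),
      intervalIntegral.integral_smul, sub_eq_zero] at h1
    exact h1.symm
  have hXF : ∀ t ∈ Icc (0:ℝ) 1, X t = X 0 + Complex.I • F t := by
    intro t ht
    ext j
    have hproj : Continuous fun z : Esp d => z j := PiLp.continuous_apply 2 _ j
    have hyc : Continuous fun t => (X t - Complex.I • F t) j := hproj.comp (hXc.sub (hFc.const_smul Complex.I))
    have h := fourier_unique (fun t => (X t - Complex.I • F t) j) hyc (by simp [hF0, hF1, hX1]) (by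
      intro k hk
      have hne : (2 * Real.pi * k : ℂ) ≠ 0 := by simp [hk, Real.pi_ne_zero]
      have c1 : Continuous fun t => ee (-k) t • X t := (ee_continuous _).smul hXc
      have c2 : Continuous fun t => Complex.I • ee (-k) t • F t := ((ee_continuous _).smul hFc).const_smul Complex.I
      have h1 : ∫ t in (0:ℝ)..1, (ee (-k) t • X t - Complex.I • ee (-k) t • F t) = 0 := by
        rw [intervalIntegral.integral_sub (c1.intervalIntegrable _ _) (c2.intervalIntegrable _ _),
          intervalIntegral.integral_smul]
        have h2 := hXk k
        rw [← hFk k] at h2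
        have h3 : (2 * Real.pi * k : ℂ) • ((∫ t in (0:ℝ)..1, ee (-k) t • X t)
            - Complex.I • ∫ t in (0:ℝ)..1, ee (-k) t • F t) = 0 := by
          rw [smul_sub, smul_smul, sub_eq_zero]
          push_cast at h2
          rw [h2]
          congr 1; ring
        exact (smul_eq_zero.1 h3).resolve_left hne
      let pr : Esp d →L[ℝ] ℂ := (EuclideanSpace.proj (𝕜 := ℂ) j).restrictScalars ℝ
      have c3 : Continuous fun t => ee (-k) t • X t - Complex.I • ee (-k) t • F t := c1.sub c2
      have h4 := pr.intervalIntegral_comp_comm (c3.intervalIntegrable (μ := volume) 0 1)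
      rw [h1, map_zero] at h4
      rw [← h4]
      refine intervalIntegral.integral_congr fun t _ => ?_
      simp [pr]
      ring) t ht
    simp only [hF0, PiLp.sub_apply, smul_zero, sub_zero, PiLp.add_apply] at h ⊢
    rw [← h]; ring
  let u : ℝ → Esp d := fun s => D.k (X (Int.fract s))
  have huc : Continuous u :=
    D.k_cont.comp (ContinuousOn.comp_fract'' (f := X) hXc.continuousOn hX1.symm)
  have hup : Function.Periodic u 1 := fun t => by simp [u]
  let G : ℝ → Esp d := fun t => X 0 + Complex.I • ∫ s in (0:ℝ)..t, u s
  have hGd : ∀ t, HasDerivAt G (Complex.I • u t) t := fun t =>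
    ((integral_hasDerivAt_right (huc.intervalIntegrable _ _) (huc.stronglyMeasurableAtFilter _ _)
      huc.continuousAt).const_smul Complex.I).const_add _
  have hGX : ∀ t ∈ Ico (0:ℝ) 1, G t = X t := by
    intro t ht
    rw [hXF t ⟨ht.1, ht.2.le⟩]
    simp only [G, F]
    congr 2
    refine intervalIntegral.integral_congr fun s hs => ?_
    rw [uIcc_of_le ht.1] at hs
    simp only [u]
    rw [Int.fract_eq_self.2 ⟨hs.1, hs.2.trans_lt ht.2⟩]
  have hu1 : ∫ s in (0:ℝ)..1, u s = 0 := by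
    rw [← hF1]
    refine intervalIntegral.integral_congr_Ioo_of_le zero_le_one fun s hs => ?_
    simp only [u]
    rw [Int.fract_eq_self.2 ⟨hs.1.le, hs.2⟩]
  have hGp : Function.Periodic G 1 := by
    intro t
    simp only [G]
    rw [← intervalIntegral.integral_add_adjacent_intervals (huc.intervalIntegrable 0 t)
      (huc.intervalIntegrable t (t + 1)), hup.intervalIntegral_add_eq t 0, zero_add, hu1, add_zero]
  have hGf : ∀ t, G t = X (Int.fract t) := by
    intro t
    rw [← hGX _ ⟨Int.fract_nonneg t, Int.fract_lt_one t⟩]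
    have := hGp.sub_zsmul_eq (x := t) ⌊t⌋
    rw [← this]
    congr 1
    simp only [Int.fract, zsmul_eq_mul, mul_one]
  refine ⟨G, fun t => ?_, hGp, ?_⟩
  · rw [hGf t]; exact hGd t
  · refine hXpos.trans_le (le_of_eq ?_)
    refine intervalIntegral.integral_congr_Ioo_of_le zero_le_one fun s hs => ?_
    rw [hGX s ⟨hs.1.le, hs.2⟩]

end HamData
end LimitPart

/-! Part 6 -/

section UpperBound
open MeasureTheory intervalIntegral Filter

/-- The cut-off slope. -/
def thet (s0 M s : ℝ) : ℝ := Real.smoothTransition ((s - s0) / (M - s0))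

/-- The profile function with derivative `thet`. -/
def ff (s0 M s : ℝ) : ℝ := M + ∫ u in s0..s, thet s0 M u

section profile
variable {s0 M : ℝ} (h : s0 < M)

lemma thet_contDiff (s0 M : ℝ) : ContDiff ℝ (⊤ : ℕ∞) (thet s0 M) := by
  unfold thet
  exact Real.smoothTransition.contDiff.comp (by fun_prop)

lemma thet_cont (s0 M : ℝ) : Continuous (thet s0 M) := (thet_contDiff s0 M).continuous

lemma thet_nonneg (s : ℝ) : 0 ≤ thet s0 M s := Real.smoothTransition.nonneg _
lemma thet_le_one (s : ℝ) : thet s0 M s ≤ 1 := Real.smoothTransition.le_one _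
lemma thet_zero (h : s0 < M) {s : ℝ} (hs : s ≤ s0) : thet s0 M s = 0 :=
  Real.smoothTransition.zero_of_nonpos (div_nonpos_of_nonpos_of_nonneg (by linarith) (by linarith))
lemma thet_pos (h : s0 < M) {s : ℝ} (hs : s0 < s) : 0 < thet s0 M s :=
  Real.smoothTransition.pos_of_pos (div_pos (by linarith) (by linarith))
lemma thet_one (h : s0 < M) {s : ℝ} (hs : M ≤ s) : thet s0 M s = 1 :=
  Real.smoothTransition.one_of_one_le (by rw [le_div_iff₀ (by linarith)]; linarith)

lemma ff_hasDerivAt (s0 M s : ℝ) : HasDerivAt (ff s0 M) (thet s0 M s) s :=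
  (integral_hasDerivAt_right ((thet_cont s0 M).intervalIntegrable _ _)
    ((thet_cont s0 M).stronglyMeasurableAtFilter _ _) (thet_cont s0 M).continuousAt).const_add _

lemma ff_contDiff (s0 M : ℝ) : ContDiff ℝ 2 (ff s0 M) := by
  have h2 : (2 : WithTop ℕ∞) = 1 + 1 := by norm_num
  rw [h2, contDiff_succ_iff_deriv]
  refine ⟨fun s => (ff_hasDerivAt s0 M s).differentiableAt, by simp, ?_⟩
  have : deriv (ff s0 M) = thet s0 M := funext fun s => (ff_hasDerivAt s0 M s).deriv
  rw [this]
  exact (thet_contDiff s0 M).of_le (by exact_mod_cast le_top)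

lemma ff_eq (h : s0 < M) {s : ℝ} (hs : s ≤ s0) : ff s0 M s = M := by
  unfold ff
  rw [intervalIntegral.integral_congr (g := fun _ => (0:ℝ))]
  · simp
  · intro u hu
    rw [uIcc_of_ge hs] at hu
    exact thet_zero h hu.2

lemma ff_gt (h : s0 < M) {s : ℝ} (hs : s0 < s) : M < ff s0 M s := by
  unfold ff
  have := intervalIntegral.intervalIntegral_pos_of_pos_on (a := s0) (b := s)
    ((thet_cont s0 M).intervalIntegrable _ _) (fun u hu => thet_pos h hu.1) hs
  linarith

lemma ff_ge (h : s0 < M) (s : ℝ) : M ≤ ff s0 M s := by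
  rcases le_or_gt s s0 with hs | hs
  · exact (ff_eq h hs).ge
  · exact (ff_gt h hs).le

lemma ff_sub (h : s0 < M) {s : ℝ} (hs : M ≤ s) : ff s0 M s - s = ff s0 M M - M := by
  unfold ff
  rw [← intervalIntegral.integral_add_adjacent_intervals ((thet_cont s0 M).intervalIntegrable s0 M)
    ((thet_cont s0 M).intervalIntegrable M s)]
  rw [intervalIntegral.integral_congr (a := M) (b := s) (g := fun _ => (1:ℝ))]
  · simp; ring
  · intro u hu
    rw [uIcc_of_le hs] at hu
    exact thet_one h hu.1

lemma thet_mul_le (h : s0 < M) (hM : 0 < M) {s : ℝ} (hs : 0 ≤ s) : thet s0 M s * s ≤ ff s0 M s := by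
  have h1 := thet_le_one (s0 := s0) (M := M) s
  have h3 := ff_ge h s
  rcases le_or_gt s M with h2 | h2
  · nlinarith
  · have := ff_sub h h2.le
    have := ff_ge h M
    nlinarith
end profile

variable {d : ℕ}

/-- The diagonal map as a continuous linear map. -/
def diagA (a : Fin d → ℝ) : Esp d →L[ℝ] Esp d :=
  LinearMap.toContinuousLinearMap
    { toFun := fun z => WithLp.toLp 2 fun j => (a j : ℂ) * z j
      map_add' := fun z w => by ext j; simp [mul_add]
      map_smul' := fun s z => by
        ext j
        simp only [PiLp.smul_apply, Complex.real_smul, RingHom.id_apply]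
        ring }

lemma diagA_apply (a : Fin d → ℝ) (z : Esp d) (j : Fin d) : diagA a z j = (a j : ℂ) * z j := rfl

/-- The diagonal quadratic form. -/
def qq (a : Fin d → ℝ) (z : Esp d) : ℝ := ∑ j, a j * ‖z j‖ ^ 2

lemma diagA_symm (a : Fin d → ℝ) (z w : Esp d) : ⟪diagA a z, w⟫ = ⟪diagA a w, z⟫ := by
  rw [esp_inner, esp_inner]
  refine Finset.sum_congr rfl fun j _ => ?_
  simp only [diagA_apply, map_mul, Complex.conj_ofReal, mul_assoc, Complex.re_ofReal_mul]
  congr 1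
  simp only [Complex.mul_re, Complex.conj_re, Complex.conj_im]; ring

lemma diagA_inner (a : Fin d → ℝ) (z : Esp d) : ⟪diagA a z, z⟫ = qq a z := by
  rw [esp_inner, qq]
  refine Finset.sum_congr rfl fun j _ => ?_
  simp only [diagA_apply, map_mul, Complex.conj_ofReal]
  rw [mul_assoc, Complex.re_ofReal_mul, Complex.conj_mul', ← Complex.ofReal_pow, Complex.ofReal_re]

lemma qq_eq (a : Fin d → ℝ) : qq a = fun z : Esp d => ⟪diagA a z, z⟫ := funext fun z => (diagA_inner a z).symm

lemma qq_contDiff (a : Fin d → ℝ) : ContDiff ℝ (⊤ : ℕ∞) (qq a) := by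
  rw [qq_eq]
  exact (diagA a).contDiff.inner ℝ contDiff_id

lemma qq_hasFDerivAt (a : Fin d → ℝ) (z : Esp d) :
    HasFDerivAt (qq a) (innerSL ℝ ((2:ℝ) • diagA a z)) z := by
  rw [qq_eq]
  have h1 := (diagA a).hasFDerivAt (x := z) |>.inner ℝ (hasFDerivAt_id z)
  refine h1.congr_fderiv ?_
  ext w
  simp only [ContinuousLinearMap.comp_apply, fderivInnerCLM_apply, ContinuousLinearMap.prod_apply,
    innerSL_apply_apply, real_inner_smul_left, id]
  rw [diagA_symm a w z]
  simp
  ring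

lemma inner_I_self (z : Esp d) : ⟪z, Complex.I • z⟫ = 0 := by
  rw [esp_inner]
  refine Finset.sum_eq_zero fun j _ => ?_
  simp only [PiLp.smul_apply, smul_eq_mul, Complex.mul_re, Complex.conj_re, Complex.conj_im, Complex.I_re,
    Complex.I_im, Complex.mul_im]
  ring

lemma inner_gradient {F : Esp d → ℝ} {z : Esp d} (h : Esp d) :
    ⟪gradient F z, h⟫ = fderiv ℝ F z h := by
  unfold gradient
  exact InnerProductSpace.toDual_symm_apply

/-- Taylor estimates for `C²` functions with compact support. -/
lemma compact_taylor (S : Esp d → ℝ) (hS : ContDiff ℝ 2 S) (hc : HasCompactSupport S) :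
    Continuous (gradient S) ∧ (∃ C0, ∀ z, |S z| ≤ C0) ∧ (∃ C1, ∀ z, ‖gradient S z‖ ≤ C1) ∧
    ∃ ell > 0, ∀ z h, |S (z + h) - S z - ⟪gradient S z, h⟫| ≤ ell * ‖h‖ ^ 2 := by
  have hd : ContDiff ℝ 1 (fderiv ℝ S) := hS.fderiv_right (by norm_num)
  have hdc : HasCompactSupport (fderiv ℝ S) := hc.fderiv (𝕜 := ℝ)
  have hgn : ∀ z, ‖gradient S z‖ = ‖fderiv ℝ S z‖ := fun z => by
    unfold gradient; exact LinearIsometryEquiv.norm_map _ _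
  refine ⟨?_, ?_, ?_, ?_⟩
  · unfold gradient
    exact (LinearIsometryEquiv.continuous _).comp hd.continuous
  · obtain ⟨C, hC⟩ := hc.exists_bound_of_continuous hS.continuous
    exact ⟨C, hC⟩
  · obtain ⟨C, hC⟩ := hdc.exists_bound_of_continuous hd.continuous
    exact ⟨C, fun z => by rw [hgn]; exact hC z⟩
  · obtain ⟨L, hL⟩ := hd.lipschitzWith_of_hasCompactSupport hdc (by norm_num)
    refine ⟨L + 1, by positivity, fun z h => ?_⟩
    have h1 := Convex.norm_image_sub_le_of_norm_hasFDerivWithin_le' (𝕜 := ℝ) (f := S) (f' := fderiv ℝ S)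
      (φ := fderiv ℝ S z) (s := closedBall z ‖h‖) (C := L * ‖h‖) (x := z) (y := z + h)
      (fun x _ => ((hS.differentiable (by norm_num)) x).hasFDerivAt.hasFDerivWithinAt)
      (fun x hx => by
        have h2 := hL.dist_le_mul x z
        rw [dist_eq_norm] at h2
        refine h2.trans ?_
        gcongr
        exact hx) (convex_closedBall _ _) (by simp) (by simp)
    rw [inner_gradient]
    simp only [add_sub_cancel_left, Real.norm_eq_abs] at h1
    refine h1.trans ?_
    nlinarith [sq_nonneg ‖h‖]

lemma qq_le (a : Fin d → ℝ) (C : ℝ) (hC : ∀ j, a j ≤ C) (z : Esp d) : qq a z ≤ C * ‖z‖ ^ 2 := by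
  rw [esp_norm_sq, Finset.mul_sum]
  exact Finset.sum_le_sum fun j _ => mul_le_mul_of_nonneg_right (hC j) (by positivity)

lemma le_qq (a : Fin d → ℝ) (C : ℝ) (hC : ∀ j, C ≤ a j) (z : Esp d) : C * ‖z‖ ^ 2 ≤ qq a z := by
  rw [esp_norm_sq, Finset.mul_sum]
  exact Finset.sum_le_sum fun j _ => mul_le_mul_of_nonneg_right (hC j) (by positivity)

theorem upper (H : Esp d → ℝ) (hs : ContDiff ℝ (⊤ : ℕ∞) H) (hc : IsCompact (tsupport H)) (j0 : Fin d)
    (r : ℝ) (hr : 0 < r) (hsup : ∀ z ∈ tsupport H, ‖z j0‖ ^ 2 < r ^ 2)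
    (U : Set (Esp d)) (hU : IsOpen U) (h0U : (0 : Esp d) ∈ U) (hUH : ∀ x ∈ U, H x = H 0)
    (hmax : ∀ x, H x ≤ H 0) (hM : Real.pi * r ^ 2 < H 0) : HasFastOrbit H := by
  classical
  set M := H 0 with hMdef
  have hp := Real.pi_pos
  have hr2 : 0 < r ^ 2 := by positivity
  have hMpos : 0 < M := lt_trans (by positivity) hM
  obtain ⟨a0, ha1, ha2⟩ : ∃ a0, Real.pi < a0 ∧ a0 < min (2 * Real.pi) (M / r ^ 2) :=
    exists_between (lt_min (by linarith) (by rw [lt_div_iff₀ hr2]; exact hM))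
  have ha3 : a0 < 2 * Real.pi := ha2.trans_le (min_le_left _ _)
  have ha4 : a0 * r ^ 2 < M := by
    have := ha2.trans_le (min_le_right _ _)
    rwa [lt_div_iff₀ hr2] at this
  obtain ⟨B, hB⟩ := hc.exists_bound_of_continuousOn (f := fun z : Esp d => z) continuousOn_id
  set s0 := (a0 * r ^ 2 + M) / 2 with hs0
  have hs01 : a0 * r ^ 2 < s0 := by rw [hs0]; linarith
  have hs02 : s0 < M := by rw [hs0]; linarith
  have hs0pos : 0 < s0 := lt_trans (mul_pos (by linarith) hr2) hs01
  set b := min 1 ((s0 - a0 * r ^ 2) / (B ^ 2 + 1)) with hb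
  have hbpos : 0 < b := lt_min one_pos (div_pos (by linarith) (by positivity))
  have hb1 : b ≤ 1 := min_le_left _ _
  have hb2 : b * (B ^ 2 + 1) ≤ s0 - a0 * r ^ 2 := by
    have : b ≤ (s0 - a0 * r ^ 2) / (B ^ 2 + 1) := min_le_right _ _
    rwa [le_div_iff₀ (by positivity)] at this
  let a : Fin d → ℝ := fun j => if j = j0 then a0 else b
  have haj0 : a j0 = a0 := by simp [a]
  have haj : ∀ j, j ≠ j0 → a j = b := fun j hj => by simp [a, hj]
  have hpi3 := Real.pi_gt_three
  have hab : ∀ j, b ≤ a j := by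
    intro j
    by_cases hj : j = j0
    · rw [hj, haj0]; linarith
    · rw [haj j hj]
  have ha2pi : ∀ j, a j ≤ 2 * Real.pi := by
    intro j
    by_cases hj : j = j0
    · rw [hj, haj0]; linarith
    · rw [haj j hj]; linarith
  have hq0 : ∀ z, 0 ≤ qq a z := fun z => by
    have := le_qq a b hab z
    have : 0 ≤ b * ‖z‖ ^ 2 := by positivity
    linarith
  have hqsup : ∀ z ∈ tsupport H, qq a z < s0 := by
    intro z hz
    have h1 : qq a z ≤ a0 * ‖z j0‖ ^ 2 + b * ‖z‖ ^ 2 := by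
      rw [esp_norm_sq, Finset.mul_sum, qq, ← Finset.add_sum_erase _ _ (Finset.mem_univ j0), haj0]
      gcongr
      refine (Finset.sum_le_sum (g := fun j => b * ‖z j‖ ^ 2) fun j hj => ?_).trans
        (Finset.sum_le_sum_of_subset_of_nonneg (Finset.erase_subset _ _) fun j _ _ => by positivity)
      rw [haj j (Finset.ne_of_mem_erase hj)]
    have h2 : ‖z‖ ^ 2 ≤ B ^ 2 := pow_le_pow_left₀ (norm_nonneg _) (hB z hz) 2
    have h3 := hsup z hz
    have h4 : a0 * ‖z j0‖ ^ 2 < a0 * r ^ 2 := by gcongr; linarith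
    have h5 : b * ‖z‖ ^ 2 ≤ b * (B ^ 2 + 1) := by gcongr; linarith
    linarith
  have hHzero : ∀ z, s0 ≤ qq a z → H z = 0 := by
    intro z hz
    by_contra hne
    exact absurd (hqsup z (subset_tsupport _ hne)) (not_lt.2 hz)
  have hGzero : ∀ z, s0 ≤ qq a z → gradient H z = 0 := by
    intro z hz
    have h1 : z ∉ tsupport H := fun h => absurd (hqsup z h) (not_lt.2 hz)
    have h2 : fderiv ℝ H z = 0 := by
      by_contra hne
      exact h1 (support_fderiv_subset ℝ hne)
    rw [gradient, h2, map_zero]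
  set κ := ff s0 M M - M with hκ
  let S : Esp d → ℝ := fun z => ff s0 M (qq a z) - qq a z - H z - κ
  have hqc := qq_contDiff a
  have hS2 : ContDiff ℝ 2 S := by
    have h1 : ContDiff ℝ 2 (qq a) := contDiff_infty.1 hqc 2
    have h2 : ContDiff ℝ 2 H := contDiff_infty.1 hs 2
    exact ((((ff_contDiff s0 M).comp h1).sub h1).sub h2).sub contDiff_const
  have hSc : HasCompactSupport S := by
    refine HasCompactSupport.of_support_subset_isCompact (K := closedBall 0 (M / b + 1)) (isCompact_closedBall _ _) ?_
    intro z hz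
    by_contra hnot
    apply hz
    have h1 : M / b + 1 < ‖z‖ := by simpa using hnot
    have h2 : 0 ≤ M / b := by positivity
    have h3 : M / b ≤ ‖z‖ ^ 2 := by nlinarith
    have h4 : M ≤ b * ‖z‖ ^ 2 := by
      rw [div_le_iff₀ hbpos] at h3; linarith
    have h5 : M ≤ qq a z := h4.trans (le_qq a b hab z)
    simp only [S]
    rw [hHzero z (by linarith), ff_sub hs02 h5]; ring
  obtain ⟨hgc, ⟨C0, hC0⟩, ⟨C1, hC1⟩, ell, hell, htay⟩ := compact_taylor S hS2 hSc
  -- formula for the gradient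
  have hgrad : ∀ z, gradient S z = (thet s0 M (qq a z) - 1) • (2:ℝ) • diagA a z - gradient H z := by
    intro z
    apply ext_inner_right ℝ
    intro w
    rw [inner_gradient, inner_sub_left, inner_gradient]
    have hH := ((hs.differentiable (by simp)) z).hasFDerivAt
    have h1 : HasFDerivAt S (thet s0 M (qq a z) • innerSL ℝ ((2:ℝ) • diagA a z) - innerSL ℝ ((2:ℝ) • diagA a z)
        - fderiv ℝ H z) z :=
      ((((ff_hasDerivAt s0 M (qq a z)).comp_hasFDerivAt z (qq_hasFDerivAt a z)).sub
        (qq_hasFDerivAt a z)).sub hH).sub_const _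
    rw [h1.fderiv]
    simp only [ContinuousLinearMap.sub_apply, ContinuousLinearMap.smul_apply, innerSL_apply_apply,
      real_inner_smul_left, smul_eq_mul]
    ring
  have hKform : ∀ z, qq a z + (S z + κ) = ff s0 M (qq a z) - H z := fun z => by simp only [S]; ring
  have hKnn : ∀ z, 0 ≤ qq a z + (S z + κ) := fun z => by
    rw [hKform]; linarith [ff_ge hs02 (qq a z), hmax z]
  have hC0' : ∀ z, |S z + κ| ≤ C0 + |κ| := fun z => (abs_add_le _ _).trans (by linarith [hC0 z])
  have hC0nn : 0 ≤ C0 + |κ| := (abs_nonneg _).trans (hC0' 0)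
  -- quartic bound
  obtain ⟨δ, hδ, hball⟩ : ∃ δ > 0, ∀ z : Esp d, ‖z‖ < δ → qq a z + (S z + κ) = 0 := by
    have hV : IsOpen (U ∩ {z | qq a z < s0}) := hU.inter (isOpen_lt hqc.continuous continuous_const)
    have h0 : (0 : Esp d) ∈ U ∩ {z | qq a z < s0} := ⟨h0U, by simpa [qq] using hs0pos⟩
    obtain ⟨δ, hδ, hsub⟩ := Metric.isOpen_iff.1 hV 0 h0
    refine ⟨δ, hδ, fun z hz => ?_⟩
    have h1 := hsub (show z ∈ ball 0 δ by simpa using hz)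
    have h2 : qq a z < s0 := h1.2
    rw [hKform, ff_eq hs02 h2.le, hUH z h1.1, sub_self]
  set C4 := 2 * Real.pi / δ ^ 2 + (C0 + |κ|) / δ ^ 4 with hC4
  have hC4pos : 0 < C4 := by positivity
  have hKle : ∀ z, qq a z + (S z + κ) ≤ C4 * ‖z‖ ^ 4 := by
    intro z
    rcases lt_or_ge ‖z‖ δ with h | h
    · rw [hball z h]; positivity
    · have h1 := qq_le a _ ha2pi z
      have h2 := (abs_le.1 (hC0' z)).2
      have h3 : 2 * Real.pi * ‖z‖ ^ 2 ≤ 2 * Real.pi / δ ^ 2 * ‖z‖ ^ 4 := by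
        rw [div_mul_eq_mul_div, le_div_iff₀ (by positivity)]
        have : δ ^ 2 ≤ ‖z‖ ^ 2 := pow_le_pow_left₀ hδ.le h 2
        calc 2 * Real.pi * ‖z‖ ^ 2 * δ ^ 2 ≤ 2 * Real.pi * ‖z‖ ^ 2 * ‖z‖ ^ 2 := by gcongr
          _ = _ := by ring
      have h4 : C0 + |κ| ≤ (C0 + |κ|) / δ ^ 4 * ‖z‖ ^ 4 := by
        rw [div_mul_eq_mul_div, le_div_iff₀ (by positivity)]
        gcongr
      rw [hC4, add_mul]; linarith
  let D : HamData d :=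
    { a := a, j0 := j0, a_gt := by rw [haj0]; exact ha1, a_lt := by rw [haj0]; exact ha3
      a_pos := fun j => hbpos.trans_le (hab j)
      a_other := fun j hj => by rw [haj j hj]; linarith
      R := fun z => S z + κ, gR := gradient S
      R_cont := hS2.continuous.add continuous_const
      gR_cont := hgc, C0 := C0 + |κ|, R_bd := hC0', C1 := C1, gR_bd := hC1
      ell := ell, ell_pos := hell
      taylor := fun z h => by
        have := htay z h
        rwa [add_sub_add_right_eq_sub]
      C4 := C4, C4_pos := hC4pos, K_nonneg := hKnn, K_le := hKle }
  obtain ⟨X, hXd, hXp, hXpos⟩ := D.exists_solution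
  have hK : ∀ z, D.K z = ff s0 M (qq a z) - H z := hKform
  have hk : ∀ z, D.k z = (thet s0 M (qq a z)) • (2:ℝ) • diagA a z - gradient H z := by
    intro z
    have h1 : D.k z = (2:ℝ) • diagA a z + gradient S z := rfl
    rw [h1, hgrad, sub_smul, one_smul]; abel
  have hXc : Continuous X := continuous_iff_continuousAt.2 fun t => (hXd t).continuousAt
  -- the profile is constant along the solution
  have hconst : ∀ t, ff s0 M (qq a (X t)) = ff s0 M (qq a (X 0)) := by
    have hder : ∀ t, HasDerivAt (fun t => ff s0 M (qq a (X t))) 0 t := by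
      intro t
      have h1 := (qq_hasFDerivAt a (X t)).comp_hasDerivAt t (hXd t)
      have h2 := (ff_hasDerivAt s0 M (qq a (X t))).comp t h1
      refine h2.congr_deriv ?_
      rcases le_or_gt (qq a (X t)) s0 with h | h
      · rw [thet_zero hs02 h, zero_mul]
      · rw [hk, hGzero _ h.le, sub_zero, innerSL_apply_apply]
        have h3 : (Complex.I • thet s0 M (qq a (X t)) • (2:ℝ) • diagA a (X t) : Esp d)
            = thet s0 M (qq a (X t)) • Complex.I • (2:ℝ) • diagA a (X t) := smul_comm _ _ _
        rw [h3, real_inner_smul_right, inner_I_self]; simp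
    intro t
    exact is_const_of_deriv_eq_zero (fun t => (hder t).differentiableAt) (fun t => (hder t).deriv) t 0
  have hcontra : ¬ ∀ t, 1 / 2 * ⟪D.k (X t), X t⟫ - D.K (X t) ≤ 0 := by
    intro hall
    have h1 : ∫ t in (0:ℝ)..1, (1 / 2 * ⟪D.k (X t), X t⟫ - D.K (X t)) ≤ 0 := by
      have h2 := intervalIntegral.integral_nonneg (a := 0) (b := 1) (μ := volume)
        (f := fun t => -(1 / 2 * ⟪D.k (X t), X t⟫ - D.K (X t))) zero_le_one
        (fun t _ => by linarith [hall t])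
      rw [intervalIntegral.integral_neg] at h2
      linarith
    linarith
  rcases le_or_gt (qq a (X 0)) s0 with h0 | h0
  · have hle : ∀ t, qq a (X t) ≤ s0 := by
      intro t
      by_contra hlt
      have h1 := ff_gt hs02 (not_le.1 hlt)
      rw [hconst t, ff_eq hs02 h0] at h1
      exact lt_irrefl _ h1
    have hkH : ∀ t, D.k (X t) = - gradient H (X t) := by
      intro t
      rw [hk, thet_zero hs02 (hle t), zero_smul, zero_sub]
    refine ⟨fun t => X (-t), 1, ⟨one_pos, ?_, ?_, ?_⟩, le_rfl⟩
    · intro t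
      have h1 := (hXd (-t)).scomp t (hasDerivAt_neg t)
      refine h1.congr_deriv ?_
      rw [hkH, hamVF]; simp
    · intro t
      show X (-(t + 1)) = X (-t)
      rw [← hXp (-(t + 1))]; congr 1; ring
    · by_contra hne
      push Not at hne
      apply hcontra
      intro t
      have hXconst : ∀ s, X s = X 0 := fun s => by
        have := hne (-s) 0
        simpa using this
      have h1 : X = fun _ => X 0 := funext hXconst
      have h2 : HasDerivAt X 0 t := by rw [h1]; exact hasDerivAt_const _ _
      have h3 := (hXd t).unique h2
      have h4 : D.k (X t) = 0 := (smul_eq_zero.1 h3).resolve_left Complex.I_ne_zero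
      rw [h4, inner_zero_left]
      have := hKnn (X t)
      rw [hK, ← hKform]
      linarith
  · exfalso
    apply hcontra
    intro t
    have hgt : s0 < qq a (X t) := by
      by_contra hle
      have h1 := ff_gt hs02 h0
      rw [← hconst t, ff_eq hs02 (not_lt.1 hle)] at h1
      exact lt_irrefl _ h1
    rw [hk, hK, hGzero _ hgt.le, hHzero _ hgt.le, sub_zero, sub_zero, real_inner_smul_left,
      real_inner_smul_left, diagA_inner]
    have := thet_mul_le hs02 hMpos (hq0 (X t))
    linarith

end UpperBound

/-! Part 7 -/

section LowerBound

lemma exists_profile (R M' : ℝ) (hR : 0 < R) (hM : M' < Real.pi * R) :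
    ∃ f : ℝ → ℝ, ContDiff ℝ (⊤ : ℕ∞) f ∧ Antitone f ∧
      (∃ ε > 0, (∀ s ≤ ε, f s = f 0) ∧ ∀ s, R - ε ≤ s → f s = 0) ∧
      (∀ s, |deriv f s| < Real.pi) ∧ M' ≤ f 0 := by
  have hpi := Real.pi_pos
  obtain ⟨c, hc1, hc2⟩ : ∃ c, max (M' / R) 0 < c ∧ c < Real.pi :=
    exists_between (max_lt ((div_lt_iff₀ hR).2 hM) hpi)
  have hc0 : 0 < c := lt_of_le_of_lt (le_max_right _ _) hc1
  have hcR : M' < c * R := (div_lt_iff₀ hR).1 (lt_of_le_of_lt (le_max_left _ _) hc1)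
  set ε := min (R / 8) ((c * R - M') / (4 * c)) with hε
  have hεpos : 0 < ε := lt_min (by linarith) (div_pos (by linarith) (by linarith))
  have hε1 : ε ≤ R / 8 := min_le_left _ _
  have hε2 : ε * (4 * c) ≤ c * R - M' := (le_div_iff₀ (by linarith)).1 (min_le_right _ _)
  let ψ : ContDiffBump (R / 2) := ⟨R / 2 - 2 * ε, R / 2 - ε, by linarith, by linarith⟩
  have hψc : Continuous (ψ : ℝ → ℝ) := ψ.continuous
  have hψi : ∀ a b, IntervalIntegrable (ψ : ℝ → ℝ) MeasureTheory.volume a b :=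
    fun a b => hψc.intervalIntegrable a b
  let f : ℝ → ℝ := fun s => c * ∫ u in s..R, ψ u
  have hfd : ∀ s, HasDerivAt f (c * (- ψ s)) s := fun s =>
    (intervalIntegral.integral_hasDerivAt_left (hψi s R)
      (hψc.stronglyMeasurableAtFilter _ _) hψc.continuousAt).const_mul c
  have hderiv : deriv f = fun s => c * (- ψ s) := funext fun s => (hfd s).deriv
  have hanti : Antitone f := by
    apply antitone_of_deriv_nonpos (fun s => (hfd s).differentiableAt)
    intro s
    rw [hderiv]
    have := ψ.nonneg (x := s)
    have := mul_nonneg hc0.le this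
    show c * (- ψ s) ≤ 0
    linarith
  have hR0 : f R = 0 := by simp [f]
  have hlow : ∀ u ≤ ε, ψ u = 0 := by
    intro u hu
    apply ψ.zero_of_le_dist
    show R / 2 - ε ≤ dist u (R / 2)
    rw [Real.dist_eq, abs_of_nonpos (by linarith)]; linarith
  have hhigh : ∀ u, R - ε ≤ u → ψ u = 0 := by
    intro u hu
    apply ψ.zero_of_le_dist
    show R / 2 - ε ≤ dist u (R / 2)
    rw [Real.dist_eq, abs_of_nonneg (by linarith)]; linarith
  refine ⟨f, ?_, hanti, ⟨ε, hεpos, ?_, ?_⟩, ?_, ?_⟩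
  · refine contDiff_infty_iff_deriv.2 ⟨fun s => (hfd s).differentiableAt, ?_⟩
    rw [hderiv]
    exact contDiff_const.mul ψ.contDiff.neg
  · intro s hs
    have h1 : (∫ u in s..(0:ℝ), ψ u) = 0 := by
      apply intervalIntegral.integral_zero_ae
      filter_upwards with u hu
      apply hlow
      have := hu.2
      rcases max_choice s 0 with h | h <;> rw [h] at this <;> linarith
    show c * _ = c * _
    rw [← intervalIntegral.integral_add_adjacent_intervals (hψi s 0) (hψi 0 R), h1, zero_add]
  · intro s hs
    have h1 : (∫ u in s..R, ψ u) = 0 := by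
      apply intervalIntegral.integral_zero_ae
      filter_upwards with u hu
      apply hhigh
      have := hu.1
      rcases min_choice s R with h | h <;> rw [h] at this <;> linarith
    show c * _ = 0
    rw [h1, mul_zero]
  · intro s
    rw [hderiv]
    have h0 := ψ.nonneg (x := s)
    have h1 := ψ.le_one (x := s)
    show |c * (- ψ s)| < Real.pi
    rw [abs_mul, abs_neg, abs_of_pos hc0, abs_of_nonneg h0]
    nlinarith
  · have h1 : f (2 * ε) ≤ f 0 := hanti (by linarith)
    have h2 : f R ≤ f (R - 2 * ε) := hanti (by linarith)
    have h3 : f (2 * ε) - f (R - 2 * ε) = c * (R - 4 * ε) := by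
      show c * _ - c * _ = _
      rw [← intervalIntegral.integral_add_adjacent_intervals (hψi (2 * ε) (R - 2 * ε)) (hψi _ R)]
      rw [intervalIntegral.integral_congr (a := 2 * ε) (b := R - 2 * ε) (g := fun _ => (1:ℝ))]
      · simp; ring
      · intro u hu
        rw [uIcc_of_le (by linarith)] at hu
        apply ψ.one_of_mem_closedBall
        show dist u (R / 2) ≤ R / 2 - 2 * ε
        rw [Real.dist_eq, abs_le]
        constructor <;> linarith [hu.1, hu.2]
    linarith

variable {d : ℕ}

lemma gradient_radial (f : ℝ → ℝ) (hf : Differentiable ℝ f) (z : Esp d) :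
    gradient (fun z : Esp d => f (‖z‖ ^ 2)) z = (2 * deriv f (‖z‖ ^ 2)) • z := by
  refine ext_inner_right ℝ fun h => ?_
  rw [inner_gradient]
  have h1 := (hf (‖z‖ ^ 2)).hasDerivAt.comp_hasFDerivAt z (hasStrictFDerivAt_norm_sq z).hasFDerivAt
  have h2 : HasFDerivAt (fun z : Esp d => f (‖z‖ ^ 2)) _ z := h1
  rw [h2.fderiv, inner_smul_left]
  simp
  ring

lemma radial_no_fast (f : ℝ → ℝ) (hf : Differentiable ℝ f) (hd : ∀ s, |deriv f s| < Real.pi) :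
    ¬ HasFastOrbit (fun z : Esp d => f (‖z‖ ^ 2)) := by
  rintro ⟨γ, T, ⟨hT, hγ, hper, t0, t1, hne⟩, hT1⟩
  have hγ' : ∀ t, HasDerivAt γ (Complex.I • ((2 * deriv f (‖γ t‖ ^ 2)) • γ t)) t := by
    intro t
    have := hγ t
    rwa [hamVF, gradient_radial f hf] at this
  have hnorm : ∀ t, ‖γ t‖ ^ 2 = ‖γ 0‖ ^ 2 := by
    intro t
    have hder : ∀ t, HasDerivAt (fun t => ‖γ t‖ ^ 2) 0 t := by
      intro t
      refine (hγ' t).norm_sq.congr_deriv ?_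
      rw [smul_comm, inner_smul_right, inner_I_self]; simp
    exact is_const_of_deriv_eq_zero (fun t => (hder t).differentiableAt) (fun t => (hder t).deriv) t 0
  set κ := deriv f (‖γ 0‖ ^ 2) with hκ
  have hγ2 : ∀ t, HasDerivAt γ ((Complex.I * (2 * κ : ℂ)) • γ t) t := by
    intro t
    refine (hγ' t).congr_deriv ?_
    rw [hnorm t, ← hκ, mul_smul]
    ext j
    simp
    ring
  have hE : ∀ t : ℝ, HasDerivAt (fun t : ℝ => Complex.exp (-(Complex.I * (2 * κ)) * t))
      (Complex.exp (-(Complex.I * (2 * κ)) * t) * (-(Complex.I * (2 * κ)))) t := by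
    intro t
    have h1 : HasDerivAt (fun t : ℝ => -(Complex.I * (2 * κ : ℂ)) * (t : ℂ))
        (-(Complex.I * (2 * κ))) t := by
      simpa using (Complex.ofRealCLM.hasDerivAt (x := t)).const_mul (-(Complex.I * (2 * κ : ℂ)))
    exact h1.cexp
  have hconst : ∀ t : ℝ, Complex.exp (-(Complex.I * (2 * κ)) * t) • γ t = γ 0 := by
    have hder : ∀ t : ℝ, HasDerivAt (fun t : ℝ => Complex.exp (-(Complex.I * (2 * κ)) * t) • γ t) 0 t := by
      intro t
      refine ((hE t).smul (hγ2 t)).congr_deriv ?_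
      rw [smul_smul, ← add_smul]
      ring_nf
      simp
    intro t
    have := is_const_of_deriv_eq_zero (fun t => (hder t).differentiableAt) (fun t => (hder t).deriv) t 0
    simpa using this
  have hγ0 : γ 0 ≠ 0 := by
    intro h0
    have : ∀ t, γ t = 0 := fun t => by
      have := hnorm t
      rw [h0] at this
      simpa using this
    exact hne (by rw [this, this])
  have hTe : Complex.exp (-(Complex.I * (2 * κ)) * T) = 1 := by
    have h1 := hconst T
    have h2 : γ T = γ 0 := by simpa using hper 0
    rw [h2] at h1
    have h3 : (Complex.exp (-(Complex.I * (2 * κ)) * T) - 1) • γ 0 = 0 := by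
      rw [sub_smul, h1, one_smul, sub_self]
    rcases smul_eq_zero.1 h3 with h | h
    · exact sub_eq_zero.1 h
    · exact absurd h hγ0
  obtain ⟨k, hk⟩ := Complex.exp_eq_one_iff.1 hTe
  have hk2 : -(κ * T) = k * Real.pi := by
    have := congrArg Complex.im hk
    simp at this
    linarith
  have hpi := Real.pi_pos
  have hkT : |κ * T| < Real.pi := by
    rw [abs_mul, abs_of_pos hT]
    have := hd (‖γ 0‖ ^ 2)
    nlinarith [abs_nonneg κ]
  have hk0 : k = 0 := by
    have h1 : |(k : ℝ)| * Real.pi < 1 * Real.pi := by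
      rw [one_mul, ← abs_of_pos hpi, ← abs_mul, ← hk2, abs_neg, abs_of_pos hpi]; exact hkT
    have h2 : |(k : ℝ)| < 1 := lt_of_mul_lt_mul_right h1 hpi.le
    have h3 : |k| < 1 := by exact_mod_cast h2
    exact Int.abs_lt_one_iff.1 h3
  have hκ0 : κ = 0 := by
    rw [hk0] at hk2
    have : κ * T = 0 := by simp at hk2; simp; exact hk2
    rcases mul_eq_zero.1 this with h | h
    · exact h
    · exact absurd h hT.ne'
  have hc2 : ∀ t, γ t = γ 0 := fun t => by
    have := hconst t
    rw [hκ0] at this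
    simpa using this
  exact hne (by rw [hc2, hc2 t1])

lemma lower (V : Set (Esp d)) (r : ℝ) (hr : 0 < r) (hV : ∀ z : Esp d, ‖z‖ ^ 2 < r ^ 2 → z ∈ V)
    (M' : ℝ) (hM : M' < Real.pi * r ^ 2) :
    ∃ H : Esp d → ℝ, InHclass V {0} H ∧ ¬ HasFastOrbit H ∧ M' ≤ H 0 := by
  obtain ⟨f, hfs, hfa, ⟨ε, hε, hf0, hf1⟩, hfd, hfM⟩ := exists_profile (r ^ 2) M' (by positivity) hM
  have hcont : Continuous fun z : Esp d => ‖z‖ ^ 2 := by fun_prop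
  have hsub : tsupport (fun z : Esp d => f (‖z‖ ^ 2)) ⊆ {z | ‖z‖ ^ 2 ≤ r ^ 2 - ε} := by
    refine closure_minimal ?_ (isClosed_le hcont continuous_const)
    intro z hz
    by_contra h
    simp only [Set.mem_ofPred_eq, not_le] at h
    exact hz (hf1 _ h.le)
  refine ⟨fun z => f (‖z‖ ^ 2), ⟨?_, ?_, ?_, ?_, ?_⟩, radial_no_fast f (hfs.differentiable (by simp)) hfd, ?_⟩
  · exact hfs.comp (contDiff_norm_sq ℝ)
  · refine (isCompact_closedBall (0 : Esp d) r).of_isClosed_subset (isClosed_tsupport _) ?_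
    intro z hz
    have := hsub hz
    simp only [Set.mem_ofPred_eq] at this
    rw [mem_closedBall_zero_iff]
    exact (sq_le_sq₀ (norm_nonneg _) hr.le).1 (by linarith)
  · intro z hz
    have := hsub hz
    simp only [Set.mem_ofPred_eq] at this
    exact hV z (by linarith)
  · refine ⟨{z | ‖z‖ ^ 2 < ε}, isOpen_lt hcont continuous_const, ?_, f 0, fun x hx => hf0 _ (le_of_lt hx)⟩
    rintro z rfl
    simpa using hε
  · rintro z rfl x
    exact hfa (by simp)
  · simpa using hfM

end LowerBound

/-- **Capacity of the symplectic cylinder (concluding remark of Section 5 of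
Ginzburg–Gürel)**: `c_HZ(B_r^{2n} × ℝ^{2m}, {0}) = π r²`, where the cylinder
`B_r^{2n} × ℝ^{2m} ⊂ ℝ^{2(n+m)} ≅ ℂ^{n+m}` consists of the points whose first
`n` complex coordinates lie in the ball of radius `r`. -/
theorem stmt_10 (n m : ℕ) (hn : 1 ≤ n) (hm : 1 ≤ m) (r : ℝ) (hr : 0 < r) :
    relCap {z : Esp (n + m) | ∑ i : Fin n, ‖z (Fin.castAdd m i)‖ ^ 2 < r ^ 2}
        {(0 : Esp (n + m))} =
      ENNReal.ofReal (Real.pi * r ^ 2) := by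
  apply le_antisymm
  · refine sSup_le ?_
    rintro c ⟨H, ⟨hs, hc, hsup, ⟨U, hU, h0U, b, hb⟩, hmax⟩, hno, z, hz, rfl⟩
    have hz0 : z = 0 := hz
    subst hz0
    apply ENNReal.ofReal_le_ofReal
    by_contra hlt
    push Not at hlt
    have h0U' : (0 : Esp (n + m)) ∈ U := h0U rfl
    refine hno (upper H hs hc (Fin.castAdd m ⟨0, hn⟩) r hr ?_ U hU h0U' ?_ (hmax 0 rfl) hlt)
    · intro w hw
      have h1 : ∑ i : Fin n, ‖w (Fin.castAdd m i)‖ ^ 2 < r ^ 2 := hsup hw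
      refine lt_of_le_of_lt ?_ h1
      exact Finset.single_le_sum (f := fun i : Fin n => ‖w (Fin.castAdd m i)‖ ^ 2)
        (fun i _ => by positivity) (Finset.mem_univ _)
    · intro x hx
      rw [hb x hx, hb 0 h0U']
  · refine le_of_forall_lt fun c hc => ?_
    have hctop : c ≠ ⊤ := ne_top_of_lt hc
    have hc' : c.toReal < Real.pi * r ^ 2 := (ENNReal.lt_ofReal_iff_toReal_lt hctop).1 hc
    obtain ⟨M', hM1, hM2⟩ := exists_between hc'
    obtain ⟨H, hH, hno, hMH⟩ := lower {z : Esp (n + m) | ∑ i : Fin n, ‖z (Fin.castAdd m i)‖ ^ 2 < r ^ 2}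
      r hr (fun z hz => by
        refine lt_of_le_of_lt ?_ hz
        rw [esp_norm_sq, Fin.sum_univ_add]
        exact le_add_of_nonneg_right (Finset.sum_nonneg fun i _ => by positivity)) M' hM2
    refine lt_of_lt_of_le ?_ (le_sSup ⟨H, hH, hno, 0, rfl, rfl⟩)
    exact (ENNReal.lt_ofReal_iff_toReal_lt hctop).2 (lt_of_lt_of_le hM1 hMH)
end
end

section
/- Let n ≥ 1, let V ⊆ ℝ^{2n} be open, let Z ⊂ V be nonempty and compact, and let H ∈ 𝓗(V,Z) be such that X_H has no fast periodic orbit. Then there exists a nonnegative function K ∈ 𝓗(V,Z) with max K = max H such that X_K has no fast periodic orbit. -/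
open scoped RealInnerProductSpace ENNReal NNReal Topology
open Metric Set

noncomputable section

variable {n : ℕ}

theorem taylor_aux {E : Type} [NormedAddCommGroup E] [NormedSpace ℝ E] [FiniteDimensional ℝ E]
    (x₀ : E) (r : ℝ) (k : ℕ) : ∀ (F : Type) [NormedAddCommGroup F] [NormedSpace ℝ F] (g : E → F),
    (∀ z ∈ closedBall x₀ r, ContDiffAt ℝ (⊤ : ℕ∞) g z) →
    ∃ M : ℝ, 0 ≤ M ∧ ∀ x ∈ closedBall x₀ r, ∀ y ∈ closedBall x₀ r,
      (∀ j, 1 ≤ j → j ≤ k → iteratedFDeriv ℝ j g x = 0) → ‖g y - g x‖ ≤ M * ‖y - x‖ ^ k := by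
  induction k with
  | zero =>
    intro F _ _ g hg
    have hc : ContinuousOn g (closedBall x₀ r) :=
      fun z hz => (hg z hz).continuousAt.continuousWithinAt
    obtain ⟨M, hM⟩ := (isCompact_closedBall x₀ r).exists_bound_of_continuousOn hc
    refine ⟨|M| + |M|, by positivity, fun x hx y hy _ => ?_⟩
    have h1 := hM x hx
    have h2 := hM y hy
    have h3 := le_abs_self M
    have h4 := norm_sub_le (g y) (g x)
    simp only [pow_zero, mul_one]
    linarith
  | succ k ih =>
    intro F _ _ g hg
    obtain ⟨M, hM0, hM⟩ := ih (E →L[ℝ] F) (fderiv ℝ g)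
      (fun z hz => (hg z hz).fderiv_right (by simp))
    refine ⟨M, hM0, fun x hx y hy hj => ?_⟩
    have h0 : fderiv ℝ g x = 0 := by
      have := hj 1 le_rfl (by omega)
      have h2 := norm_iteratedFDeriv_one (𝕜 := ℝ) (f := g) (x := x)
      rw [this, norm_zero] at h2
      exact norm_eq_zero.1 h2.symm
    have hseg : segment ℝ x y ⊆ closedBall x₀ r := (convex_closedBall x₀ r).segment_subset hx hy
    have hb : ∀ z ∈ segment ℝ x y, ‖fderiv ℝ g z‖ ≤ M * ‖y - x‖ ^ k := by
      intro z hz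
      have h1 := hM x hx z (hseg hz) (fun j hj1 hj2 => by
        have h3 := hj (j + 1) (by omega) (by omega)
        have h4 := norm_iteratedFDeriv_fderiv (𝕜 := ℝ) (f := g) (x := x) (n := j)
        rw [h3, norm_zero] at h4
        exact norm_eq_zero.1 h4)
      rw [h0, sub_zero] at h1
      refine h1.trans ?_
      gcongr
      exact norm_sub_le_of_mem_segment hz
    have := (convex_segment (𝕜 := ℝ) x y).norm_image_sub_le_of_norm_fderiv_le
      (fun z hz => (hg z (hseg hz)).differentiableAt (by simp)) hb
      (left_mem_segment ℝ x y) (right_mem_segment ℝ x y)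
    rw [pow_succ, ← mul_assoc]
    exact this

theorem dimH_local {E : Type} [NormedAddCommGroup E] [NormedSpace ℝ E] [FiniteDimensional ℝ E]
    (f : E → ℝ) (S : Set E) (h : ∀ x ∈ S, ∃ t ∈ 𝓝[S] x, dimH (f '' t) = 0) :
    dimH (f '' S) = 0 := by
  have : SecondCountableTopology E := by
    have := FiniteDimensional.proper_real E
    infer_instance
  choose! t ht ht0 using h
  obtain ⟨u, hus, huc, huU⟩ := TopologicalSpace.countable_cover_nhdsWithin ht
  have h1 : f '' S ⊆ ⋃ x ∈ u, f '' t x := by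
    rw [← image_iUnion₂]; exact image_mono huU
  refine le_antisymm ((dimH_mono h1).trans ?_) zero_le
  rw [dimH_bUnion huc]
  simp only [iSup_le_iff]
  exact fun x hx => (ht0 x (hus hx)).le

theorem sard_flat {E : Type} [NormedAddCommGroup E] [NormedSpace ℝ E] [FiniteDimensional ℝ E]
    (f : E → ℝ) (S : Set E) (U : Set E) (hU : IsOpen U) (hSU : S ⊆ U)
    (hf : ∀ x ∈ U, ContDiffAt ℝ (⊤ : ℕ∞) f x)
    (hS : ∀ x ∈ S, ∀ j, 1 ≤ j → iteratedFDeriv ℝ j f x = 0) : dimH (f '' S) = 0 := by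
  have : SecondCountableTopology E := by
    have := FiniteDimensional.proper_real E
    infer_instance
  have key : ∀ k : ℕ, 0 < k → dimH (f '' S) ≤ (Module.finrank ℝ E : ℝ≥0∞) / k := by
    intro k hk
    have h1 : dimH (f '' S) ≤ dimH S / ((k : ℝ≥0) : ℝ≥0∞) := by
      apply dimH_image_le_of_locally_holder_on (by exact_mod_cast hk)
      intro x hx
      obtain ⟨r, hr, hrU⟩ := nhds_basis_closedBall.mem_iff.1 (hU.mem_nhds (hSU hx))
      obtain ⟨M, hM0, hM⟩ := taylor_aux x r k ℝ f (fun z hz => hf z (hrU hz))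
      refine ⟨M.toNNReal, S ∩ closedBall x r,
        inter_mem_nhdsWithin _ (closedBall_mem_nhds x hr), ?_⟩
      intro y hy z hz
      have h := hM z hz.2 y hy.2 (fun j hj _ => hS z hz.1 j hj)
      rw [edist_dist, edist_dist, ENNReal.ofReal_rpow_of_nonneg dist_nonneg (by positivity)]
      change _ ≤ ENNReal.ofReal M * _
      rw [← ENNReal.ofReal_mul hM0]
      apply ENNReal.ofReal_le_ofReal
      rw [dist_eq_norm, dist_eq_norm]
      simpa using h
    refine h1.trans ?_
    have h2 : dimH S ≤ (Module.finrank ℝ E : ℝ≥0∞) := by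
      rw [← Real.dimH_univ_eq_finrank]; exact dimH_mono (subset_univ _)
    have : ((k : ℝ≥0) : ℝ≥0∞) = (k : ℝ≥0∞) := by simp
    rw [this]
    gcongr
  refine le_antisymm ?_ zero_le
  have ht : Filter.Tendsto (fun k : ℕ => (Module.finrank ℝ E : ℝ≥0∞) / k) Filter.atTop (𝓝 0) := by
    simp only [div_eq_mul_inv]
    simpa using ENNReal.Tendsto.const_mul ENNReal.tendsto_inv_nat_nhds_zero
      (Or.inr (ENNReal.natCast_ne_top (Module.finrank ℝ E)))
  exact ge_of_tendsto ht (Filter.eventually_atTop.2 ⟨1, fun k hk => key k hk⟩)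

theorem sard_step {E : Type} [NormedAddCommGroup E] [NormedSpace ℝ E] [FiniteDimensional ℝ E]
    (f g : E → ℝ) (U : Set E) (hU : IsOpen U) 
    (hf : ∀ x ∈ U, ContDiffAt ℝ (⊤ : ℕ∞) f x) (hg : ∀ x ∈ U, ContDiffAt ℝ (⊤ : ℕ∞) g x)
    (x : E) (hx : x ∈ U) (hgx : fderiv ℝ g x ≠ 0)
    (IH : ∀ (h : (fderiv ℝ g x).ker → ℝ) (U' : Set (fderiv ℝ g x).ker), IsOpen U' →
      (∀ y ∈ U', ContDiffAt ℝ (⊤ : ℕ∞) h y) → dimH (h '' {y ∈ U' | fderiv ℝ h y = 0}) = 0) :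
    ∃ W ∈ 𝓝 x, dimH (f '' {y ∈ W | fderiv ℝ f y = 0 ∧ g y = 0}) = 0 := by
  have hs : HasStrictFDerivAt g (fderiv ℝ g x) x := (hg x hx).hasStrictFDerivAt (by simp)
  have hr : (fderiv ℝ g x).range = ⊤ := by
    rw [LinearMap.range_eq_top]
    exact LinearMap.surjective (f := (fderiv ℝ g x).toLinearMap) (by
      intro h; apply hgx; ext v; exact congrArg (fun l => l v) h)
  have hk : (fderiv ℝ g x).ker.ClosedComplemented := 
    ContinuousLinearMap.ker_closedComplemented_of_finiteDimensional_range _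
  let D := hs.implicitFunctionDataOfComplemented g (fderiv ℝ g x) hr hk
  let Φ := D.toOpenPartialHomeomorph
  let p : E →L[ℝ] (fderiv ℝ g x).ker := Classical.choose hk
  have hΦ : ∀ y, Φ y = (g y, p (y - x)) := fun y => rfl
  have hΦ' : (Φ : E → ℝ × (fderiv ℝ g x).ker) = fun y => (g y, p (y - x)) := rfl
  have hxs : x ∈ Φ.source := D.pt_mem_toOpenPartialHomeomorph_source
  have hsm : ∀ y ∈ U, ContDiffAt ℝ (⊤ : ℕ∞) Φ y := by
    intro y hy
    rw [hΦ']
    exact (hg y hy).prodMk (p.contDiff.contDiffAt.comp y (contDiffAt_id.sub contDiffAt_const))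
  have hinv : (fderiv ℝ Φ x).IsInvertible := D.isInvertible_fderiv_prodFun
  obtain ⟨e, he⟩ := hinv
  have hnear : ∀ᶠ y in 𝓝 x, (fderiv ℝ Φ y) ∈ range ((↑) : (E ≃L[ℝ] (ℝ × (fderiv ℝ g x).ker)) → _) := by
    have hc : ContinuousAt (fderiv ℝ Φ) x := ((hsm x hx).fderiv_right (m := 0) (by simp)).continuousAt
    apply hc.eventually_mem
    rw [← he]
    exact e.nhds
  obtain ⟨W, hWsub, hWo, hxW⟩ := _root_.mem_nhds_iff.1
    (Filter.inter_mem hnear (Filter.inter_mem (hU.mem_nhds hx) (Φ.open_source.mem_nhds hxs)))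
  refine ⟨W, hWo.mem_nhds hxW, ?_⟩
  let φ : (fderiv ℝ g x).ker → E := fun k => Φ.symm (0, k)
  let U' : Set (fderiv ℝ g x).ker := (fun k => ((0 : ℝ), k)) ⁻¹' (Φ.target ∩ Φ.symm ⁻¹' W)
  have hU' : IsOpen U' := (Φ.isOpen_inter_preimage_symm hWo).preimage (by fun_prop)
  have hφ : ∀ k ∈ U', ContDiffAt ℝ (⊤ : ℕ∞) φ k := by
    intro k hk
    obtain ⟨⟨e', he'⟩, hyU, hys⟩ := hWsub hk.2
    have : ContDiffAt ℝ (⊤ : ℕ∞) Φ.symm (0, k) := by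
      apply Φ.contDiffAt_symm (f₀' := e') hk.1
      · rw [he']
        exact ((hsm _ hyU).differentiableAt (by simp)).hasFDerivAt
      · exact hsm _ hyU
    exact this.comp k (contDiffAt_const.prodMk contDiffAt_id)
  have hh := IH (f ∘ φ) U' hU' (fun k hk => (hf _ (hWsub hk.2).2.1).comp k (hφ k hk))
  refine le_antisymm ((dimH_mono ?_).trans hh.le) zero_le
  rintro _ ⟨y, ⟨hyW, hy1, hy2⟩, rfl⟩
  obtain ⟨_, hyU, hys⟩ := hWsub hyW
  have h1 : Φ y = (0, p (y - x)) := by rw [hΦ, hy2]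
  have h2 : φ (p (y - x)) = y := by
    change Φ.symm _ = y
    rw [← h1, Φ.left_inv hys]
  have h3 : p (y - x) ∈ U' := by
    refine ⟨?_, ?_⟩
    · change ((0 : ℝ), p (y - x)) ∈ Φ.target
      rw [← h1]; exact Φ.map_source hys
    · change φ (p (y - x)) ∈ W
      rw [h2]; exact hyW
  refine ⟨p (y - x), ⟨h3, ?_⟩, congrArg f h2⟩
  rw [fderiv_comp _ (by rw [h2]; exact (hf y hyU).differentiableAt (by simp))
    ((hφ _ h3).differentiableAt (by simp)), h2, hy1]
  simp

theorem sard (N : ℕ) : ∀ (E : Type) [NormedAddCommGroup E] [NormedSpace ℝ E]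
    [FiniteDimensional ℝ E], Module.finrank ℝ E = N → ∀ (f : E → ℝ) (U : Set E), IsOpen U →
    (∀ x ∈ U, ContDiffAt ℝ (⊤ : ℕ∞) f x) → dimH (f '' {x ∈ U | fderiv ℝ f x = 0}) = 0 := by
  induction N using Nat.strong_induction_on with
  | _ N ih =>
  intro E _ _ _ hN f U hU hf
  let S : ℕ → Set E := fun k => {x ∈ U | fderiv ℝ f x = 0 ∧ iteratedFDeriv ℝ k f x = 0 ∧
    iteratedFDeriv ℝ (k + 1) f x ≠ 0}
  let S' : Set E := {x ∈ U | ∀ j, 1 ≤ j → iteratedFDeriv ℝ j f x = 0}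
  have hcov : {x ∈ U | fderiv ℝ f x = 0} ⊆ S' ∪ ⋃ k, S k := by
    rintro x ⟨hxU, hx⟩
    by_cases h : ∃ k, iteratedFDeriv ℝ k f x = 0 ∧ iteratedFDeriv ℝ (k + 1) f x ≠ 0
    · obtain ⟨k, hk⟩ := h
      exact Or.inr (mem_iUnion.2 ⟨k, hxU, hx, hk⟩)
    · push Not at h
      refine Or.inl ⟨hxU, fun j hj => ?_⟩
      induction j, hj using Nat.le_induction with
      | base =>
        have h2 := norm_iteratedFDeriv_one (𝕜 := ℝ) (f := f) (x := x)
        rw [hx, norm_zero] at h2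
        exact norm_eq_zero.1 h2
      | succ j hj ihj => exact h j ihj
  have h1 : dimH (f '' S') = 0 := sard_flat f S' U hU (fun x hx => hx.1) hf (fun x hx => hx.2)
  have h2 : ∀ k, dimH (f '' S k) = 0 := by
    intro k
    apply dimH_local
    rintro x ⟨hxU, hx1, hx2, hx3⟩
    have hG : ∀ y ∈ U, ContDiffAt ℝ (⊤ : ℕ∞) (iteratedFDeriv ℝ k f) y := fun y hy =>
      (hf y hy).iteratedFDeriv_right (by exact_mod_cast le_top)
    have hd : fderiv ℝ (iteratedFDeriv ℝ k f) x ≠ 0 := by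
      intro h
      apply hx3
      have := norm_fderiv_iteratedFDeriv (𝕜 := ℝ) (f := f) (x := x) (n := k)
      rw [h] at this
      exact norm_eq_zero.1 (this.symm.trans ContinuousLinearMap.opNorm_zero)
    obtain ⟨v, hv⟩ : ∃ v, fderiv ℝ (iteratedFDeriv ℝ k f) x v ≠ 0 := by
      by_contra! h
      exact hd (ContinuousLinearMap.ext h)
    obtain ⟨l, hl⟩ := SeparatingDual.exists_ne_zero (R := ℝ) hv
    let g : E → ℝ := fun y => l (iteratedFDeriv ℝ k f y)
    have hg : ∀ y ∈ U, ContDiffAt ℝ (⊤ : ℕ∞) g y := fun y hy =>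
      l.contDiff.contDiffAt.comp y (hG y hy)
    have hgx : fderiv ℝ g x ≠ 0 := by
      intro h
      apply hl
      have h3 : HasFDerivAt g (l.comp (fderiv ℝ (iteratedFDeriv ℝ k f) x)) x :=
        l.hasFDerivAt.comp x ((hG x hxU).differentiableAt (by simp)).hasFDerivAt
      rw [h3.fderiv] at h
      exact congrArg (fun m => m v) h
    obtain ⟨W, hW, hW0⟩ := sard_step f g U hU hf hg x hxU hgx (by
      intro h U' hU' hh
      refine ih _ ?_ _ rfl h U' hU' hh
      rw [← hN]
      apply Submodule.finrank_lt
      intro htop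
      apply hgx
      ext v
      have : v ∈ (fderiv ℝ g x).ker := by rw [htop]; trivial
      simpa using this)
    refine ⟨S k ∩ W, inter_mem_nhdsWithin _ hW, le_antisymm ((dimH_mono ?_).trans hW0.le) zero_le⟩
    apply image_mono
    rintro y ⟨⟨_, hy1, hy2, _⟩, hyW⟩
    exact ⟨hyW, hy1, by simp [g, hy2]⟩
  refine le_antisymm ((dimH_mono (image_mono hcov)).trans ?_) zero_le
  rw [image_union, image_iUnion, dimH_union, dimH_iUnion, h1]
  simp [h2]

theorem exists_reparam (m a δ ε : ℝ) (hδ : 0 < δ) (ha : 0 < a - δ) (hm : a + δ < m) (hε : 0 < ε) :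
    ∃ f ρ : ℝ → ℝ, ContDiff ℝ (⊤ : ℕ∞) f ∧ (∀ s, HasDerivAt f (ρ s) s) ∧ (∀ s, 0 ≤ ρ s) ∧
      (∀ s, s ∉ Icc (a - δ) (a + δ) → ρ s ≤ 1) ∧ (∀ s, ρ s ≤ 1 + ε) ∧ (∀ s, s ≤ 0 → f s = 0) ∧
      f m = m := by
  let b : ContDiffBump a := ⟨δ / 2, δ, by linarith, by linarith⟩
  have hbc : Continuous b := b.continuous
  let I := ∫ s in (0:ℝ)..m, b s
  have hI : 0 < I := by
    exact intervalIntegral.integral_pos (by linarith) hbc.continuousOn (fun x _ => b.nonneg)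
      ⟨a, ⟨by linarith, by linarith⟩, b.pos_of_mem_ball (by simp [b, hδ])⟩
  let η := min m (ε * I)
  have hη : 0 < η := lt_min (by linarith) (by positivity)
  let θ : ℝ → ℝ := fun s => Real.smoothTransition (s / η)
  have hθc : Continuous θ := Real.smoothTransition.continuous.comp (continuous_id.div_const _)
  let loss := m - ∫ s in (0:ℝ)..m, θ s
  have hloss0 : 0 ≤ loss := by
    have : ∫ s in (0:ℝ)..m, θ s ≤ ∫ s in (0:ℝ)..m, (1:ℝ) :=
      intervalIntegral.integral_mono_on (by linarith) (hθc.intervalIntegrable _ _)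
        (by simp) (fun s _ => Real.smoothTransition.le_one _)
    simp at this
    simp only [loss]; linarith
  have hloss1 : loss ≤ η := by
    have h1 : (∫ s in (0:ℝ)..m, θ s) = (∫ s in (0:ℝ)..η, θ s) + ∫ s in η..m, θ s :=
      (intervalIntegral.integral_add_adjacent_intervals (hθc.intervalIntegrable _ _)
        (hθc.intervalIntegrable _ _)).symm
    have h2 : 0 ≤ ∫ s in (0:ℝ)..η, θ s :=
      intervalIntegral.integral_nonneg hη.le (fun s _ => Real.smoothTransition.nonneg _)
    have h3 : ∫ s in η..m, (1:ℝ) ≤ ∫ s in η..m, θ s :=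
      intervalIntegral.integral_mono_on (min_le_left _ _) (by simp) (hθc.intervalIntegrable _ _)
        (fun s hs => (Real.smoothTransition.one_of_one_le ((one_le_div hη).2 hs.1)).ge)
    simp at h3
    simp only [loss]; linarith
  let κ := loss / I
  have hκ0 : 0 ≤ κ := by positivity
  have hκ : κ ≤ ε := by
    rw [div_le_iff₀ hI]
    exact hloss1.trans (min_le_right _ _)
  let ρ : ℝ → ℝ := fun s => θ s + κ * b s
  have hρc : Continuous ρ := hθc.add (continuous_const.mul hbc)
  have hρs : ContDiff ℝ (⊤ : ℕ∞) ρ :=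
    (Real.smoothTransition.contDiff.comp (contDiff_id.div_const _)).add
      (contDiff_const.mul b.contDiff)
  let f : ℝ → ℝ := fun s => ∫ u in (0:ℝ)..s, ρ u
  have hf : ∀ s, HasDerivAt f (ρ s) s := fun s =>
    hρc.integral_hasStrictDerivAt 0 s |>.hasDerivAt
  have hb0 : ∀ s, s ∉ Icc (a - δ) (a + δ) → b s = 0 := by
    intro s hs
    apply b.zero_of_le_dist
    rw [Real.dist_eq]
    by_contra! h
    rw [abs_lt] at h
    exact hs ⟨by simp [b] at h; linarith, by simp [b] at h; linarith⟩
  refine ⟨f, ρ, ?_, hf, ?_, ?_, ?_, ?_, ?_⟩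
  · refine contDiff_infty_iff_deriv.2 ⟨fun s => (hf s).differentiableAt, ?_⟩
    rw [show deriv f = ρ from funext fun s => (hf s).deriv]
    exact hρs
  · intro s
    exact add_nonneg (Real.smoothTransition.nonneg _) (mul_nonneg hκ0 b.nonneg)
  · intro s hs
    simp only [ρ, hb0 s hs, mul_zero, add_zero]
    exact Real.smoothTransition.le_one _
  · intro s
    have h1 : θ s ≤ 1 := Real.smoothTransition.le_one _
    have h2 : κ * b s ≤ ε * 1 := mul_le_mul hκ b.le_one b.nonneg hε.le
    simp only [ρ]; linarith
  · intro s hs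
    simp only [f]
    rw [intervalIntegral.integral_congr (g := fun _ => (0:ℝ))]
    · simp
    · intro u hu
      rw [uIcc_of_ge hs] at hu
      have h1 : θ u = 0 := Real.smoothTransition.zero_of_nonpos (div_nonpos_of_nonpos_of_nonneg hu.2 hη.le)
      have h2 : b u = 0 := hb0 u (fun h => by linarith [h.1, hu.2])
      simp [ρ, h1, h2]
  · simp only [f, ρ]
    have hkb : Continuous fun s => κ * b s := continuous_const.mul hbc
    rw [intervalIntegral.integral_add (hθc.intervalIntegrable _ _)
      (hkb.intervalIntegrable _ _), intervalIntegral.integral_const_mul]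
    change _ + loss / I * I = m
    rw [div_mul_cancel₀ _ hI.ne']
    simp [loss]

theorem gronwall_two {E : Type} [NormedAddCommGroup E] [NormedSpace ℝ E] (X : E → E) (K : ℝ≥0)
    (hX : LipschitzWith K X) (γ σ : ℝ → E) (hγ : ∀ t, HasDerivAt γ (X (γ t)) t)
    (hσ : ∀ t, HasDerivAt σ (X (σ t)) t) (t : ℝ) :
    dist (γ t) (σ t) ≤ dist (γ 0) (σ 0) * Real.exp (K * |t|) := by
  have pos : ∀ (X : E → E), LipschitzWith K X → ∀ (γ σ : ℝ → E), (∀ t, HasDerivAt γ (X (γ t)) t) →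
      (∀ t, HasDerivAt σ (X (σ t)) t) → ∀ t, 0 ≤ t → 
      dist (γ t) (σ t) ≤ dist (γ 0) (σ 0) * Real.exp (K * t) := by
    intro X hX γ σ hγ hσ t ht
    have := dist_le_of_trajectories_ODE (v := fun _ => X) (a := 0) (b := t) (fun _ => hX)
      (fun s _ => (hγ s).continuousAt.continuousWithinAt) (fun s _ => (hγ s).hasDerivWithinAt)
      (fun s _ => (hσ s).continuousAt.continuousWithinAt) (fun s _ => (hσ s).hasDerivWithinAt)
      le_rfl t ⟨ht, le_rfl⟩
    simpa using this
  rcases le_total 0 t with ht | ht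
  · rw [abs_of_nonneg ht]; exact pos X hX γ σ hγ hσ t ht
  · have hneg : ∀ γ : ℝ → E, (∀ t, HasDerivAt γ (X (γ t)) t) →
        ∀ t, HasDerivAt (fun s => γ (-s)) ((fun x => - X x) (γ (-t))) t := by
      intro γ hγ t
      have := (hγ (-t)).scomp t (hasDerivAt_neg t)
      simp only [neg_smul, one_smul] at this
      exact this
    have := pos (fun x => - X x) hX.neg (fun s => γ (-s)) (fun s => σ (-s)) (hneg γ hγ) (hneg σ hσ)
      (-t) (by linarith)
    rw [abs_of_nonpos ht]
    simpa using this

theorem limit_orbit {E : Type} [NormedAddCommGroup E] [NormedSpace ℝ E] [CompleteSpace E]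
    (X : E → E) (K : ℝ≥0) (hX : LipschitzWith K X) (C : Set E) (hC : IsCompact C)
    (γ : ℕ → ℝ → E) (hγ : ∀ k t, HasDerivAt (γ k) (X (γ k t)) t) (T : ℕ → ℝ)
    (hT : Filter.Tendsto T Filter.atTop (𝓝 1)) (hper : ∀ k t, γ k (t + T k) = γ k t)
    (h0 : ∀ k, γ k 0 ∈ C) :
    ∃ σ : ℝ → E, (∀ t, HasDerivAt σ (X (σ t)) t) ∧ (∀ t, σ (t + 1) = σ t) ∧ σ 0 ∈ C := by
  obtain ⟨x, hxC, u, hu, hux⟩ := hC.tendsto_subseq h0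
  have hcau : ∀ t, CauchySeq (fun k => γ (u k) t) := by
    intro t
    rw [Metric.cauchySeq_iff]
    intro ε hε
    obtain ⟨N, hN⟩ := Metric.cauchySeq_iff.1 hux.cauchySeq (ε / Real.exp (K * |t|)) (by positivity)
    refine ⟨N, fun k hk l hl => ?_⟩
    have h1 := gronwall_two X K hX _ _ (hγ (u k)) (hγ (u l)) t
    have h2 := hN k hk l hl
    rw [lt_div_iff₀ (Real.exp_pos _)] at h2
    exact h1.trans_lt h2
  choose σ hσ using fun t => cauchySeq_tendsto_of_complete (hcau t)
  have hσ0 : σ 0 = x := tendsto_nhds_unique (hσ 0) hux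
  have hd : ∀ k t, dist (γ (u k) t) (σ t) ≤ dist (γ (u k) 0) (σ 0) * Real.exp (K * |t|) := by
    intro k t
    refine le_of_tendsto_of_tendsto (tendsto_const_nhds.dist (hσ t))
      ((tendsto_const_nhds.dist (hσ 0)).mul_const _) (Filter.Eventually.of_forall fun l => ?_)
    exact gronwall_two X K hX _ _ (hγ (u k)) (hγ (u l)) t
  have hd0 : Filter.Tendsto (fun k => dist (γ (u k) 0) (σ 0)) Filter.atTop (𝓝 0) :=
    tendsto_iff_dist_tendsto_zero.1 (hσ 0)
  have hunif : ∀ R, TendstoUniformlyOn (fun k => γ (u k)) σ Filter.atTop (ball 0 R) := by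
    intro R
    rw [Metric.tendstoUniformlyOn_iff]
    intro ε hε
    have h1 : Filter.Tendsto (fun k => dist (γ (u k) 0) (σ 0) * Real.exp (K * R)) Filter.atTop
        (𝓝 0) := by simpa using hd0.mul_const (Real.exp (K * R))
    filter_upwards [h1.eventually (gt_mem_nhds hε)] with k hk t ht
    rw [dist_comm]
    refine ((hd k t).trans ?_).trans_lt hk
    have : |t| ≤ R := by
      have := mem_ball.1 ht
      rw [Real.dist_eq, sub_zero] at this
      exact this.le
    gcongr
  have hsol : ∀ t, HasDerivAt σ (X (σ t)) t := by
    intro t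
    have ht : t ∈ ball (0:ℝ) (|t| + 1) := by simp
    have h1 : TendstoUniformlyOn (fun k => X ∘ γ (u k)) (X ∘ σ) Filter.atTop (ball 0 (|t| + 1)) :=
      hX.uniformContinuous.comp_tendstoUniformlyOn (hunif _)
    exact hasDerivAt_of_tendstoUniformlyOn isOpen_ball h1
      (Filter.Eventually.of_forall fun k s _ => hγ (u k) s) (fun s _ => hσ s) ht
  refine ⟨σ, hsol, fun t => ?_, hσ0 ▸ hxC⟩
  have hTu : Filter.Tendsto (fun k => t + T (u k)) Filter.atTop (𝓝 (t + 1)) :=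
    tendsto_const_nhds.add (hT.comp hu.tendsto_atTop)
  have h1 : Filter.Tendsto (fun k => γ (u k) (t + T (u k))) Filter.atTop (𝓝 (σ (t + 1))) := by
    have hmem : ball (0:ℝ) (|t + 1| + 1) ∈ 𝓝 (t + 1) :=
      isOpen_ball.mem_nhds (by simp)
    refine (hunif (|t + 1| + 1)).tendsto_comp (hsol _).continuousAt.continuousWithinAt ?_
    rwa [nhdsWithin_eq_nhds.2 hmem]
  simp only [hper] at h1
  exact tendsto_nhds_unique h1 (hσ t)

theorem inner_I_smul {n : ℕ} (v : Esp n) : ⟪v, Complex.I • v⟫ = 0 := by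
  rw [PiLp.inner_apply]
  apply Finset.sum_eq_zero
  intro i _
  simp [Complex.inner, mul_comm]

theorem hamVF_comp {n : ℕ} (H : Esp n → ℝ) (f ρ : ℝ → ℝ) (hH : Differentiable ℝ H)
    (hf : ∀ s, HasDerivAt f (ρ s) s) (x : Esp n) :
    hamVF (fun y => f (H y)) x = ρ (H x) • hamVF H x := by
  have h1 : HasFDerivAt (fun y => f (H y)) (ρ (H x) • fderiv ℝ H x) x :=
    (hf (H x)).comp_hasFDerivAt x (hH x).hasFDerivAt
  unfold hamVF gradient
  rw [h1.fderiv, map_smulₛₗ, smul_comm]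
  simp

theorem hamVF_lipschitz {n : ℕ} (H : Esp n → ℝ) (hH : ContDiff ℝ (⊤ : ℕ∞) H)
    (hc : IsCompact (tsupport H)) : ∃ K, LipschitzWith K (hamVF H) := by
  have h1 : ContDiff ℝ (⊤ : ℕ∞) (fderiv ℝ H) := hH.fderiv_right (by simp)
  have h2 : ContDiff ℝ (⊤ : ℕ∞) (hamVF H) :=
    ((InnerProductSpace.toDual ℝ (Esp n)).symm.contDiff.comp h1).const_smul Complex.I
  have h3 : HasCompactSupport (hamVF H) := by
    have h4 : HasCompactSupport (fderiv ℝ H) := HasCompactSupport.fderiv ℝ hc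
    exact h4.comp_left (g := fun l => Complex.I • (InnerProductSpace.toDual ℝ (Esp n)).symm l)
      (by simp)
  exact h2.lipschitzWith_of_hasCompactSupport h3 (by simp)

theorem hamVF_eq_zero {n : ℕ} (H : Esp n → ℝ) (x : Esp n) (h : hamVF H x = 0) :
    fderiv ℝ H x = 0 := by
  unfold hamVF gradient at h
  simpa using h

theorem const_of_deriv_zero {E : Type} [NormedAddCommGroup E] [NormedSpace ℝ E] (γ : ℝ → E)
    (h : ∀ t, HasDerivAt γ 0 t) (s t : ℝ) : γ s = γ t :=
  is_const_of_deriv_eq_zero (fun t => (h t).differentiableAt) (fun t => (h t).deriv) s t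

/-- Existence of an interval of regular values. -/
theorem exists_band {n : ℕ} (H : Esp n → ℝ) (hH : ContDiff ℝ (⊤ : ℕ∞) H)
    (hc : IsCompact (tsupport H)) (m : ℝ) (hm : 0 < m) :
    ∃ a δ : ℝ, 0 < δ ∧ 0 < a - δ ∧ a + δ < m ∧
      ∀ x, H x ∈ Icc (a - δ) (a + δ) → fderiv ℝ H x ≠ 0 := by
  have hs := sard _ (Esp n) rfl H univ isOpen_univ (fun x _ => hH.contDiffAt)
  have hd : Dense (H '' {x ∈ univ | fderiv ℝ H x = 0})ᶜ := by
    apply dense_compl_of_dimH_lt_finrank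
    rw [hs]; simp
  obtain ⟨a, ⟨ha0, ham⟩, ha⟩ := hd.inter_open_nonempty (Ioo 0 m) isOpen_Ioo (nonempty_Ioo.2 hm)
  have hR : IsCompact (H '' (tsupport H ∩ {x | fderiv ℝ H x = 0})) := by
    apply IsCompact.image _ hH.continuous
    apply hc.inter_right
    exact isClosed_eq (hH.continuous_fderiv (by simp)) continuous_const
  have haR : a ∈ (H '' (tsupport H ∩ {x | fderiv ℝ H x = 0}))ᶜ := by
    rintro ⟨x, hx, rfl⟩
    exact ha ⟨x, ⟨trivial, hx.2⟩, rfl⟩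
  obtain ⟨r, hr, hrs⟩ := Metric.isOpen_iff.1 hR.isClosed.isOpen_compl a haR
  obtain ⟨δ, hδ, h1⟩ := exists_between (lt_min hr (lt_min ha0 (sub_pos.2 ham)))
  have h2 := h1.trans_le (min_le_left _ _)
  have h3 := (h1.trans_le (min_le_right _ _)).trans_le (min_le_left _ _)
  have h4 := (h1.trans_le (min_le_right _ _)).trans_le (min_le_right _ _)
  refine ⟨a, δ, hδ, by linarith, by linarith, fun x hx hx0 => ?_⟩
  have hxs : x ∈ tsupport H := by
    apply subset_tsupport
    have := hx.1
    exact ne_of_gt (by linarith : 0 < H x)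
  have hb : H x ∈ ball a r := by
    rw [mem_ball, Real.dist_eq, abs_lt]
    constructor <;> linarith [hx.1, hx.2]
  exact hrs hb ⟨x, ⟨hxs, hx0⟩, rfl⟩

/-- On a compact band of regular values the periods are uniformly larger than one. -/
theorem exists_gap {n : ℕ} (H : Esp n → ℝ) (hH : ContDiff ℝ (⊤ : ℕ∞) H)
    (hc : IsCompact (tsupport H)) (hno : ¬ HasFastOrbit H) (p q : ℝ) (hp : 0 < p)
    (hreg : ∀ x, H x ∈ Icc p q → fderiv ℝ H x ≠ 0) :
    ∃ ε : ℝ, 0 < ε ∧ ∀ γ T, IsPeriodicOrbit H γ T → H (γ 0) ∈ Icc p q → 1 + ε < T := by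
  by_contra! hcon
  choose γ T hper hband hle using fun k : ℕ => hcon (1 / ((k : ℝ) + 1)) (by positivity)
  obtain ⟨K, hK⟩ := hamVF_lipschitz H hH hc
  have hT1 : ∀ k, 1 < T k := by
    intro k
    by_contra! h
    exact hno ⟨γ k, T k, hper k, h⟩
  have hT : Filter.Tendsto T Filter.atTop (𝓝 1) := by
    have h1 : Filter.Tendsto (fun k : ℕ => 1 + 1 / ((k : ℝ) + 1)) Filter.atTop (𝓝 1) := by
      simpa using tendsto_one_div_add_atTop_nhds_zero_nat.const_add (1 : ℝ)
    exact tendsto_of_tendsto_of_tendsto_of_le_of_le tendsto_const_nhds h1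
      (fun k => (hT1 k).le) hle
  have hC : IsCompact (tsupport H ∩ H ⁻¹' Icc p q) :=
    hc.inter_right (isClosed_Icc.preimage hH.continuous)
  obtain ⟨σ, hσ, hσp, hσ0⟩ := limit_orbit (hamVF H) K hK _ hC γ (fun k => (hper k).2.1) T hT
    (fun k => (hper k).2.2.1) (fun k => ⟨subset_tsupport _ (by
      have := (hband k).1
      exact ne_of_gt (by linarith : 0 < H (γ k 0))), hband k⟩)
  refine hno ⟨σ, 1, ⟨one_pos, hσ, hσp, ?_⟩, le_rfl⟩
  by_contra! hconst
  apply hreg _ hσ0.2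
  apply hamVF_eq_zero
  have h1 : σ = fun _ => σ 0 := funext fun t => hconst t 0
  have h2 : HasDerivAt σ 0 0 := by
    rw [h1]; exact hasDerivAt_const _ _
  exact (hσ 0).unique h2

theorem no_fast_comp {n : ℕ} (H : Esp n → ℝ) (hH : ContDiff ℝ (⊤ : ℕ∞) H)
    (hno : ¬ HasFastOrbit H) (p q ε : ℝ)
    (hgap : ∀ γ T, IsPeriodicOrbit H γ T → H (γ 0) ∈ Icc p q → 1 + ε < T)
    (f ρ : ℝ → ℝ) (hf : ∀ s, HasDerivAt f (ρ s) s) (hρ0 : ∀ s, 0 ≤ ρ s)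
    (hρ1 : ∀ s, s ∉ Icc p q → ρ s ≤ 1) (hρ2 : ∀ s, ρ s ≤ 1 + ε) :
    ¬ HasFastOrbit (fun x => f (H x)) := by
  rintro ⟨γ, T, ⟨hT, hγ, hper, t₀, t₁, hne⟩, hT1⟩
  have hHd : Differentiable ℝ H := hH.differentiable (by simp)
  simp only [hamVF_comp H f ρ hHd hf] at hγ
  have hcons : ∀ t, H (γ t) = H (γ 0) := by
    intro t
    refine const_of_deriv_zero (fun s => H (γ s)) (fun s => ?_) t 0
    have h1 := (hHd (γ s)).hasFDerivAt.comp_hasDerivAt s (hγ s)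
    have h2 : fderiv ℝ H (γ s) (ρ (H (γ s)) • hamVF H (γ s)) = 0 := by
      rw [map_smul, ← inner_gradient_left]
      unfold hamVF
      rw [inner_I_smul, smul_zero]
    rw [h2] at h1
    exact h1
  simp only [hcons] at hγ
  set c := H (γ 0) with hcdef
  rcases (hρ0 c).eq_or_lt with h0 | hpos
  · rw [← h0] at hγ
    simp only [zero_smul] at hγ
    exact hne (const_of_deriv_zero γ hγ t₀ t₁)
  · have horb : IsPeriodicOrbit H (fun t => γ ((ρ c)⁻¹ * t)) (ρ c * T) := by
      refine ⟨by positivity, fun t => ?_, fun t => ?_, ρ c * t₀, ρ c * t₁, ?_⟩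
      · have h1 := (hγ ((ρ c)⁻¹ * t)).scomp t ((hasDerivAt_id t).const_mul (ρ c)⁻¹)
        rw [mul_one, smul_smul, inv_mul_cancel₀ hpos.ne', one_smul] at h1
        exact h1
      · have : (ρ c)⁻¹ * (t + ρ c * T) = (ρ c)⁻¹ * t + T := by field_simp
        simp only [this, hper]
      · simpa [inv_mul_cancel_left₀ hpos.ne'] using hne
    by_cases hb : c ∈ Icc p q
    · have h1 := hgap _ _ horb (by simpa using hb)
      have h2 := hρ2 c
      nlinarith
    · refine hno ⟨_, _, horb, ?_⟩
      have := hρ1 c hb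
      nlinarith

/-- **Lemma 5.2 of Ginzburg–Gürel** for open subsets of standard `ℝ^{2n}`: if
`H ∈ 𝓗(V, Z)` has no fast nonconstant periodic orbit, then there is a
nonnegative `K ∈ 𝓗(V, Z)` with `max K = max H` (the common value being
attained on `Z`) and no fast nonconstant periodic orbit. -/
theorem stmt_13 (n : ℕ) (hn : 1 ≤ n) (V Z : Set (Esp n)) (hV : IsOpen V)
    (hZcpt : IsCompact Z) (hZne : Z.Nonempty) (hZV : Z ⊆ V)
    (H : Esp n → ℝ) (hH : InHclass V Z H) (hnofast : ¬ HasFastOrbit H) :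
    ∃ K : Esp n → ℝ, InHclass V Z K ∧ (∀ x, 0 ≤ K x) ∧
      (∀ z ∈ Z, K z = H z) ∧ ¬ HasFastOrbit K := by
  obtain ⟨hsm, hcs, hsV, ⟨U, hU, hZU, c, hUc⟩, hmax⟩ := hH
  obtain ⟨z₀, hz₀⟩ := hZne
  have hHd : Differentiable ℝ H := hsm.differentiable (by simp)
  have hval : ∀ z ∈ Z, H z = H z₀ := fun z hz => le_antisymm (hmax z₀ hz₀ z) (hmax z hz z₀)
  have hm0 : 0 ≤ H z₀ := by
    haveI : Nonempty (Fin n) := ⟨⟨0, hn⟩⟩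
    haveI : Nontrivial (Esp n) := inferInstance
    haveI : NoncompactSpace (Esp n) := NormedSpace.noncompactSpace ℝ (Esp n)
    obtain ⟨x, hx⟩ := (ne_univ_iff_exists_notMem _).1 hcs.ne_univ
    have h1 := hmax z₀ hz₀ x
    rwa [image_eq_zero_of_notMem_tsupport hx] at h1
  rcases hm0.eq_or_lt with hm | hm
  · refine ⟨fun _ => 0, ⟨contDiff_const, ?_, ?_, ⟨univ, isOpen_univ, subset_univ _, 0, by simp⟩,
      by simp⟩, by simp, fun z hz => by rw [hval z hz, hm], ?_⟩
    · rw [show (fun _ : Esp n => (0:ℝ)) = 0 from rfl, tsupport_zero]; exact isCompact_empty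
    · rw [show (fun _ : Esp n => (0:ℝ)) = 0 from rfl, tsupport_zero]; exact empty_subset _
    · rintro ⟨γ, T, ⟨_, hγ, _, t₀, t₁, hne⟩, _⟩
      refine hne (const_of_deriv_zero γ (fun t => ?_) t₀ t₁)
      have h1 := hγ t
      unfold hamVF at h1
      rwa [gradient_fun_const, smul_zero] at h1
  · obtain ⟨a, δ, hδ, ha, ham, hreg⟩ := exists_band H hsm hcs (H z₀) hm
    obtain ⟨ε, hε, hgap⟩ := exists_gap H hsm hcs hnofast (a - δ) (a + δ) ha hreg
    obtain ⟨f, ρ, hfs, hf, hρ0, hρ1, hρ2, hf0, hfm⟩ := exists_reparam (H z₀) a δ ε hδ ha ham hε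
    have hmono : Monotone f := monotone_of_hasDerivAt_nonneg hf (fun s => hρ0 s)
    have hts : tsupport (fun x => f (H x)) ⊆ tsupport H := tsupport_comp_subset (hf0 0 le_rfl) H
    refine ⟨fun x => f (H x), ⟨hfs.comp hsm, hcs.of_isClosed_subset (isClosed_tsupport _) hts,
      hts.trans hsV, ⟨U, hU, hZU, f c, fun x hx => by simp only [hUc x hx]⟩,
      fun z hz x => hmono (hmax z hz x)⟩, fun x => ?_, fun z hz => ?_, 
      no_fast_comp H hsm hnofast _ _ ε hgap f ρ hf hρ0 hρ1 hρ2⟩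
    · rw [← hf0 (min 0 (H x)) (min_le_left _ _)]
      exact hmono (min_le_right _ _)
    · simp only [hval z hz, hfm]
end
end
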